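/- Let n ≥ 2, let U ⊆ ℝⁿ be open and connected, let a_{ij} : U → ℝ (1 ≤ i,j ≤ n) be smooth with a_{ij} = a_{ji} and ∑_{i,j} a_{ij}(x) ξᵢ ξⱼ > 0 for all x ∈ U and ξ ∈ ℝⁿ \ {0}, and let F : U × ℝ × ℝⁿ → ℝ be smooth with F(x, 0, 0) = 0 for all x ∈ U. Let u : U → ℝ be a smooth solution of −∑_{i,j} a_{ij}(x) (∂²u/∂xᵢ∂xⱼ)(x) + F(x, u(x), ∇u(x)) = 0 with u not identically zero. Then the nodal set N(u) = u⁻¹(0) is countably (n−1)-C∞-rectifiable and has locally finite (n−1)-dimensional Hausdorff measure: every p ∈ U admits r > 0 with μH^{n−1}(N(u) ∩ B(p,r)) < ∞. -/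

import Mathlib

open MeasureTheory Metric Set Filter Topology ENNReal NNReal

noncomputable section

/-- `m`-dimensional Euclidean space. -/
abbrev Euc (m : ℕ) := EuclideanSpace ℝ (Fin m)

/-- The semilinear first-order differential operator `φ ↦ ∑ⱼ Aⱼ(x) ∂φ/∂xⱼ + V(x, φ(x))`
applied to `φ` at the point `x`. -/
def semilinApply {n N : ℕ} (A : Fin n → Euc n → Matrix (Fin N) (Fin N) ℝ)
    (V : Euc n → (Fin N → ℝ) → (Fin N → ℝ)) (φ : Euc n → (Fin N → ℝ)) (x : Euc n) :
    Fin N → ℝ :=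
  (∑ j, (A j x).mulVec (fderiv ℝ φ x (EuclideanSpace.single j 1))) + V x (φ x)

/-- Ellipticity of the principal symbol `ξ ↦ ∑ⱼ ξⱼ Aⱼ(x)` at every point of `U`. -/
def IsElliptic {n N : ℕ} (A : Fin n → Euc n → Matrix (Fin N) (Fin N) ℝ)
    (U : Set (Euc n)) : Prop :=
  ∀ x ∈ U, ∀ ξ : Euc n, ξ ≠ 0 → IsUnit (∑ j, ξ j • A j x)

/-- A set `S ⊆ ℝⁿ` is countably `m`-`C^∞`-rectifiable if it is contained in a countable
union of ranges of smooth maps `ℝᵐ → ℝⁿ`. -/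
def CountablyCinfRectifiable {n : ℕ} (m : ℕ) (S : Set (Euc n)) : Prop :=
  ∃ g : ℕ → (Euc m → Euc n), (∀ i, ContDiff ℝ (⊤ : ℕ∞) (g i)) ∧ S ⊆ ⋃ i, range (g i)

/-- The scalar semilinear second-order operator
`u ↦ −∑_{i,j} a_{ij}(x) ∂²u/∂xᵢ∂xⱼ + F(x, u(x), ∇u(x))` applied to `u` at `x`. -/
def scalarOp {n : ℕ} (a : Fin n → Fin n → Euc n → ℝ)
    (F : Euc n → ℝ → Euc n → ℝ) (u : Euc n → ℝ) (x : Euc n) : ℝ :=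
  -(∑ i, ∑ j, a i j x *
      iteratedFDeriv ℝ 2 u x ![EuclideanSpace.single i 1, EuclideanSpace.single j 1])
    + F x (u x) (gradient u x)

namespace NodalSet

section

variable {n : ℕ}

/-- Directional derivative of a real function in the direction `ξ`. -/
def dd (ξ : Euc n) (f : Euc n → ℝ) (x : Euc n) : ℝ := fderiv ℝ f x ξ

/-- The standard basis vectors of Euclidean space. -/
def bv (i : Fin n) : Euc n := EuclideanSpace.single i 1

lemma norm_bv (i : Fin n) : ‖bv i‖ = 1 := by simp [bv]

lemma bv_apply (i j : Fin n) : (bv i : Euc n) j = if i = j then 1 else 0 := by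
  simp [bv, eq_comm]

lemma sum_smul_bv (ξ : Euc n) : ∑ i, ξ i • bv i = ξ := by
  ext j
  simp [bv_apply]

lemma dd_eq_sum (ξ : Euc n) (f : Euc n → ℝ) (x : Euc n) :
    dd ξ f x = ∑ i, ξ i * dd (bv i) f x := by
  conv_lhs => rw [dd, ← sum_smul_bv ξ]
  simp [dd, map_sum]

lemma contDiff_dd {f : Euc n → ℝ} (hf : ContDiff ℝ (⊤ : ℕ∞) f) (ξ : Euc n) :
    ContDiff ℝ (⊤ : ℕ∞) (dd ξ f) :=
  (hf.fderiv_right (by simp)).clm_apply contDiff_const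

lemma dd_mul {f g : Euc n → ℝ} {x : Euc n} (hf : DifferentiableAt ℝ f x)
    (hg : DifferentiableAt ℝ g x) (ξ : Euc n) :
    dd ξ (fun y => f y * g y) x = dd ξ f x * g x + f x * dd ξ g x := by
  simp only [dd]
  rw [fderiv_fun_mul hf hg]
  simp
  ring

lemma dd_add {f g : Euc n → ℝ} {x : Euc n} (hf : DifferentiableAt ℝ f x)
    (hg : DifferentiableAt ℝ g x) (ξ : Euc n) :
    dd ξ (fun y => f y + g y) x = dd ξ f x + dd ξ g x := by
  simp only [dd]
  rw [fderiv_fun_add hf hg]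
  simp

lemma dd_sum {ι : Type*} (s : Finset ι) {f : ι → Euc n → ℝ} {x : Euc n}
    (hf : ∀ i ∈ s, DifferentiableAt ℝ (f i) x) (ξ : Euc n) :
    dd ξ (fun y => ∑ i ∈ s, f i y) x = ∑ i ∈ s, dd ξ (f i) x := by
  simp only [dd]
  rw [fderiv_fun_sum hf]
  simp

lemma dd_coord (ξ : Euc n) (i : Fin n) (x : Euc n) : dd ξ (fun y => y i) x = ξ i := by
  have : HasFDerivAt (fun y : Euc n => y i) (EuclideanSpace.proj i : Euc n →L[ℝ] ℝ) x :=
    (EuclideanSpace.proj i : Euc n →L[ℝ] ℝ).hasFDerivAt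
  rw [dd, this.fderiv]
  rfl

lemma dd_const (ξ : Euc n) (c : ℝ) (x : Euc n) : dd ξ (fun _ => c) x = 0 := by
  simp [dd]

lemma dd_comm {f : Euc n → ℝ} (hf : ContDiff ℝ (⊤ : ℕ∞) f) (ξ η : Euc n) (x : Euc n) :
    dd ξ (dd η f) x = dd η (dd ξ f) x := by
  have h1 : DifferentiableAt ℝ (fderiv ℝ f) x :=
    ((hf.fderiv_right (m := 1) (by norm_cast)).differentiable (by norm_num)) x
  have hs : IsSymmSndFDerivAt ℝ f x :=
    (hf.contDiffAt).isSymmSndFDerivAt (by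
      simp only [minSmoothness_of_isRCLikeNormedField]; norm_cast)
  have key : ∀ ξ η : Euc n, dd ξ (dd η f) x = fderiv ℝ (fderiv ℝ f) x ξ η := by
    intro ξ η
    change fderiv ℝ (fun y => fderiv ℝ f y η) x ξ = _
    rw [fderiv_clm_apply h1 (differentiableAt_const _)]
    simp
  rw [key, key]
  exact hs ξ η

lemma dd_radial {φ : ℝ → ℝ} {φ' : ℝ} {x : Euc n} (hx : x ≠ 0) (h : HasDerivAt φ φ' ‖x‖)
    (i : Fin n) : dd (bv i) (fun y => φ ‖y‖) x = φ' / ‖x‖ * x i := by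
  have h1 : HasFDerivAt (fun y : Euc n => ‖y‖) (‖x‖⁻¹ • innerSL ℝ x) x := by
    have h2 := (hasStrictFDerivAt_norm_sq x).hasFDerivAt.sqrt
      (by simpa using hx)
    simp only [Real.sqrt_sq (norm_nonneg _)] at h2
    refine h2.congr_fderiv ?_
    ext y
    simp
    ring
  have h3 := h.comp_hasFDerivAt x h1
  have h4 : fderiv ℝ (fun y => φ ‖y‖) x = φ' • ‖x‖⁻¹ • innerSL ℝ x := h3.fderiv
  rw [dd, h4]
  simp [bv, EuclideanSpace.inner_single_right]
  field_simp

lemma dd_eq_zero_of_notMem_tsupport {f : Euc n → ℝ} {x : Euc n} (hx : x ∉ tsupport f)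
    (ξ : Euc n) : dd ξ f x = 0 := by
  have : f =ᶠ[𝓝 x] fun _ => 0 := notMem_tsupport_iff_eventuallyEq.mp hx
  rw [dd, this.fderiv_eq]
  simp

lemma tsupport_dd_subset (f : Euc n → ℝ) (ξ : Euc n) : tsupport (dd ξ f) ⊆ tsupport f :=
  closure_minimal (fun x hx => by
    by_contra h
    exact hx (dd_eq_zero_of_notMem_tsupport h ξ)) (isClosed_tsupport f)

lemma contDiff_mul_of_contDiffOn_compl {m : WithTop ℕ∞} {q f : Euc n → ℝ}
    (hq : ContDiffOn ℝ m q {0}ᶜ) (hf : ContDiff ℝ m f) (h0 : (0 : Euc n) ∉ tsupport f) :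
    ContDiff ℝ m (fun x => q x * f x) := by
  rw [contDiff_iff_contDiffAt]
  intro x
  by_cases hx : x = 0
  · subst hx
    have : (fun x => q x * f x) =ᶠ[𝓝 0] fun _ => 0 := by
      filter_upwards [notMem_tsupport_iff_eventuallyEq.mp h0] with y hy
      simp [hy]
    exact contDiffAt_const.congr_of_eventuallyEq this
  · exact (hq.contDiffAt (isOpen_compl_singleton.mem_nhds hx)).mul hf.contDiffAt

lemma integral_dd_eq_zero {g : Euc n → ℝ} (hg : ContDiff ℝ 1 g) (hc : HasCompactSupport g)
    (ξ : Euc n) : Integrable (dd ξ g) ∧ ∫ x, dd ξ g x = 0 := by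
  have hcont : Continuous (dd ξ g) := by
    have := hg.continuous_fderiv (by norm_num)
    exact this.clm_apply continuous_const
  have hi : Integrable (dd ξ g) :=
    hcont.integrable_of_hasCompactSupport (hc.mono' (subset_trans subset_closure
      (tsupport_dd_subset g ξ)))
  refine ⟨hi, ?_⟩
  have := integral_mul_fderiv_eq_neg_fderiv_mul_of_integrable (μ := (volume : Measure (Euc n)))
    (f := fun _ => (1 : ℝ)) (g := g) (v := ξ) (by simp)
    (by simpa using! hi) (by simpa using hg.continuous.integrable_of_hasCompactSupport hc)
    (by fun_prop) (fun x _ => hg.differentiable (by norm_num) x)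
  simpa [dd] using this

lemma integral_dd_mul_eq_zero {q f : Euc n → ℝ}
    (hq : ContDiffOn ℝ (⊤ : ℕ∞) q {0}ᶜ) (hf : ContDiff ℝ (⊤ : ℕ∞) f)
    (h0 : (0 : Euc n) ∉ tsupport f) (hc : HasCompactSupport f) (ξ : Euc n) :
    Integrable (dd ξ (fun x => q x * f x)) ∧ ∫ x, dd ξ (fun x => q x * f x) x = 0 :=
  integral_dd_eq_zero ((contDiff_mul_of_contDiffOn_compl hq hf h0).of_le (by norm_cast))
    hc.mul_left ξ

end

/-- Kronecker delta. -/
def kd {n : ℕ} (i j : Fin n) : ℝ := if i = j then 1 else 0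

lemma kd_le {n : ℕ} (i j : Fin n) : |kd i j| ≤ 1 := by
  unfold kd; split_ifs <;> simp

/-- Pointwise bounds expressing that a coefficient matrix is close to the identity. -/
structure CoeffBound {n : ℕ} (A : Fin n → Fin n → ℝ) (dA : Fin n → Fin n → Fin n → ℝ)
    (x : Fin n → ℝ) (r Λ : ℝ) : Prop where
  one_le_n : (1 : ℝ) ≤ n
  r_nonneg : 0 ≤ r
  r_le : r ≤ 1
  one_le_lam : 1 ≤ Λ
  lam_r : Λ * r ≤ 1
  hx : ∀ i, |x i| ≤ r
  hA : ∀ i j, |A i j - kd i j| ≤ Λ * r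
  hdA : ∀ l i j, |dA l i j| ≤ Λ

/-- The vector field `a(x) x`. -/
def bb {n : ℕ} (A : Fin n → Fin n → ℝ) (x : Fin n → ℝ) (k : Fin n) : ℝ := ∑ m, A k m * x m

/-- The derivative of the vector field `a(x) x`. -/
def db {n : ℕ} (A : Fin n → Fin n → ℝ) (dA : Fin n → Fin n → Fin n → ℝ)
    (x : Fin n → ℝ) (l k : Fin n) : ℝ := A k l + ∑ m, dA l k m * x m

lemma abs_sum_le_card_mul {n : ℕ} {f : Fin n → ℝ} {B : ℝ} (h : ∀ i, |f i| ≤ B) :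
    |∑ i, f i| ≤ n * B := by
  calc |∑ i, f i| ≤ ∑ i, |f i| := Finset.abs_sum_le_sum_abs _ _
    _ ≤ ∑ _i : Fin n, B := Finset.sum_le_sum fun i _ => h i
    _ = n * B := by simp

lemma abs_sum_sub_sum_le {n : ℕ} {f f0 : Fin n → ℝ} {B : ℝ} (h : ∀ i, |f i - f0 i| ≤ B) :
    |∑ i, f i - ∑ i, f0 i| ≤ n * B := by
  rw [← Finset.sum_sub_distrib]
  exact abs_sum_le_card_mul h

lemma abs_mul_sub_mul_le {p q p0 q0 B C P Q : ℝ} (h1 : |p - p0| ≤ B) (h2 : |q - q0| ≤ C)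
    (h3 : |q| ≤ Q) (h4 : |p0| ≤ P) : |p * q - p0 * q0| ≤ B * Q + P * C := by
  have e : p * q - p0 * q0 = (p - p0) * q + p0 * (q - q0) := by ring
  rw [e]
  refine (abs_add_le _ _).trans ?_
  rw [abs_mul, abs_mul]
  have := abs_nonneg (p - p0)
  have := abs_nonneg (q - q0)
  have := abs_nonneg q
  have := abs_nonneg p0
  gcongr <;> linarith

lemma abs_mul_le {p q P Q : ℝ} (h1 : |p| ≤ P) (h2 : |q| ≤ Q) : |p * q| ≤ P * Q := by
  rw [abs_mul]
  have := abs_nonneg p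
  have := abs_nonneg q
  gcongr
  linarith

namespace CoeffBound

variable {n : ℕ} {A : Fin n → Fin n → ℝ} {dA : Fin n → Fin n → Fin n → ℝ}
  {x : Fin n → ℝ} {r Λ : ℝ}

lemma b_sub (h : CoeffBound A dA x r Λ) (k : Fin n) : |bb A x k - x k| ≤ n * Λ * r ^ 2 := by
  have e : x k = ∑ m, kd k m * x m := by simp [kd]
  rw [bb, e]
  refine (abs_sum_sub_sum_le (B := Λ * r * r) fun m => ?_).trans (le_of_eq (by ring))
  rw [← sub_mul]
  exact abs_mul_le (h.hA k m) (h.hx m)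

lemma lr2 (h : CoeffBound A dA x r Λ) : Λ * r ^ 2 ≤ r := by
  nlinarith [h.lam_r, h.r_nonneg]

lemma b_le (h : CoeffBound A dA x r Λ) (k : Fin n) : |bb A x k| ≤ 2 * n * r := by
  have h1 := h.b_sub k
  have h2 := h.hx k
  have h3 := abs_le.mp h1
  have h4 := abs_le.mp h2
  have h5 : n * Λ * r ^ 2 ≤ n * r := by
    rw [mul_assoc]; exact mul_le_mul_of_nonneg_left h.lr2 (by positivity)
  have h6 : r ≤ n * r := le_mul_of_one_le_left h.r_nonneg h.one_le_n
  rw [abs_le]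
  constructor <;> linarith

lemma db_sub (h : CoeffBound A dA x r Λ) (l k : Fin n) :
    |db A dA x l k - kd k l| ≤ 2 * n * Λ * r := by
  have h1 := abs_le.mp (h.hA k l)
  have h2 : |∑ m, dA l k m * x m| ≤ n * (Λ * r) :=
    abs_sum_le_card_mul fun m => abs_mul_le (h.hdA l k m) (h.hx m)
  have h3 := abs_le.mp h2
  have h0 : 0 ≤ Λ * r := mul_nonneg (by linarith [h.one_le_lam]) h.r_nonneg
  have h6 : Λ * r ≤ n * (Λ * r) := le_mul_of_one_le_left h0 h.one_le_n
  rw [abs_le, db]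
  constructor <;> linarith

lemma db_le (h : CoeffBound A dA x r Λ) (l k : Fin n) : |db A dA x l k| ≤ 3 * n := by
  have h1 := abs_le.mp (h.db_sub l k)
  have h2 := abs_le.mp (kd_le k l)
  have h3 : 2 * n * Λ * r ≤ 2 * n := by
    have := mul_le_mul_of_nonneg_left h.lam_r (show (0 : ℝ) ≤ 2 * n by positivity)
    linarith
  have := h.one_le_n
  rw [abs_le]
  constructor <;> linarith

lemma Adb (h : CoeffBound A dA x r Λ) (i j l k : Fin n) :
    |A i j * db A dA x l k - kd i j * kd k l| ≤ 5 * n * Λ * r :=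
  (abs_mul_sub_mul_le (h.hA i j) (h.db_sub l k) (h.db_le l k) (kd_le i j)).trans
    (le_of_eq (by ring))

lemma dAb (h : CoeffBound A dA x r Λ) (l i j k : Fin n) :
    |dA l i j * bb A x k| ≤ 2 * n * Λ * r :=
  (abs_mul_le (h.hdA l i j) (h.b_le k)).trans (le_of_eq (by ring))

/-- The weight-free part of the derivative of `a_{ij} (a x)_k`. -/
def dab (A : Fin n → Fin n → ℝ) (dA : Fin n → Fin n → Fin n → ℝ)
    (x : Fin n → ℝ) (l i j k : Fin n) : ℝ :=
  dA l i j * bb A x k + A i j * db A dA x l k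

lemma dab_sub (h : CoeffBound A dA x r Λ) (l i j k : Fin n) :
    |dab A dA x l i j k - kd i j * kd k l| ≤ 7 * n * Λ * r := by
  have h1 := abs_le.mp (h.Adb i j l k)
  have h2 := abs_le.mp (h.dAb l i j k)
  rw [abs_le, dab]
  constructor <;> linarith

lemma rellich (h : CoeffBound A dA x r Λ) {g : Fin n → ℝ} {γ : ℝ}
    (hg : ∀ i, |g i| ≤ γ) (hg2 : ∑ i, g i ^ 2 = γ ^ 2) :
    |∑ i, ∑ j, ∑ k, (dab A dA x i i j k * (g j * g k) + dab A dA x j i j k * (g i * g k)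
      - dab A dA x k i j k * (g i * g j)) - (2 - n) * γ ^ 2| ≤ 21 * n ^ 4 * Λ * r * γ ^ 2 := by
  have e : (2 - n) * γ ^ 2 = ∑ i, ∑ j, ∑ k, (kd i j * kd k i * (g j * g k)
      + kd i j * kd k j * (g i * g k) - kd i j * kd k k * (g i * g j)) := by
    simp only [Finset.sum_add_distrib, Finset.sum_sub_distrib, kd, ← hg2]
    simp
    simp only [← pow_two]
    rw [← Finset.mul_sum]
    ring
  rw [e]
  have hgg : ∀ i j, |g i * g j| ≤ γ * γ := fun i j => abs_mul_le (hg i) (hg j)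
  have key : ∀ l i j k p q, |dab A dA x l i j k * (g p * g q) - kd i j * kd k l * (g p * g q)|
      ≤ 7 * n * Λ * r * (γ * γ) := by
    intro l i j k p q
    rw [← sub_mul]
    exact abs_mul_le (h.dab_sub l i j k) (hgg p q)
  refine (abs_sum_sub_sum_le fun i => abs_sum_sub_sum_le fun j => abs_sum_sub_sum_le
    (B := 21 * n * Λ * r * (γ * γ)) fun k => ?_).trans (le_of_eq (by ring))
  have h1 := abs_le.mp (key i i j k j k)
  have h2 := abs_le.mp (key j i j k i k)
  have h3 := abs_le.mp (key k i j k i j)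
  rw [abs_le]
  constructor <;> linarith

lemma quad (h : CoeffBound A dA x r Λ) {g : Fin n → ℝ} {γ : ℝ}
    (hg : ∀ i, |g i| ≤ γ) (hg2 : ∑ i, g i ^ 2 = γ ^ 2) :
    |∑ i, ∑ j, A i j * (g i * g j) - γ ^ 2| ≤ n ^ 2 * Λ * r * γ ^ 2 := by
  have e : γ ^ 2 = ∑ i, ∑ j, kd i j * (g i * g j) := by
    simp [kd, ← hg2, pow_two]
  rw [e]
  have e2 : n ^ 2 * Λ * r * (∑ i, ∑ j, kd i j * (g i * g j)) = n * (n * (Λ * r * (γ * γ))) := by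
    rw [← e]; ring
  rw [e2]
  refine abs_sum_sub_sum_le fun i => abs_sum_sub_sum_le fun j => ?_
  rw [← sub_mul]
  exact abs_mul_le (h.hA i j) (abs_mul_le (hg i) (hg j))

lemma xb (h : CoeffBound A dA x r Λ) (hx2 : ∑ i, x i ^ 2 = r ^ 2) :
    |∑ k, x k * bb A x k - r ^ 2| ≤ n ^ 2 * Λ * r * r ^ 2 := by
  rw [← hx2]
  refine (abs_sum_sub_sum_le (B := r * (n * Λ * r ^ 2)) fun k => ?_).trans
    (le_of_eq (by rw [hx2]; ring))
  rw [pow_two, ← mul_sub]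
  exact abs_mul_le (h.hx k) (h.b_sub k)

lemma divb (h : CoeffBound A dA x r Λ) : |∑ k, db A dA x k k - n| ≤ 2 * n ^ 2 * Λ * r := by
  have e : (n : ℝ) = ∑ k : Fin n, kd k k := by simp [kd]
  conv_lhs => rw [e]
  exact (abs_sum_sub_sum_le fun k => h.db_sub k k).trans (le_of_eq (by ring))

lemma trA (h : CoeffBound A dA x r Λ) : |∑ k, A k k - n| ≤ n * Λ * r := by
  have e : (n : ℝ) = ∑ k : Fin n, kd k k := by simp [kd]
  conv_lhs => rw [e]
  exact (abs_sum_sub_sum_le fun k => h.hA k k).trans (le_of_eq (by ring))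

lemma bgrad (h : CoeffBound A dA x r Λ) (hx2 : ∑ i, x i ^ 2 = r ^ 2) :
    |∑ l, bb A x l * (bb A x l + ∑ k, x k * db A dA x l k) - 2 * r ^ 2| ≤
      8 * n ^ 4 * Λ * r * r ^ 2 := by
  have e : 2 * r ^ 2 = ∑ l, x l * (x l + ∑ k, x k * kd k l) := by
    simp only [kd, ← hx2, Finset.mul_sum]
    simp
    congr 1
    ext i
    ring
  rw [e]
  have hn := h.one_le_n
  have hr := h.r_nonneg
  have hΛ := h.one_le_lam
  refine (abs_sum_sub_sum_le (B := n * Λ * r ^ 2 * (2 * n * r + n * (r * (3 * n)))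
    + r * (n * Λ * r ^ 2 + n * (r * (2 * n * Λ * r)))) fun l => ?_).trans ?_
  · refine abs_mul_sub_mul_le (h.b_sub l) ?_ ?_ (h.hx l)
    · have h1 := abs_le.mp (h.b_sub l)
      have h2 := abs_le.mp (abs_sum_sub_sum_le (f := fun k => x k * db A dA x l k)
        (f0 := fun k => x k * kd k l) (B := r * (2 * n * Λ * r)) fun k => by
          rw [← mul_sub]; exact abs_mul_le (h.hx k) (h.db_sub l k))
      rw [abs_le]
      constructor <;> linarith
    · have h1 := abs_le.mp (h.b_le l)
      have h2 := abs_le.mp (abs_sum_le_card_mul (f := fun k => x k * db A dA x l k)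
        (B := r * (3 * n)) fun k => abs_mul_le (h.hx k) (h.db_le l k))
      rw [abs_le]
      constructor <;> linarith
  · have h3 : (n : ℝ) ^ 3 ≤ n ^ 4 := pow_le_pow_right₀ hn (by norm_num)
    have h2 : (n : ℝ) ^ 2 ≤ n ^ 4 := pow_le_pow_right₀ hn (by norm_num)
    have h4 : 0 ≤ Λ * r ^ 3 := by positivity
    nlinarith [mul_le_mul_of_nonneg_right h3 h4, mul_le_mul_of_nonneg_right h2 h4]

end CoeffBound

lemma carleman_gradient_term {N ε r s γ α TW a2 h : ℝ} (hN : 2 ≤ N) (hε0 : 0 < ε)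
    (hε : ε ≤ 1 / 4) (hr : 0 < r) (hs0 : 0 < s) (hsε : 16 * r + 40 * (N * ε) ≤ s)
    (hh0 : 0 < h) (hh2 : h ≤ 2)
    (hα : |α - 1| ≤ ε) (hTW : |TW - (2 - N) * γ ^ 2| ≤ ε * γ ^ 2)
    (ha2 : |a2 - γ ^ 2| ≤ ε * γ ^ 2) :
    h * TW - ((2 - N) * h + s) * (α * a2) ≤ -(r * γ ^ 2) := by
  obtain ⟨hα1, hα2⟩ := abs_le.mp hα
  obtain ⟨hTW1, hTW2⟩ := abs_le.mp hTW
  obtain ⟨ha1, ha2'⟩ := abs_le.mp ha2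
  have hγ := sq_nonneg γ
  have hεγ : 0 ≤ ε * γ ^ 2 := by positivity
  have hεγ' : ε * (ε * γ ^ 2) ≤ 1 / 4 * (ε * γ ^ 2) := mul_le_mul_of_nonneg_right hε hεγ
  have hεγ'' : ε * γ ^ 2 ≤ 1 / 4 * γ ^ 2 := mul_le_mul_of_nonneg_right hε hγ
  have ha0 : 0 ≤ a2 := by linarith
  have hαa : α * a2 ≤ γ ^ 2 + 3 * (ε * γ ^ 2) := by
    have h1 : α * a2 ≤ (1 + ε) * ((1 + ε) * γ ^ 2) :=
      mul_le_mul (by linarith) (by linarith) ha0 (by linarith)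
    linarith
  have hαa' : γ ^ 2 / 2 ≤ α * a2 := by
    have h1 : (1 - ε) * ((1 - ε) * γ ^ 2) ≤ α * a2 :=
      mul_le_mul (by linarith) (by linarith) (mul_nonneg (by linarith) hγ) (by linarith)
    have h2 : 0 ≤ ε * (ε * γ ^ 2) := by positivity
    linarith
  have h1 : h * TW ≤ h * ((2 - N) * γ ^ 2 + ε * γ ^ 2) :=
    mul_le_mul_of_nonneg_left (by linarith) hh0.le
  have h2 : (N - 2) * h * (α * a2) ≤ (N - 2) * h * (γ ^ 2 + 3 * (ε * γ ^ 2)) :=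
    mul_le_mul_of_nonneg_left hαa (mul_nonneg (by linarith) hh0.le)
  have h3 : s * (γ ^ 2 / 2) ≤ s * (α * a2) := mul_le_mul_of_nonneg_left hαa' hs0.le
  have h4 : h * ((1 + 3 * (N - 2)) * (ε * γ ^ 2)) ≤ 2 * ((1 + 3 * (N - 2)) * (ε * γ ^ 2)) :=
    mul_le_mul_of_nonneg_right hh2 (mul_nonneg (by linarith) hεγ)
  have h5 : (16 * r + 40 * (N * ε)) * γ ^ 2 ≤ s * γ ^ 2 := mul_le_mul_of_nonneg_right hsε hγ
  have h6 : 0 ≤ N * (ε * γ ^ 2) := by positivity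
  have h7 : 0 ≤ r * γ ^ 2 := by positivity
  linarith

lemma carleman_zero_term {N ε r s α dvb bga h : ℝ} (hN : 2 ≤ N) (hε0 : 0 < ε)
    (hε : ε ≤ 1 / 4) (hs0 : 0 < s) (hsε : 16 * r + 40 * (N * ε) ≤ s)
    (hh1 : 1 ≤ h) (hh2 : h ≤ 2) (hα : |α - 1| ≤ ε) (hdvb : |dvb - N| ≤ ε) (hbga : |bga| ≤ ε) :
    (-N / h - s / h ^ 2) * α * α + (bga + α * dvb) / h ≤ -(2 * r) := by
  obtain ⟨hα1, hα2⟩ := abs_le.mp hα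
  obtain ⟨hd1, hd2⟩ := abs_le.mp hdvb
  obtain ⟨hb1, hb2⟩ := abs_le.mp hbga
  have hh0 : 0 < h := by linarith
  have h1 : (-N / h - s / h ^ 2) * α * α + (bga + α * dvb) / h =
      (bga + α * (dvb - N * α)) / h - s * α ^ 2 / h ^ 2 := by
    field_simp; ring
  have h2 : (bga + α * (dvb - N * α)) / h ≤ 4 * (N * ε) := by
    rw [div_le_iff₀ hh0]
    have h0 := mul_le_mul_of_nonneg_left hα1 (show 0 ≤ N by linarith)
    have h3 : dvb - N * α ≤ ε + N * ε := by linarith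
    have h4 : α * (dvb - N * α) ≤ α * (ε + N * ε) :=
      mul_le_mul_of_nonneg_left h3 (by linarith)
    have h5 : α * (ε + N * ε) ≤ 5 / 4 * (ε + N * ε) :=
      mul_le_mul_of_nonneg_right (by linarith) (by positivity)
    have h6 : 2 * ε ≤ N * ε := mul_le_mul_of_nonneg_right hN hε0.le
    have h7 : 4 * (N * ε) ≤ 4 * (N * ε) * h := le_mul_of_one_le_right (by positivity) hh1
    linarith
  have h3 : s / 8 ≤ s * α ^ 2 / h ^ 2 := by
    rw [le_div_iff₀ (by positivity)]
    have h4 : h ^ 2 ≤ 4 := by nlinarith only [hh1, hh2]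
    have h5 : 1 / 2 ≤ α ^ 2 := by nlinarith only [hα1, hε]
    have h6 := mul_le_mul_of_nonneg_left h4 hs0.le
    have h7 := mul_le_mul_of_nonneg_left h5 hs0.le
    linarith
  rw [h1]
  have : 0 ≤ N * ε := by positivity
  linarith

lemma carleman_zero_term_lower {N M K r τ ε s α dvb h : ℝ} (hN : 2 ≤ N) (hr : 0 < r)
    (hεM : ε = M * r) (hsK : s = K * r) (hε0 : 0 < ε) (hε : ε ≤ 1 / 4) (hs0 : 0 < s)
    (hτ0 : 0 < τ) (hτ1 : 2 * N * (2 * (N + 1) * M + 2 * K) ≤ τ)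
    (hh0 : 0 < h) (hh2 : h ≤ 2) (hα : |α - 1| ≤ ε) (hdvb : |dvb - N| ≤ ε) :
    (N - 2) * τ * ((-N * h + s) * α + h * dvb) ≤ 1 / 2 * (τ ^ 2 * r) := by
  obtain ⟨hα1, hα2⟩ := abs_le.mp hα
  obtain ⟨hd1, hd2⟩ := abs_le.mp hdvb
  have h1 : (-N * h + s) * α + h * dvb ≤ 2 * (ε + N * ε) + 2 * s := by
    have h0 := mul_le_mul_of_nonneg_left hα1 (show 0 ≤ N by linarith)
    have h2 : dvb - N * α ≤ ε + N * ε := by linarith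
    have h3 : h * (dvb - N * α) ≤ h * (ε + N * ε) := mul_le_mul_of_nonneg_left h2 hh0.le
    have h4 : h * (ε + N * ε) ≤ 2 * (ε + N * ε) :=
      mul_le_mul_of_nonneg_right hh2 (by positivity)
    have h5 : s * α ≤ s * 2 := mul_le_mul_of_nonneg_left (by linarith) hs0.le
    linarith
  have h2 : (N - 2) * τ * ((-N * h + s) * α + h * dvb)
      ≤ (N - 2) * τ * (2 * (ε + N * ε) + 2 * s) :=
    mul_le_mul_of_nonneg_left h1 (mul_nonneg (by linarith) hτ0.le)
  have h3 : (N - 2) * τ * (2 * (ε + N * ε) + 2 * s) ≤ N * τ * (2 * (ε + N * ε) + 2 * s) := by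
    gcongr; linarith
  have h4 := mul_le_mul_of_nonneg_right hτ1 (show 0 ≤ τ * r by positivity)
  have h5 : N * τ * (2 * (ε + N * ε) + 2 * s) =
    1 / 2 * (2 * N * (2 * (N + 1) * M + 2 * K) * (τ * r)) := by rw [hsK, hεM]; ring
  linarith

lemma carleman_first_order_coeff {N ε s α trA h c : ℝ} (hN : 2 ≤ N) (hs0 : 0 < s) (hs1 : s ≤ 1)
    (hε0 : 0 < ε) (hα : |α - 1| ≤ ε) (htrA : |trA - N| ≤ ε) (hh : h = 1 + s)
    (hc : c = trA / h - α * (2 + 3 * s) / h ^ 2) :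
    |c - (N - 2)| ≤ 7 * ε + 6 * (N * s) := by
  have hh0 : 0 < h := by linarith
  have h1 : c - (N - 2) = ((trA - N) * h + (1 - α) * (2 + 3 * s)
      + (s * (1 - N) - (N - 2) * s ^ 2)) / h ^ 2 := by
    rw [hc, hh]; field_simp; ring
  rw [h1, abs_div, abs_of_pos (show 0 < h ^ 2 by positivity), div_le_iff₀ (by positivity)]
  have h2 : |(trA - N) * h| ≤ ε * 2 := abs_mul_le htrA (by rw [abs_of_pos hh0]; linarith)
  have h3 : |(1 - α) * (2 + 3 * s)| ≤ ε * 5 :=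
    abs_mul_le (by rw [abs_sub_comm]; exact hα) (by rw [abs_of_pos (by linarith)]; linarith)
  have hNs : 0 ≤ N * s := by positivity
  have h4 : |s * (1 - N) - (N - 2) * s ^ 2| ≤ 2 * (N * s) := by
    have h0 : s ^ 2 ≤ s := by nlinarith only [hs0, hs1]
    have h5 : 0 ≤ (N - 2) * s ^ 2 := mul_nonneg (by linarith) (by positivity)
    have h6 : (N - 2) * s ^ 2 ≤ (N - 2) * s :=
      mul_le_mul_of_nonneg_left h0 (by linarith)
    rw [abs_le]; constructor <;> linarith
  have hh3 : 1 ≤ h ^ 2 := by nlinarith only [hh, hs0]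
  have h5 : (7 * ε + 6 * (N * s)) ≤ (7 * ε + 6 * (N * s)) * h ^ 2 :=
    le_mul_of_one_le_right (by positivity) hh3
  have h7 := abs_add_three ((trA - N) * h) ((1 - α) * (2 + 3 * s))
    (s * (1 - N) - (N - 2) * s ^ 2)
  linarith

/-- The scalar inequality behind the Carleman estimate. -/
lemma carleman_scalar {N M K r τ X S v γ α TW a2 dvb bga trA f h c : ℝ} (hN : 2 ≤ N)
    (hM : 1 ≤ M) (hK : 8 * (2 + 5 * N * M) ≤ K) (hr : 0 < r) (hKr : K * r ≤ 1)
    (hMr : M * r ≤ 1 / 4)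
    (hτ1 : 2 * N * (2 * (N + 1) * M + 2 * K) ≤ τ) (hτ2 : 8 * (7 * M + 6 * N * K) ^ 2 ≤ τ)
    (hα : |α - 1| ≤ M * r) (hTW : |TW - (2 - N) * γ ^ 2| ≤ M * r * γ ^ 2)
    (ha2 : |a2 - γ ^ 2| ≤ M * r * γ ^ 2) (hdvb : |dvb - N| ≤ M * r) (hbga : |bga| ≤ M * r)
    (htrA : |trA - N| ≤ M * r) (hh : h = 1 + K * r)
    (hc : c = trA / h - α * (2 + 3 * (K * r)) / h ^ 2)
    (hf : f = r ^ 2 * S + 2 * τ * X / h + τ ^ 2 * α * v / h ^ 2 + τ * c * v) :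
    r ^ 3 * γ ^ 2 + τ ^ 2 * r * v ^ 2
      + (h * r ^ 2 * (2 * S * X + TW) + ((2 - N) * h + K * r) * (2 * X ^ 2 - α * r ^ 2 * a2)
        + (τ ^ 2 * α / h + (N - 2) * τ * h) * (2 * v * X)
        + v ^ 2 * (τ ^ 2 * ((-N / h - K * r / h ^ 2) * α * α + (bga + α * dvb) / h)
          + (N - 2) * τ * ((-N * h + K * r) * α + h * dvb))) ≤ 4 * f ^ 2 / τ := by
  have hNM : N ≤ N * M := le_mul_of_one_le_right (by linarith) hM
  have hK16 : 16 ≤ K := by linarith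
  have hr1 : r ≤ 1 := by nlinarith only [hM, hMr, hr]
  set s := K * r with hs
  set ε := M * r with hε
  have hs0 : 0 < s := by positivity
  have hε0 : 0 < ε := by positivity
  have hh1 : 1 ≤ h := by linarith
  have hh2 : h ≤ 2 := by linarith
  have hh0 : 0 < h := by linarith
  have hsε : s ≥ 16 * r + 40 * (N * ε) := by
    have := mul_le_mul_of_nonneg_right hK hr.le
    rw [hs, hε]; linarith
  set C := 7 * M + 6 * N * K with hC
  have hC1 : 1 ≤ C := by
    have : 0 ≤ 6 * N * K := by positivity
    linarith
  have hτ8 : 8 ≤ τ := by nlinarith only [hC1, hτ2]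
  have hτ0 : 0 < τ := by linarith
  have e1 : 2 * h * f * X ≤ τ * X ^ 2 + 4 * f ^ 2 / τ := by
    have h1 : 0 ≤ (τ * X - h * f) ^ 2 / τ := by positivity
    have h2 : (τ * X - h * f) ^ 2 / τ = τ * X ^ 2 - 2 * h * f * X + h ^ 2 * f ^ 2 / τ := by
      field_simp; ring
    have h3 : h ^ 2 * f ^ 2 / τ ≤ 4 * f ^ 2 / τ := by
      gcongr; nlinarith only [hh1, hh2]
    linarith
  have e3 : h * TW - ((2 - N) * h + s) * (α * a2) ≤ -(r * γ ^ 2) :=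
    carleman_gradient_term hN hε0 hMr hr hs0 hsε hh0 hh2 hα hTW ha2
  have q1 : (-N / h - s / h ^ 2) * α * α + (bga + α * dvb) / h ≤ -(2 * r) :=
    carleman_zero_term hN hε0 hMr hs0 hsε hh1 hh2 hα hdvb hbga
  have q2 : (N - 2) * τ * ((-N * h + s) * α + h * dvb) ≤ 1 / 2 * (τ ^ 2 * r) :=
    carleman_zero_term_lower hN hr hε hs hε0 hMr hs0 hτ0 hτ1 hh0 hh2 hα hdvb
  have e4 : v ^ 2 * (τ ^ 2 * ((-N / h - s / h ^ 2) * α * α + (bga + α * dvb) / h)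
      + (N - 2) * τ * ((-N * h + s) * α + h * dvb)) ≤ v ^ 2 * (-(3 / 2) * (τ ^ 2 * r)) := by
    refine mul_le_mul_of_nonneg_left ?_ (sq_nonneg v)
    have := mul_le_mul_of_nonneg_left q1 (sq_nonneg τ)
    linarith
  have hc' : |c - (N - 2)| ≤ C * r :=
    (carleman_first_order_coeff hN hs0 hKr hε0 hα htrA hh hc).trans
      (le_of_eq (by rw [hC, hε, hs]; ring))
  have e5 : -(2 * τ * h * (c - (N - 2)) * v * X) ≤ τ * X ^ 2 + 1 / 2 * (τ ^ 2 * r) * v ^ 2 := by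
    have h1 : |h * (c - (N - 2)) * v| ≤ 2 * (C * r) * |v| := by
      refine abs_mul_le (abs_mul_le ?_ hc') le_rfl
      rw [abs_of_pos hh0]; exact hh2
    have h2 : (h * (c - (N - 2)) * v) ^ 2 ≤ (2 * (C * r) * |v|) ^ 2 := by
      rw [← sq_abs]; gcongr
    have h3 : (2 * (C * r) * |v|) ^ 2 = 4 * C ^ 2 * r ^ 2 * v ^ 2 := by
      rw [mul_pow, sq_abs]; ring
    have h4 : 4 * C ^ 2 * r ^ 2 * v ^ 2 ≤ 1 / 2 * (τ * r) * v ^ 2 := by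
      refine mul_le_mul_of_nonneg_right ?_ (sq_nonneg v)
      have : r ^ 2 ≤ r := by nlinarith only [hr, hr1]
      have h5 : 4 * C ^ 2 * r ^ 2 ≤ 4 * C ^ 2 * r := by gcongr
      have h6 := mul_le_mul_of_nonneg_right hτ2 hr.le
      linarith
    have h5 : 0 ≤ τ * (X + h * (c - (N - 2)) * v) ^ 2 := by positivity
    have h6 := mul_le_mul_of_nonneg_left (h2.trans (h3.le.trans h4)) hτ0.le
    linarith
  have e6 : ((2 - N) * h + s) * (2 * X ^ 2) ≤ 1 * (2 * X ^ 2) := by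
    refine mul_le_mul_of_nonneg_right ?_ (by positivity)
    have : 0 ≤ (N - 2) * h := mul_nonneg (by linarith) hh0.le
    linarith
  have e7 : 2 * h * f * X = 2 * h * r ^ 2 * S * X + 4 * τ * X ^ 2 + 2 * τ ^ 2 * α * v * X / h
      + 2 * τ * h * c * v * X := by
    rw [hf]; field_simp; ring
  have e8 : r ^ 2 * (h * TW - ((2 - N) * h + s) * (α * a2)) ≤ r ^ 2 * (-(r * γ ^ 2)) :=
    mul_le_mul_of_nonneg_left e3 (by positivity)
  have e9 : 8 * X ^ 2 ≤ τ * X ^ 2 := mul_le_mul_of_nonneg_right hτ8 (sq_nonneg X)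
  have e10 : (τ ^ 2 * α / h + (N - 2) * τ * h) * (2 * v * X) =
    2 * τ ^ 2 * α * v * X / h + 2 * τ * h * (N - 2) * v * X := by field_simp
  rw [e10]
  have e11 := sq_nonneg X
  linarith

section

variable {n : ℕ} {a : Fin n → Fin n → Euc n → ℝ}

/-- The vector field `a(x) x` as a function of the point. -/
def bf (a : Fin n → Fin n → Euc n → ℝ) (k : Fin n) (y : Euc n) : ℝ := ∑ m, a k m y * y m

/-- The function `⟨x, a(x) x⟩`. -/
def pf (a : Fin n → Fin n → Euc n → ℝ) (y : Euc n) : ℝ := ∑ m, y m * bf a m y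

/-- The coefficient matrix at a point. -/
def av (a : Fin n → Fin n → Euc n → ℝ) (x : Euc n) (i j : Fin n) : ℝ := a i j x

/-- The derivatives of the coefficient matrix at a point. -/
def dav (a : Fin n → Fin n → Euc n → ℝ) (x : Euc n) (l i j : Fin n) : ℝ :=
  dd (bv l) (a i j) x

lemma contDiff_coord (i : Fin n) : ContDiff ℝ (⊤ : ℕ∞) (fun y : Euc n => y i) := by fun_prop

lemma contDiff_bf (ha : ∀ i j, ContDiff ℝ (⊤ : ℕ∞) (a i j)) (k : Fin n) :
    ContDiff ℝ (⊤ : ℕ∞) (bf a k) :=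
  ContDiff.sum fun m _ => (ha k m).mul (contDiff_coord m)

lemma contDiff_pf (ha : ∀ i j, ContDiff ℝ (⊤ : ℕ∞) (a i j)) : ContDiff ℝ (⊤ : ℕ∞) (pf a) :=
  ContDiff.sum fun m _ => (contDiff_coord m).mul (contDiff_bf ha m)

lemma smooth_differentiableAt {f : Euc n → ℝ} (hf : ContDiff ℝ (⊤ : ℕ∞) f) (x : Euc n) :
    DifferentiableAt ℝ f x := hf.differentiable (by simp) x

lemma dd_bf (ha : ∀ i j, ContDiff ℝ (⊤ : ℕ∞) (a i j)) (l k : Fin n) (x : Euc n) :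
    dd (bv l) (bf a k) x = db (av a x) (dav a x) (fun i => x i) l k := by
  unfold bf
  rw [dd_sum _ fun m _ => ((smooth_differentiableAt (ha k m) x).fun_mul
    (smooth_differentiableAt (contDiff_coord m) x))]
  simp_rw [dd_mul (smooth_differentiableAt (ha k _) x)
    (smooth_differentiableAt (contDiff_coord _) x), dd_coord, bv_apply]
  rw [Finset.sum_add_distrib, db]
  simp [dav, av, add_comm]

lemma dd_pf (ha : ∀ i j, ContDiff ℝ (⊤ : ℕ∞) (a i j)) (l : Fin n) (x : Euc n) :
    dd (bv l) (pf a) x = bf a l x +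
      ∑ k, x k * db (av a x) (dav a x) (fun i => x i) l k := by
  unfold pf
  rw [dd_sum _ fun m _ => ((smooth_differentiableAt (contDiff_coord m) x).fun_mul
    (smooth_differentiableAt (contDiff_bf ha m) x))]
  simp_rw [dd_mul (smooth_differentiableAt (contDiff_coord _) x)
    (smooth_differentiableAt (contDiff_bf ha _) x), dd_coord, bv_apply, dd_bf ha]
  rw [Finset.sum_add_distrib]
  simp

lemma rellich_algebra (A : Fin n → Fin n → ℝ) (hA : ∀ i j, A i j = A j i)
    (dA : Fin n → Fin n → Fin n → ℝ) (x g : Fin n → ℝ) (H : Fin n → Fin n → ℝ)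
    (hH : ∀ i j, H i j = H j i) (w ω : ℝ) :
    ∑ i, ∑ j, ∑ k,
      (((ω * x i * (A i j * bb A x k) + w * CoeffBound.dab A dA x i i j k) * (g j * g k)
          + w * (A i j * bb A x k) * (H i j * g k + g j * H i k))
        + ((ω * x j * (A i j * bb A x k) + w * CoeffBound.dab A dA x j i j k) * (g i * g k)
          + w * (A i j * bb A x k) * (H j i * g k + g i * H j k))
        - ((ω * x k * (A i j * bb A x k) + w * CoeffBound.dab A dA x k i j k) * (g i * g j)
          + w * (A i j * bb A x k) * (H k i * g j + g i * H k j)))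
    = w * (2 * (∑ i, ∑ j, A i j * H i j) * (∑ k, bb A x k * g k)
        + ∑ i, ∑ j, ∑ k, (CoeffBound.dab A dA x i i j k * (g j * g k)
          + CoeffBound.dab A dA x j i j k * (g i * g k)
          - CoeffBound.dab A dA x k i j k * (g i * g j)))
      + ω * (2 * (∑ k, bb A x k * g k) ^ 2
          - (∑ k, x k * bb A x k) * ∑ i, ∑ j, A i j * (g i * g j)) := by
  have hb : ∑ i, ∑ j, A i j * (x i * g j) = ∑ k, bb A x k * g k := by
    rw [Finset.sum_comm]
    simp only [bb, Finset.sum_mul]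
    refine Finset.sum_congr rfl fun i _ => Finset.sum_congr rfl fun j _ => ?_
    rw [hA j i]; ring
  have hb' : ∑ i, ∑ j, A i j * (x j * g i) = ∑ k, bb A x k * g k := by
    simp only [bb, Finset.sum_mul]
    refine Finset.sum_congr rfl fun i _ => Finset.sum_congr rfl fun j _ => ?_
    ring
  have e5 : ∀ i j k,
      (((ω * x i * (A i j * bb A x k) + w * CoeffBound.dab A dA x i i j k) * (g j * g k)
          + w * (A i j * bb A x k) * (H i j * g k + g j * H i k))
        + ((ω * x j * (A i j * bb A x k) + w * CoeffBound.dab A dA x j i j k) * (g i * g k)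
          + w * (A i j * bb A x k) * (H j i * g k + g i * H j k))
        - ((ω * x k * (A i j * bb A x k) + w * CoeffBound.dab A dA x k i j k) * (g i * g j)
          + w * (A i j * bb A x k) * (H k i * g j + g i * H k j)))
      = 2 * w * ((A i j * H i j) * (bb A x k * g k))
        + w * (CoeffBound.dab A dA x i i j k * (g j * g k)
          + CoeffBound.dab A dA x j i j k * (g i * g k)
          - CoeffBound.dab A dA x k i j k * (g i * g j))
        + ω * ((A i j * (x i * g j)) * (bb A x k * g k))
        + ω * ((A i j * (x j * g i)) * (bb A x k * g k))
        - ω * ((A i j * (g i * g j)) * (x k * bb A x k)) := by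
    intro i j k
    rw [hH j i, hH k i, hH k j]; ring
  simp only [e5, Finset.sum_add_distrib, Finset.sum_sub_distrib, ← Finset.mul_sum,
    ← Finset.sum_mul, hb, hb']
  ring

lemma dd_weight {wt : ℝ → ℝ} {wt' : ℝ} {x : Euc n} (hx : x ≠ 0) (hw : HasDerivAt wt wt' ‖x‖)
    (hwd : DifferentiableAt ℝ (fun y : Euc n => wt ‖y‖) x)
    (ha : ∀ i j, ContDiff ℝ (⊤ : ℕ∞) (a i j)) {v : Euc n → ℝ} (hv : ContDiff ℝ (⊤ : ℕ∞) v)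
    (l i j k p q : Fin n) :
    dd (bv l) (fun y => (wt ‖y‖ * (a i j y * bf a k y)) * (dd (bv p) v y * dd (bv q) v y)) x
      = (wt' / ‖x‖ * x l * (av a x i j * bb (av a x) (fun i => x i) k)
          + wt ‖x‖ * CoeffBound.dab (av a x) (dav a x) (fun i => x i) l i j k)
          * (dd (bv p) v x * dd (bv q) v x)
        + wt ‖x‖ * (av a x i j * bb (av a x) (fun i => x i) k)
          * (dd (bv l) (dd (bv p) v) x * dd (bv q) v x
            + dd (bv p) v x * dd (bv l) (dd (bv q) v) x) := by
  have h1 := smooth_differentiableAt (ha i j) x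
  have h2 := smooth_differentiableAt (contDiff_bf ha k) x
  have h3 := smooth_differentiableAt (contDiff_dd hv (bv p)) x
  have h4 := smooth_differentiableAt (contDiff_dd hv (bv q)) x
  rw [dd_mul (hwd.fun_mul (h1.fun_mul h2)) (h3.fun_mul h4), dd_mul hwd (h1.fun_mul h2),
    dd_mul h1 h2, dd_mul h3 h4, dd_radial hx hw, dd_bf ha]
  rfl

lemma dd_zero_weight {y1 y2 : ℝ → ℝ} {y1' y2' : ℝ} {x : Euc n} (hx : x ≠ 0)
    (hw1 : HasDerivAt y1 y1' ‖x‖) (hw2 : HasDerivAt y2 y2' ‖x‖)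
    (hwd1 : DifferentiableAt ℝ (fun y : Euc n => y1 ‖y‖) x)
    (hwd2 : DifferentiableAt ℝ (fun y : Euc n => y2 ‖y‖) x)
    (ha : ∀ i j, ContDiff ℝ (⊤ : ℕ∞) (a i j)) {v : Euc n → ℝ} (hv : ContDiff ℝ (⊤ : ℕ∞) v) :
    ∑ k, dd (bv k) (fun y => ((y1 ‖y‖ * pf a y + y2 ‖y‖) * bf a k y) * (v y * v y)) x
      = v x ^ 2 * (y1' / ‖x‖ * pf a x * pf a x
          + y1 ‖x‖ * (∑ l, bf a l x * (bf a l x +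
              ∑ k, x k * db (av a x) (dav a x) (fun i => x i) l k))
          + y2' / ‖x‖ * pf a x
          + (y1 ‖x‖ * pf a x + y2 ‖x‖) * ∑ k, db (av a x) (dav a x) (fun i => x i) k k)
        + (y1 ‖x‖ * pf a x + y2 ‖x‖) * (2 * v x * ∑ k, bf a k x * dd (bv k) v x) := by
  have h1 := smooth_differentiableAt (contDiff_pf ha) x
  have h3 := smooth_differentiableAt hv x
  have key : ∀ k, dd (bv k)
      (fun y => ((y1 ‖y‖ * pf a y + y2 ‖y‖) * bf a k y) * (v y * v y)) x
      = v x ^ 2 * (y1' / ‖x‖ * pf a x) * (x k * bf a k x)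
        + v x ^ 2 * y1 ‖x‖ * (bf a k x * (bf a k x +
              ∑ m, x m * db (av a x) (dav a x) (fun i => x i) k m))
        + v x ^ 2 * (y2' / ‖x‖) * (x k * bf a k x)
        + v x ^ 2 * (y1 ‖x‖ * pf a x + y2 ‖x‖) * db (av a x) (dav a x) (fun i => x i) k k
        + (y1 ‖x‖ * pf a x + y2 ‖x‖) * (2 * v x) * (bf a k x * dd (bv k) v x) := by
    intro k
    have h2 := smooth_differentiableAt (contDiff_bf ha k) x
    rw [dd_mul (((hwd1.fun_mul h1).fun_add hwd2).fun_mul h2) (h3.fun_mul h3),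
      dd_mul ((hwd1.fun_mul h1).fun_add hwd2) h2, dd_add (hwd1.fun_mul h1) hwd2,
      dd_mul hwd1 h1, dd_mul h3 h3, dd_radial hx hw1, dd_radial hx hw2, dd_bf ha, dd_pf ha]
    ring
  simp only [key, Finset.sum_add_distrib, ← Finset.mul_sum]
  rw [show ∑ k, x k * bf a k x = pf a x from rfl]
  ring

/-- The weight in the quadratic form of second-order multipliers. -/
def wtA (n : ℕ) (K t : ℝ) : ℝ := (1 + K * t) * t ^ 2 * (t ^ n)⁻¹

/-- The main weight of the zeroth-order multiplier. -/
def wtB (n : ℕ) (K τ t : ℝ) : ℝ := τ ^ 2 * ((1 + K * t) * t ^ 2)⁻¹ * (t ^ n)⁻¹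

/-- The lower-order weight of the zeroth-order multiplier. -/
def wtC (n : ℕ) (K τ t : ℝ) : ℝ := (n - 2) * τ * (1 + K * t) * (t ^ n)⁻¹

lemma hasDerivAt_pow_inv (n : ℕ) {t : ℝ} (ht : 0 < t) :
    HasDerivAt (fun t : ℝ => (t ^ n)⁻¹) (-n / t * (t ^ n)⁻¹) t := by
  refine ((hasDerivAt_pow n t).inv (by positivity)).congr_deriv ?_
  cases n with
  | zero => simp
  | succ m => field_simp; simp [pow_succ]

lemma hasDerivAt_affine (K t : ℝ) : HasDerivAt (fun t : ℝ => 1 + K * t) K t := by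
  simpa using ((hasDerivAt_id t).const_mul K).const_add 1

lemma hasDerivAt_wtA (n : ℕ) {K t : ℝ} (ht : 0 < t) :
    HasDerivAt (wtA n K) (t * ((K * t + (2 - n) * (1 + K * t)) * (t ^ n)⁻¹)) t := by
  refine (((hasDerivAt_affine K t).fun_mul (hasDerivAt_pow 2 t)).fun_mul
    (hasDerivAt_pow_inv n ht)).congr_deriv ?_
  field_simp
  ring

lemma hasDerivAt_wtB (n : ℕ) {K τ t : ℝ} (ht : 0 < t) (hh : 0 < 1 + K * t) :
    HasDerivAt (wtB n K τ)
      (τ ^ 2 * ((1 + K * t) * t ^ 2)⁻¹ * (t ^ n)⁻¹ * (-K / (1 + K * t) - (n + 2) / t)) t := by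
  refine (((((hasDerivAt_affine K t).fun_mul (hasDerivAt_pow 2 t)).fun_inv
    (by positivity)).const_mul (τ ^ 2)).fun_mul (hasDerivAt_pow_inv n ht)).congr_deriv ?_
  field_simp
  ring

lemma hasDerivAt_wtC (n : ℕ) {K τ t : ℝ} (ht : 0 < t) :
    HasDerivAt (wtC n K τ)
      ((n - 2) * τ * (K - n / t * (1 + K * t)) * (t ^ n)⁻¹) t := by
  refine (((hasDerivAt_affine K t).const_mul (((n : ℝ) - 2) * τ)).fun_mul
    (hasDerivAt_pow_inv n ht)).congr_deriv ?_
  field_simp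
  ring

lemma contDiffOn_norm_compl : ContDiffOn ℝ (⊤ : ℕ∞) (fun y : Euc n => ‖y‖) {0}ᶜ :=
  fun _ hx => (contDiffAt_norm ℝ hx).contDiffWithinAt

lemma contDiffOn_wtA (K : ℝ) :
    ContDiffOn ℝ (⊤ : ℕ∞) (fun y : Euc n => wtA n K ‖y‖) {0}ᶜ := by
  have h := contDiffOn_norm_compl (n := n)
  exact ((contDiffOn_const.add (contDiffOn_const.mul h)).mul (h.pow 2)).mul
    ((h.pow n).inv fun x hx => pow_ne_zero _ (norm_ne_zero_iff.mpr hx))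

lemma contDiffOn_wtB {K : ℝ} (hK : 0 ≤ K) (τ : ℝ) :
    ContDiffOn ℝ (⊤ : ℕ∞) (fun y : Euc n => wtB n K τ ‖y‖) {0}ᶜ := by
  have h := contDiffOn_norm_compl (n := n)
  refine (contDiffOn_const.mul (((contDiffOn_const.add (contDiffOn_const.mul h)).mul
    (h.pow 2)).inv fun x hx => ?_)).mul
    ((h.pow n).inv fun x hx => pow_ne_zero _ (norm_ne_zero_iff.mpr hx))
  have : 0 < ‖x‖ := norm_pos_iff.mpr hx
  positivity

lemma contDiffOn_wtC (K τ : ℝ) :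
    ContDiffOn ℝ (⊤ : ℕ∞) (fun y : Euc n => wtC n K τ ‖y‖) {0}ᶜ := by
  have h := contDiffOn_norm_compl (n := n)
  exact ((contDiffOn_const.mul (contDiffOn_const.add (contDiffOn_const.mul h)))).mul
    ((h.pow n).inv fun x hx => pow_ne_zero _ (norm_ne_zero_iff.mpr hx))

lemma differentiableAt_of_contDiffOn_compl {f : Euc n → ℝ} (hf : ContDiffOn ℝ (⊤ : ℕ∞) f {0}ᶜ)
    {x : Euc n} (hx : x ≠ 0) : DifferentiableAt ℝ f x :=
  (hf.contDiffAt (isOpen_compl_singleton.mem_nhds hx)).differentiableAt (by simp)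

/-- Squared norm of the gradient. -/
def grad2 (v : Euc n → ℝ) (x : Euc n) : ℝ := ∑ i, dd (bv i) v x ^ 2

/-- The second-order part `∑ a_{ij} ∂_i ∂_j v`. -/
def pop (a : Fin n → Fin n → Euc n → ℝ) (v : Euc n → ℝ) (x : Euc n) : ℝ :=
  ∑ i, ∑ j, a i j x * dd (bv i) (dd (bv j) v) x

/-- The derivative of `v` along the vector field `a(x) x`. -/
def xop (a : Fin n → Fin n → Euc n → ℝ) (v : Euc n → ℝ) (x : Euc n) : ℝ :=
  ∑ k, bf a k x * dd (bv k) v x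

/-- The operator `r² ∑ a_{ij} ∂_i ∂_j` conjugated with the weight `((1 + K r) / r) ^ τ`. -/
def fop (a : Fin n → Fin n → Euc n → ℝ) (K τ : ℝ) (v : Euc n → ℝ) (x : Euc n) : ℝ :=
  ‖x‖ ^ 2 * pop a v x + 2 * τ * xop a v x / (1 + K * ‖x‖)
    + τ ^ 2 * (pf a x / ‖x‖ ^ 2) * v x / (1 + K * ‖x‖) ^ 2
    + τ * ((∑ i, a i i x) / (1 + K * ‖x‖)
        - (pf a x / ‖x‖ ^ 2) * (2 + 3 * (K * ‖x‖)) / (1 + K * ‖x‖) ^ 2) * v x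

/-- The total divergence used in the Carleman estimate. -/
def divTerm (a : Fin n → Fin n → Euc n → ℝ) (K τ : ℝ) (v : Euc n → ℝ) (x : Euc n) : ℝ :=
  (∑ i, ∑ j, ∑ k,
    (dd (bv i) (fun y => (wtA n K ‖y‖ * (a i j y * bf a k y))
        * (dd (bv j) v y * dd (bv k) v y)) x
      + dd (bv j) (fun y => (wtA n K ‖y‖ * (a i j y * bf a k y))
        * (dd (bv i) v y * dd (bv k) v y)) x
      - dd (bv k) (fun y => (wtA n K ‖y‖ * (a i j y * bf a k y))
        * (dd (bv i) v y * dd (bv j) v y)) x))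
  + ∑ k, dd (bv k) (fun y => ((wtB n K τ ‖y‖ * pf a y + wtC n K τ ‖y‖) * bf a k y)
      * (v y * v y)) x

lemma sum_sq_coord (x : Euc n) : ∑ i, x i ^ 2 = ‖x‖ ^ 2 := by
  rw [EuclideanSpace.norm_sq_eq]; simp

lemma abs_coord_le (x : Euc n) (i : Fin n) : |x i| ≤ ‖x‖ := by
  simpa using PiLp.norm_apply_le x i

/-- The value of `M` in the Carleman estimate. -/
def cM (n : ℕ) (Λ : ℝ) : ℝ := 21 * n ^ 4 * Λ

/-- The value of `K` in the Carleman estimate. -/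
def cK (n : ℕ) (Λ : ℝ) : ℝ := 8 * (2 + 5 * n * cM n Λ)

/-- The threshold for `τ` in the Carleman estimate. -/
def cT (n : ℕ) (Λ : ℝ) : ℝ := max (2 * n * (2 * (n + 1) * cM n Λ + 2 * cK n Λ))
  (8 * (7 * cM n Λ + 6 * n * cK n Λ) ^ 2)

lemma divergence_algebra {J r K N τ S X TW P a2 T dvb γ2 v : ℝ} (hr : 0 < r)
    (hh : 0 < 1 + K * r) :
    J * (r ^ 3 * γ2 + τ ^ 2 * r * v ^ 2)
      + ((1 + K * r) * r ^ 2 * J * (2 * S * X + TW)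
        + r * ((K * r + (2 - N) * (1 + K * r)) * J) / r * (2 * X ^ 2 - P * a2)
        + (v ^ 2 * ((τ ^ 2 * ((1 + K * r) * r ^ 2)⁻¹ * J * (-K / (1 + K * r) - (N + 2) / r)) / r
              * P * P
            + (τ ^ 2 * ((1 + K * r) * r ^ 2)⁻¹ * J) * T
            + ((N - 2) * τ * (K - N / r * (1 + K * r)) * J) / r * P
            + ((τ ^ 2 * ((1 + K * r) * r ^ 2)⁻¹ * J) * P
              + (N - 2) * τ * (1 + K * r) * J) * dvb)
          + ((τ ^ 2 * ((1 + K * r) * r ^ 2)⁻¹ * J) * P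
              + (N - 2) * τ * (1 + K * r) * J) * (2 * v * X)))
    = J * (r ^ 3 * γ2 + τ ^ 2 * r * v ^ 2
      + ((1 + K * r) * r ^ 2 * (2 * S * X + TW)
        + ((2 - N) * (1 + K * r) + K * r) * (2 * X ^ 2 - P / r ^ 2 * r ^ 2 * a2)
        + (τ ^ 2 * (P / r ^ 2) / (1 + K * r) + (N - 2) * τ * (1 + K * r)) * (2 * v * X)
        + v ^ 2 * (τ ^ 2 * ((-N / (1 + K * r) - K * r / (1 + K * r) ^ 2) * (P / r ^ 2) * (P / r ^ 2)
            + (T / r ^ 2 - 2 * (P / r ^ 2) ^ 2 + P / r ^ 2 * dvb) / (1 + K * r))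
          + (N - 2) * τ * ((-N * (1 + K * r) + K * r) * (P / r ^ 2) + (1 + K * r) * dvb)))) := by
  generalize 1 + K * r = h at hh ⊢
  field_simp
  ring

lemma carleman_pointwise (hn : 2 ≤ n) (ha : ∀ i j, ContDiff ℝ (⊤ : ℕ∞) (a i j))
    (hsym : ∀ i j x, a i j x = a j i x) {Λ τ : ℝ} {x : Euc n} (hx : x ≠ 0)
    (hcb : CoeffBound (av a x) (dav a x) (fun i => x i) ‖x‖ Λ) (hKr : cK n Λ * ‖x‖ ≤ 1)
    (hτ : cT n Λ ≤ τ) {v : Euc n → ℝ} (hv : ContDiff ℝ (⊤ : ℕ∞) v) :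
    (‖x‖ ^ n)⁻¹ * (‖x‖ ^ 3 * grad2 v x + τ ^ 2 * ‖x‖ * v x ^ 2) + divTerm a (cK n Λ) τ v x
      ≤ (‖x‖ ^ n)⁻¹ * (4 * fop a (cK n Λ) τ v x ^ 2 / τ) := by
  have hr : 0 < ‖x‖ := norm_pos_iff.mpr hx
  have hN : (2 : ℝ) ≤ n := by exact_mod_cast hn
  have hΛ := hcb.one_le_lam
  have hM : 1 ≤ cM n Λ := by
    have : (1 : ℝ) ≤ n ^ 4 := one_le_pow₀ (by linarith)
    unfold cM; nlinarith only [this, hΛ]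
  have hK : 0 < cK n Λ := by
    unfold cK
    have : 0 < cM n Λ := by linarith
    positivity
  have hMr : cM n Λ * ‖x‖ ≤ 1 / 4 := by
    have h1 : cK n Λ * ‖x‖ = 16 * ‖x‖ + 40 * (n * (cM n Λ * ‖x‖)) := by unfold cK; ring
    have h2 : 2 * (cM n Λ * ‖x‖) ≤ n * (cM n Λ * ‖x‖) :=
      mul_le_mul_of_nonneg_right hN (mul_nonneg (by linarith) hr.le)
    linarith
  have hh : 0 < 1 + cK n Λ * ‖x‖ := by positivity
  set A := av a x with hAdef
  set dA := dav a x with hdA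
  set g : Fin n → ℝ := fun i => dd (bv i) v x with hg
  set γ := Real.sqrt (grad2 v x) with hγ
  have hg0 : 0 ≤ grad2 v x := Finset.sum_nonneg fun i _ => sq_nonneg _
  have hγ2 : ∑ i, g i ^ 2 = γ ^ 2 := (Real.sq_sqrt hg0).symm
  have hgi : ∀ i, |g i| ≤ γ := fun i => Real.abs_le_sqrt
    (Finset.single_le_sum (f := fun i => g i ^ 2) (fun i _ => sq_nonneg _) (Finset.mem_univ i))
  have hx2 := sum_sq_coord x
  have hpow : ∀ (c : ℝ) (m : ℕ), 0 ≤ c → c ≤ 21 → m ≤ 4 →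
      c * n ^ m * Λ * ‖x‖ ≤ cM n Λ * ‖x‖ := by
    intro c m hc hc2 hm
    have : (n : ℝ) ^ m ≤ n ^ 4 := pow_le_pow_right₀ (by linarith) hm
    unfold cM; gcongr
  have hpfα : ∀ {c : ℝ}, |pf a x - ‖x‖ ^ 2| ≤ c * ‖x‖ ^ 2 → |pf a x / ‖x‖ ^ 2 - 1| ≤ c := by
    intro c h
    rw [div_sub_one (by positivity), abs_div, abs_of_pos (show 0 < ‖x‖ ^ 2 by positivity),
      div_le_iff₀ (by positivity)]
    exact h
  have h0xb : |pf a x - ‖x‖ ^ 2| ≤ n ^ 2 * Λ * ‖x‖ * ‖x‖ ^ 2 := hcb.xb hx2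
  have hα1 : |pf a x / ‖x‖ ^ 2 - 1| ≤ n ^ 2 * Λ * ‖x‖ := hpfα h0xb
  have hα : |pf a x / ‖x‖ ^ 2 - 1| ≤ cM n Λ * ‖x‖ :=
    hα1.trans (by simpa using hpow 1 2 (by norm_num) (by norm_num) (by norm_num))
  have hTW := hcb.rellich hgi hγ2
  have ha2 := (hcb.quad hgi hγ2).trans (mul_le_mul_of_nonneg_right
    (by simpa using hpow 1 2 (by norm_num) (by norm_num) (by norm_num)) (sq_nonneg γ))
  have hdvb := hcb.divb.trans (hpow 2 2 (by norm_num) (by norm_num) (by norm_num))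
  have htrA := hcb.trA.trans
    (by simpa using hpow 1 1 (by norm_num) (by norm_num) (by norm_num))
  set T := ∑ l, bb A (fun i => x i) l * (bb A (fun i => x i) l
      + ∑ k, x k * db A dA (fun i => x i) l k) with hT
  have hbg : |T / ‖x‖ ^ 2 - 2 * (pf a x / ‖x‖ ^ 2) ^ 2| ≤ cM n Λ * ‖x‖ := by
    have h1 : |T - 2 * ‖x‖ ^ 2| ≤ 8 * n ^ 4 * Λ * ‖x‖ * ‖x‖ ^ 2 := hcb.bgrad hx2
    have h2 : |T / ‖x‖ ^ 2 - 2| ≤ 8 * n ^ 4 * Λ * ‖x‖ := by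
      rw [show T / ‖x‖ ^ 2 - 2 = (T - 2 * ‖x‖ ^ 2) / ‖x‖ ^ 2 by field_simp, abs_div,
        abs_of_pos (show 0 < ‖x‖ ^ 2 by positivity), div_le_iff₀ (by positivity)]
      exact h1
    set α := pf a x / ‖x‖ ^ 2
    obtain ⟨h3, h4⟩ := abs_le.mp h2
    obtain ⟨h5, h6⟩ := abs_le.mp hα1
    obtain ⟨h5', h6'⟩ := abs_le.mp (hα.trans hMr)
    have h7 : |2 * (α ^ 2 - 1)| ≤ 5 * (n ^ 2 * Λ * ‖x‖) := by
      have : 2 * (α ^ 2 - 1) = (α - 1) * (2 * (α + 1)) := by ring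
      rw [this]
      refine (abs_mul_le hα1 (Q := 5) ?_).trans (le_of_eq (by ring))
      rw [abs_le]; constructor <;> linarith
    obtain ⟨h8, h9⟩ := abs_le.mp h7
    have h10 := hpow 8 4 (by norm_num) (by norm_num) (by norm_num)
    have h11 : n ^ 2 * Λ * ‖x‖ ≤ n ^ 4 * Λ * ‖x‖ := by
      have : (n : ℝ) ^ 2 ≤ n ^ 4 := pow_le_pow_right₀ (by linarith) (by norm_num)
      gcongr
    have h12 : 0 ≤ n ^ 4 * Λ * ‖x‖ := by positivity
    have h13 : cM n Λ * ‖x‖ = 21 * (n ^ 4 * Λ * ‖x‖) := by unfold cM; ring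
    rw [abs_le]
    constructor <;> linarith
  have key := carleman_scalar (N := n) (M := cM n Λ) (K := cK n Λ) (r := ‖x‖) (τ := τ)
    (X := xop a v x) (S := pop a v x) (v := v x) (γ := γ) (α := pf a x / ‖x‖ ^ 2)
    (dvb := ∑ k, db A dA (fun i => x i) k k) (trA := ∑ i, a i i x)
    (f := fop a (cK n Λ) τ v x) hN hM le_rfl hr hKr hMr
    ((le_max_left _ _).trans hτ) ((le_max_right _ _).trans hτ) hα hTW ha2 hdvb hbg
    htrA rfl rfl rfl
  have hJ : 0 ≤ (‖x‖ ^ n)⁻¹ := by positivity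
  have key2 := mul_le_mul_of_nonneg_left key hJ
  refine le_trans (le_of_eq ?_) key2
  have hd1 := rellich_algebra A (fun i j => hsym i j x) dA (fun i => x i) g
    (fun i j => dd (bv i) (dd (bv j) v) x) (fun i j => dd_comm hv _ _ x) (wtA n (cK n Λ) ‖x‖)
    (‖x‖ * ((cK n Λ * ‖x‖ + (2 - n) * (1 + cK n Λ * ‖x‖)) * (‖x‖ ^ n)⁻¹) / ‖x‖)
  have hd2 := dd_zero_weight hx (hasDerivAt_wtB n (τ := τ) hr hh) (hasDerivAt_wtC n (τ := τ) hr)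
    (differentiableAt_of_contDiffOn_compl (contDiffOn_wtB hK.le τ) hx)
    (differentiableAt_of_contDiffOn_compl (contDiffOn_wtC (cK n Λ) τ) hx) ha hv
  unfold divTerm
  rw [hd2]
  simp_rw [dd_weight hx (hasDerivAt_wtA n (K := cK n Λ) hr)
    (differentiableAt_of_contDiffOn_compl (contDiffOn_wtA (cK n Λ)) hx) ha hv]
  rw [hd1, ← Real.sq_sqrt hg0]
  exact divergence_algebra hr hh

lemma tsupport_subset_of_zero {f w : Euc n → ℝ} (h : ∀ x ∉ tsupport w, f x = 0) :
    tsupport f ⊆ tsupport w :=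
  closure_minimal (fun x hx => by by_contra h1; exact hx (h x h1)) (isClosed_tsupport w)

lemma integrable_mul_of_compl {q f w : Euc n → ℝ} (hq : ContDiffOn ℝ (⊤ : ℕ∞) q {0}ᶜ)
    (hf : Continuous f) (hw : HasCompactSupport w) (h0 : (0 : Euc n) ∉ tsupport w)
    (h : ∀ x ∉ tsupport w, f x = 0) : Integrable (fun x => q x * f x) := by
  have hs := tsupport_subset_of_zero h
  have h1 : Continuous (fun x => q x * f x) :=
    (contDiff_mul_of_contDiffOn_compl (m := 0) (hq.of_le (by simp)) (contDiff_zero.mpr hf)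
      fun h => h0 (hs h)).continuous
  exact h1.integrable_of_hasCompactSupport
    ((hw.mono' (subset_trans subset_closure hs)).mul_left)

lemma integral_dd_weight {q v f : Euc n → ℝ}
    (hq : ContDiffOn ℝ (⊤ : ℕ∞) q {0}ᶜ) (hf : ContDiff ℝ (⊤ : ℕ∞) f)
    (hv : HasCompactSupport v) (h0 : (0 : Euc n) ∉ tsupport v)
    (h : ∀ x ∉ tsupport v, f x = 0) (ξ : Euc n) :
    Integrable (dd ξ (fun x => q x * f x)) ∧ ∫ x, dd ξ (fun x => q x * f x) x = 0 := by
  have hs := tsupport_subset_of_zero h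
  exact integral_dd_mul_eq_zero hq hf (fun h => h0 (hs h))
    (hv.mono' (subset_trans subset_closure hs)) ξ

lemma integral_divTerm (ha : ∀ i j, ContDiff ℝ (⊤ : ℕ∞) (a i j)) {K : ℝ} (hK : 0 ≤ K) (τ : ℝ)
    {v : Euc n → ℝ} (hv : ContDiff ℝ (⊤ : ℕ∞) v) (hc : HasCompactSupport v)
    (h0 : (0 : Euc n) ∉ tsupport v) :
    Integrable (divTerm a K τ v) ∧ ∫ x, divTerm a K τ v x = 0 := by
  have hA : ∀ i j k, ContDiffOn ℝ (⊤ : ℕ∞)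
      (fun y : Euc n => wtA n K ‖y‖ * (a i j y * bf a k y)) {0}ᶜ := fun i j k =>
    (contDiffOn_wtA K).mul ((ha i j).mul (contDiff_bf ha k)).contDiffOn
  have hB : ∀ k, ContDiffOn ℝ (⊤ : ℕ∞)
      (fun y : Euc n => (wtB n K τ ‖y‖ * pf a y + wtC n K τ ‖y‖) * bf a k y) {0}ᶜ := fun k =>
    (((contDiffOn_wtB hK τ).mul (contDiff_pf ha).contDiffOn).add (contDiffOn_wtC K τ)).mul
      (contDiff_bf ha k).contDiffOn
  have h1 : ∀ i j k l p q, Integrable (dd (bv l) (fun y => (wtA n K ‖y‖ * (a i j y * bf a k y))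
        * (dd (bv p) v y * dd (bv q) v y))) ∧
      ∫ x, dd (bv l) (fun y => (wtA n K ‖y‖ * (a i j y * bf a k y))
        * (dd (bv p) v y * dd (bv q) v y)) x = 0 := fun i j k l p q =>
    integral_dd_weight (hA i j k) ((contDiff_dd hv _).mul (contDiff_dd hv _)) hc h0
      (fun x hx => by rw [dd_eq_zero_of_notMem_tsupport hx, zero_mul]) _
  have h2 : ∀ k, Integrable (dd (bv k)
        (fun y => ((wtB n K τ ‖y‖ * pf a y + wtC n K τ ‖y‖) * bf a k y) * (v y * v y))) ∧
      ∫ x, dd (bv k)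
        (fun y => ((wtB n K τ ‖y‖ * pf a y + wtC n K τ ‖y‖) * bf a k y) * (v y * v y)) x = 0 :=
    fun k => integral_dd_weight (hB k) (hv.mul hv) hc h0
      (fun x hx => by rw [image_eq_zero_of_notMem_tsupport hx, zero_mul]) _
  have i3 : ∀ i j k, Integrable (fun x => dd (bv i) (fun y => (wtA n K ‖y‖ * (a i j y * bf a k y))
        * (dd (bv j) v y * dd (bv k) v y)) x
      + dd (bv j) (fun y => (wtA n K ‖y‖ * (a i j y * bf a k y))
        * (dd (bv i) v y * dd (bv k) v y)) x
      - dd (bv k) (fun y => (wtA n K ‖y‖ * (a i j y * bf a k y))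
        * (dd (bv i) v y * dd (bv j) v y)) x) := fun i j k =>
    ((h1 i j k i j k).1.add (h1 i j k j i k).1).sub (h1 i j k k i j).1
  have i4 : Integrable (fun x => ∑ i, ∑ j, ∑ k,
    (dd (bv i) (fun y => (wtA n K ‖y‖ * (a i j y * bf a k y))
        * (dd (bv j) v y * dd (bv k) v y)) x
      + dd (bv j) (fun y => (wtA n K ‖y‖ * (a i j y * bf a k y))
        * (dd (bv i) v y * dd (bv k) v y)) x
      - dd (bv k) (fun y => (wtA n K ‖y‖ * (a i j y * bf a k y))
        * (dd (bv i) v y * dd (bv j) v y)) x)) :=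
    integrable_finsetSum _ fun i _ => integrable_finsetSum _ fun j _ =>
      integrable_finsetSum _ fun k _ => i3 i j k
  have i5 := integrable_finsetSum Finset.univ fun k _ => (h2 k).1
  refine ⟨i4.add i5, ?_⟩
  unfold divTerm
  rw [integral_add i4 i5, integral_finsetSum _ fun k _ => (h2 k).1,
    integral_finsetSum _ fun i _ => integrable_finsetSum _ fun j _ =>
      integrable_finsetSum _ fun k _ => i3 i j k]
  simp_rw [fun k => (h2 k).2]
  simp only [Finset.sum_const_zero, add_zero]
  refine Finset.sum_eq_zero fun i _ => ?_
  rw [integral_finsetSum _ fun j _ => integrable_finsetSum _ fun k _ => i3 i j k]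
  refine Finset.sum_eq_zero fun j _ => ?_
  rw [integral_finsetSum _ fun k _ => i3 i j k]
  refine Finset.sum_eq_zero fun k _ => ?_
  refine (integral_sub ((h1 i j k i j k).1.add (h1 i j k j i k).1) (h1 i j k k i j).1).trans ?_
  rw [integral_add' (h1 i j k i j k).1 (h1 i j k j i k).1]
  simp [(h1 _ _ _ _ _ _).2]

/-- The base of the Carleman weight. -/
def rho (K t : ℝ) : ℝ := (1 + K * t) / t

lemma rho_pos {K t : ℝ} (hK : 0 ≤ K) (ht : 0 < t) : 0 < rho K t := by
  unfold rho; positivity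

lemma hasDerivAt_rho_pow {K t : ℝ} (ht : 0 < t) (hh : 0 < 1 + K * t) (τ : ℕ) :
    HasDerivAt (fun t => rho K t ^ τ) (-τ * rho K t ^ τ / (t * (1 + K * t))) t := by
  have h1 : HasDerivAt (rho K) ((K * t - (1 + K * t) * 1) / t ^ 2) t :=
    (hasDerivAt_affine K t).fun_div (hasDerivAt_id' t) ht.ne'
  refine (h1.fun_pow τ).congr_deriv ?_
  cases τ with
  | zero => simp
  | succ m =>
    have hr : rho K t * t = 1 + K * t := by unfold rho; field_simp
    rw [pow_succ, ← hr]
    have : rho K t ≠ 0 := by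
      intro h; rw [h, zero_mul] at hr; exact hh.ne hr
    push_cast
    field_simp
    linear_combination (-(rho K t ^ m * rho K t)) * hr

lemma contDiffOn_rho_pow (K : ℝ) (τ : ℕ) :
    ContDiffOn ℝ (⊤ : ℕ∞) (fun y : Euc n => rho K ‖y‖ ^ τ) {0}ᶜ := by
  have h := contDiffOn_norm_compl (n := n)
  exact ((contDiffOn_const.add (contDiffOn_const.mul h)).div h
    fun x hx => norm_ne_zero_iff.mpr hx).pow τ

/-- The conjugated function. -/
def conj (K : ℝ) (τ : ℕ) (w : Euc n → ℝ) (y : Euc n) : ℝ := rho K ‖y‖ ^ τ * w y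

lemma dd_conj {K : ℝ} (hK : 0 ≤ K) (τ : ℕ) {w : Euc n → ℝ} {x : Euc n} (hx : x ≠ 0)
    (hw : ContDiff ℝ (⊤ : ℕ∞) w) (j : Fin n) :
    dd (bv j) (conj K τ w) x = -τ * ((‖x‖ ^ 2 * (1 + K * ‖x‖))⁻¹ * x j * conj K τ w x)
      + rho K ‖x‖ ^ τ * dd (bv j) w x := by
  have hr : 0 < ‖x‖ := norm_pos_iff.mpr hx
  have hh : 0 < 1 + K * ‖x‖ := by positivity
  unfold conj
  rw [dd_mul (differentiableAt_of_contDiffOn_compl (contDiffOn_rho_pow K τ) hx)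
    (smooth_differentiableAt hw x), dd_radial hx (hasDerivAt_rho_pow hr hh τ)]
  field_simp

lemma hasDerivAt_psi {K t : ℝ} (ht : 0 < t) (hh : 0 < 1 + K * t) :
    HasDerivAt (fun t => (t ^ 2 * (1 + K * t))⁻¹)
      (-(2 + 3 * (K * t)) / (t ^ 3 * (1 + K * t) ^ 2)) t := by
  refine (((hasDerivAt_pow 2 t).fun_mul (hasDerivAt_affine K t)).fun_inv
    (by positivity)).congr_deriv ?_
  generalize hdef : 1 + K * t = h at hh ⊢
  have : K * t = h - 1 := by linarith
  field_simp
  linear_combination (2 * t) * this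

lemma dd_dd_conj {K : ℝ} (hK : 0 ≤ K) (τ : ℕ) {w : Euc n → ℝ} {x : Euc n} (hx : x ≠ 0)
    (hw : ContDiff ℝ (⊤ : ℕ∞) w) (hv : ContDiff ℝ (⊤ : ℕ∞) (conj K τ w)) (i j : Fin n) :
    rho K ‖x‖ ^ τ * dd (bv i) (dd (bv j) w) x = dd (bv i) (dd (bv j) (conj K τ w)) x
      + τ * ((‖x‖ ^ 2 * (1 + K * ‖x‖))⁻¹ * (x i * dd (bv j) (conj K τ w) x
        + x j * dd (bv i) (conj K τ w) x))
      + τ ^ 2 * ((‖x‖ ^ 2 * (1 + K * ‖x‖))⁻¹ ^ 2 * (x i * x j) * conj K τ w x)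
      + τ * (kd i j * (‖x‖ ^ 2 * (1 + K * ‖x‖))⁻¹
        - (2 + 3 * (K * ‖x‖)) / (‖x‖ ^ 4 * (1 + K * ‖x‖) ^ 2) * (x i * x j))
        * conj K τ w x := by
  have hr : 0 < ‖x‖ := norm_pos_iff.mpr hx
  have hh : 0 < 1 + K * ‖x‖ := by positivity
  have hev : dd (bv j) (conj K τ w) =ᶠ[𝓝 x] fun y =>
      -τ * ((‖y‖ ^ 2 * (1 + K * ‖y‖))⁻¹ * y j * conj K τ w y)
        + rho K ‖y‖ ^ τ * dd (bv j) w y := by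
    filter_upwards [isOpen_compl_singleton.mem_nhds hx] with y hy
    exact dd_conj hK τ hy hw j
  have hdw := contDiff_dd hw (bv j)
  have hψ : DifferentiableAt ℝ (fun y : Euc n => (‖y‖ ^ 2 * (1 + K * ‖y‖))⁻¹) x := by
    have hnd : DifferentiableAt ℝ (fun y : Euc n => ‖y‖) x :=
      differentiableAt_of_contDiffOn_compl contDiffOn_norm_compl hx
    exact ((hnd.fun_pow 2).fun_mul ((hnd.const_mul K).const_add 1)).fun_inv (by positivity)
  have hρ := differentiableAt_of_contDiffOn_compl (contDiffOn_rho_pow (n := n) K τ) hx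
  have hc := smooth_differentiableAt (contDiff_coord (n := n) j) x
  have hvd := smooth_differentiableAt hv x
  have h1 : dd (bv i) (dd (bv j) (conj K τ w)) x = dd (bv i) (fun y =>
      -τ * ((‖y‖ ^ 2 * (1 + K * ‖y‖))⁻¹ * y j * conj K τ w y)
        + rho K ‖y‖ ^ τ * dd (bv j) w y) x := by
    rw [dd, hev.fderiv_eq]; rfl
  rw [h1, dd_add ((differentiableAt_const _).fun_mul ((hψ.fun_mul hc).fun_mul hvd))
    (hρ.fun_mul (smooth_differentiableAt hdw x)),
    dd_mul (differentiableAt_const _) ((hψ.fun_mul hc).fun_mul hvd), dd_const,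
    dd_mul (hψ.fun_mul hc) hvd, dd_mul hψ hc, dd_coord, bv_apply,
    dd_mul hρ (smooth_differentiableAt hdw x),
    dd_radial hx (hasDerivAt_psi hr hh), dd_radial hx (hasDerivAt_rho_pow hr hh τ)]
  have h2 : rho K ‖x‖ ^ τ * dd (bv j) w x = dd (bv j) (conj K τ w) x
      + τ * ((‖x‖ ^ 2 * (1 + K * ‖x‖))⁻¹ * x j * conj K τ w x) := by
    rw [dd_conj hK τ hx hw j]; ring
  have h3 : -↑τ * rho K ‖x‖ ^ τ / (‖x‖ * (1 + K * ‖x‖)) / ‖x‖ * x i * dd (bv j) w x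
      = -τ / (‖x‖ * (1 + K * ‖x‖)) / ‖x‖ * x i * (rho K ‖x‖ ^ τ * dd (bv j) w x) := by ring
  rw [h3, h2, show (if i = j then (1 : ℝ) else 0) = kd i j from rfl]
  generalize 1 + K * ‖x‖ = h at hh ⊢
  field_simp
  ring

lemma fop_conj (hsym : ∀ i j x, a i j x = a j i x) {K : ℝ} (hK : 0 ≤ K) (τ : ℕ)
    {w : Euc n → ℝ} {x : Euc n} (hx : x ≠ 0) (hw : ContDiff ℝ (⊤ : ℕ∞) w)
    (hv : ContDiff ℝ (⊤ : ℕ∞) (conj K τ w)) :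
    fop a K τ (conj K τ w) x = ‖x‖ ^ 2 * (rho K ‖x‖ ^ τ * pop a w x) := by
  have hr : 0 < ‖x‖ := norm_pos_iff.mpr hx
  have hh : 0 < 1 + K * ‖x‖ := by positivity
  set v := conj K τ w with hvdef
  set Ψ := (‖x‖ ^ 2 * (1 + K * ‖x‖))⁻¹ with hΨ
  have h1 : ∀ i j, a i j x * (rho K ‖x‖ ^ τ * dd (bv i) (dd (bv j) w) x)
      = a i j x * dd (bv i) (dd (bv j) v) x
        + τ * Ψ * (a i j x * x i * dd (bv j) v x) + τ * Ψ * (a i j x * x j * dd (bv i) v x)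
        + (τ ^ 2 * Ψ ^ 2 * v x - τ * v x * (2 + 3 * (K * ‖x‖)) / (‖x‖ ^ 4 * (1 + K * ‖x‖) ^ 2))
          * (x i * (a i j x * x j))
        + τ * v x * Ψ * (a i j x * kd i j) := by
    intro i j
    rw [dd_dd_conj hK τ hx hw hv]
    ring
  have e1 : rho K ‖x‖ ^ τ * pop a w x
      = ∑ i, ∑ j, a i j x * (rho K ‖x‖ ^ τ * dd (bv i) (dd (bv j) w) x) := by
    unfold pop
    simp only [Finset.mul_sum]
    refine Finset.sum_congr rfl fun i _ => Finset.sum_congr rfl fun j _ => ?_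
    ring
  have e2 : ∑ i, ∑ j, a i j x * x i * dd (bv j) v x = xop a v x := by
    rw [Finset.sum_comm]
    simp only [xop, bf, Finset.sum_mul]
    refine Finset.sum_congr rfl fun i _ => Finset.sum_congr rfl fun j _ => ?_
    rw [hsym j i]
  have e3 : ∑ i, ∑ j, a i j x * x j * dd (bv i) v x = xop a v x := by
    simp only [xop, bf, Finset.sum_mul]
  have e4 : ∑ i, x i * ∑ j, a i j x * x j = pf a x := rfl
  have e5 : ∑ i, ∑ j, a i j x * kd i j = ∑ i, a i i x := by simp [kd]
  rw [e1]
  simp only [h1, Finset.sum_add_distrib, ← Finset.mul_sum, e2, e3, e4, e5]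
  rw [show ∑ i, ∑ j, a i j x * dd (bv i) (dd (bv j) v) x = pop a v x from rfl, fop, hΨ]
  generalize 1 + K * ‖x‖ = h at hh ⊢
  field_simp
  ring

/-- The integrand of the Carleman estimate. -/
def carlemanG (a : Fin n → Fin n → Euc n → ℝ) (K : ℝ) (τ : ℕ) (w : Euc n → ℝ) (x : Euc n) : ℝ :=
  (‖x‖ ^ n)⁻¹ * (‖x‖ ^ 3 * grad2 (conj K τ w) x + τ ^ 2 * ‖x‖ * conj K τ w x ^ 2)
    - (‖x‖ ^ n)⁻¹ * (4 * (‖x‖ ^ 2 * (rho K ‖x‖ ^ τ * pop a w x)) ^ 2 / τ)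

lemma contDiff_conj (K : ℝ) (τ : ℕ) {w : Euc n → ℝ} (hw : ContDiff ℝ (⊤ : ℕ∞) w)
    (h0 : (0 : Euc n) ∉ tsupport w) : ContDiff ℝ (⊤ : ℕ∞) (conj K τ w) :=
  contDiff_mul_of_contDiffOn_compl (contDiffOn_rho_pow K τ) hw h0

lemma tsupport_conj_subset (K : ℝ) (τ : ℕ) (w : Euc n → ℝ) :
    tsupport (conj K τ w) ⊆ tsupport w :=
  tsupport_subset_of_zero fun x hx => by
    rw [conj, image_eq_zero_of_notMem_tsupport hx, mul_zero]

lemma grad2_eq_zero {v : Euc n → ℝ} {x : Euc n} (hx : x ∉ tsupport v) : grad2 v x = 0 :=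
  Finset.sum_eq_zero fun i _ => by rw [dd_eq_zero_of_notMem_tsupport hx]; ring

lemma pop_eq_zero {v : Euc n → ℝ} {x : Euc n} (hx : x ∉ tsupport v) : pop a v x = 0 :=
  Finset.sum_eq_zero fun i _ => Finset.sum_eq_zero fun j _ => by
    rw [dd_eq_zero_of_notMem_tsupport fun h => hx (tsupport_dd_subset v _ h), mul_zero]

lemma continuous_grad2 {v : Euc n → ℝ} (hv : ContDiff ℝ (⊤ : ℕ∞) v) : Continuous (grad2 v) :=
  continuous_finsetSum _ fun _ _ => (contDiff_dd hv _).continuous.pow 2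

lemma continuous_pop (ha : ∀ i j, ContDiff ℝ (⊤ : ℕ∞) (a i j)) {v : Euc n → ℝ}
    (hv : ContDiff ℝ (⊤ : ℕ∞) v) : Continuous (pop a v) :=
  continuous_finsetSum _ fun i _ => continuous_finsetSum _ fun j _ =>
    (ha i j).continuous.mul (contDiff_dd (contDiff_dd hv _) _).continuous

/-- The Carleman estimate. -/
lemma carleman_integral (hn : 2 ≤ n) (ha : ∀ i j, ContDiff ℝ (⊤ : ℕ∞) (a i j))
    (hsym : ∀ i j x, a i j x = a j i x) {Λ R : ℝ}
    (hcb : ∀ x : Euc n, ‖x‖ ≤ R → CoeffBound (av a x) (dav a x) (fun i => x i) ‖x‖ Λ)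
    (hΛ : 0 ≤ Λ) (hKR : cK n Λ * R ≤ 1) {τ : ℕ} (hτ : cT n Λ ≤ τ) {w : Euc n → ℝ}
    (hw : ContDiff ℝ (⊤ : ℕ∞) w) (hc : HasCompactSupport w) (h0 : (0 : Euc n) ∉ tsupport w)
    (hR : ∀ x ∈ tsupport w, ‖x‖ ≤ R) :
    Integrable (carlemanG a (cK n Λ) τ w) ∧ ∫ x, carlemanG a (cK n Λ) τ w x ≤ 0 := by
  have hK : 0 ≤ cK n Λ := by unfold cK cM; positivity
  set K := cK n Λ
  set v := conj K τ w with hvdef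
  have hv : ContDiff ℝ (⊤ : ℕ∞) v := contDiff_conj K τ hw h0
  have hvs : tsupport v ⊆ tsupport w := tsupport_conj_subset K τ w
  have hvc : HasCompactSupport v := hc.mono' (subset_trans subset_closure hvs)
  have hJ : ContDiffOn ℝ (⊤ : ℕ∞) (fun x : Euc n => (‖x‖ ^ n)⁻¹) {0}ᶜ :=
    (contDiffOn_norm_compl.pow n).inv fun x hx => pow_ne_zero _ (norm_ne_zero_iff.mpr hx)
  have i1 : Integrable (fun x : Euc n => (‖x‖ ^ n)⁻¹ *
      (‖x‖ ^ 3 * grad2 v x + τ ^ 2 * ‖x‖ * v x ^ 2)) := by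
    refine integrable_mul_of_compl hJ ?_ hc h0 fun x hx => ?_
    · have := continuous_grad2 hv
      have := hv.continuous
      fun_prop
    · rw [grad2_eq_zero fun h => hx (hvs h), image_eq_zero_of_notMem_tsupport fun h => hx (hvs h)]
      ring
  have i2 : Integrable (fun x : Euc n => (‖x‖ ^ n)⁻¹ *
      (4 * (‖x‖ ^ 2 * (rho K ‖x‖ ^ τ * pop a w x)) ^ 2 / τ)) := by
    have := integrable_mul_of_compl (q := fun x : Euc n => (‖x‖ ^ n)⁻¹ *
        (rho K ‖x‖ ^ τ * rho K ‖x‖ ^ τ))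
      (f := fun x => 4 * (‖x‖ ^ 2 * pop a w x) ^ 2 / τ) (w := w)
      (hJ.mul ((contDiffOn_rho_pow K τ).mul (contDiffOn_rho_pow K τ))) ?_ hc h0 fun x hx => ?_
    · refine this.congr (ae_of_all _ fun x => ?_)
      ring
    · have := continuous_pop ha hw
      fun_prop
    · simp only [pop_eq_zero hx]
      ring
  have hG : Integrable (carlemanG a K τ w) := i1.sub i2
  refine ⟨hG, ?_⟩
  obtain ⟨i3, h3⟩ := integral_divTerm ha hK τ hv hvc fun h => h0 (hvs h)
  have h4 : ∫ x, (carlemanG a K τ w x + divTerm a K τ v x) ≤ 0 := by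
    refine integral_nonpos fun x => ?_
    by_cases hx : x ∈ tsupport w
    · have hx0 : x ≠ 0 := fun h => h0 (h ▸ hx)
      have hxR := hR x hx
      have hb := carleman_pointwise hn ha hsym hx0 (hcb x hxR)
        ((mul_le_mul_of_nonneg_left hxR hK).trans hKR) hτ hv
      rw [fop_conj hsym hK τ hx0 hw hv] at hb
      simp only [carlemanG, Pi.zero_apply]
      linarith
    · have hxv : x ∉ tsupport v := fun h => hx (hvs h)
      have hd : divTerm a K τ v x = 0 := by
        have hz : ∀ (q : Euc n → ℝ) (f : Euc n → ℝ), (∀ y ∉ tsupport v, f y = 0) → ∀ ξ,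
            dd ξ (fun y => q y * f y) x = 0 := fun q f hf ξ =>
          dd_eq_zero_of_notMem_tsupport (fun h => hxv (tsupport_subset_of_zero
            (f := fun y => q y * f y) (fun y hy => by rw [hf y hy, mul_zero]) h)) ξ
        have hz1 : ∀ p q, ∀ y ∉ tsupport v, dd (bv p) v y * dd (bv q) v y = 0 :=
          fun p q y hy => by rw [dd_eq_zero_of_notMem_tsupport hy, zero_mul]
        unfold divTerm
        rw [Finset.sum_eq_zero, Finset.sum_eq_zero, add_zero]
        · intro k _
          exact hz _ _ (fun y hy => by rw [image_eq_zero_of_notMem_tsupport hy, zero_mul]) _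
        · intro i _
          refine Finset.sum_eq_zero fun j _ => Finset.sum_eq_zero fun k _ => ?_
          rw [hz _ _ (hz1 _ _), hz _ _ (hz1 _ _), hz _ _ (hz1 _ _)]
          ring
      simp only [carlemanG, Pi.zero_apply]
      rw [hd, ← hvdef, grad2_eq_zero hxv, image_eq_zero_of_notMem_tsupport hxv, pop_eq_zero hx]
      simp
  rwa [integral_add hG i3, h3, add_zero] at h4

lemma dd_comp_smul {g : Euc n → ℝ} (hg : ContDiff ℝ (⊤ : ℕ∞) g) (c : ℝ) (ξ x : Euc n) :
    dd ξ (fun y => g (c • y)) x = c * dd ξ g (c • x) := by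
  have h1 : HasFDerivAt (fun y : Euc n => c • y) (c • ContinuousLinearMap.id ℝ (Euc n)) x :=
    (ContinuousLinearMap.id ℝ (Euc n)).hasFDerivAt.const_smul c
  have h2 := (smooth_differentiableAt hg (c • x)).hasFDerivAt.comp x h1
  have h3 : fderiv ℝ (fun y => g (c • y)) x = _ := h2.fderiv
  rw [dd, h3]
  simp [dd]

lemma pop_mul (hsym : ∀ i j x, a i j x = a j i x) {f u : Euc n → ℝ}
    (hf : ContDiff ℝ (⊤ : ℕ∞) f) (hu : ContDiff ℝ (⊤ : ℕ∞) u) (x : Euc n) :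
    pop a (fun y => f y * u y) x = f x * pop a u x + u x * pop a f x
      + 2 * ∑ i, ∑ j, a i j x * (dd (bv i) f x * dd (bv j) u x) := by
  have h1 : ∀ j, dd (bv j) (fun y => f y * u y) =
      fun y => dd (bv j) f y * u y + f y * dd (bv j) u y := fun j => by
    ext y
    exact dd_mul (smooth_differentiableAt hf y) (smooth_differentiableAt hu y) _
  have h2 : ∀ i j, dd (bv i) (dd (bv j) (fun y => f y * u y)) x
      = dd (bv i) (dd (bv j) f) x * u x + dd (bv j) f x * dd (bv i) u x
        + (dd (bv i) f x * dd (bv j) u x + f x * dd (bv i) (dd (bv j) u) x) := fun i j => by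
    have d1 := smooth_differentiableAt hf x
    have d2 := smooth_differentiableAt hu x
    have d3 := smooth_differentiableAt (contDiff_dd hf (bv j)) x
    have d4 := smooth_differentiableAt (contDiff_dd hu (bv j)) x
    rw [h1, dd_add (d3.fun_mul d2) (d1.fun_mul d4), dd_mul d3 d2, dd_mul d1 d4]
  have h3 : ∑ i, ∑ j, a i j x * (dd (bv j) f x * dd (bv i) u x)
      = ∑ i, ∑ j, a i j x * (dd (bv i) f x * dd (bv j) u x) := by
    rw [Finset.sum_comm]
    refine Finset.sum_congr rfl fun i _ => Finset.sum_congr rfl fun j _ => ?_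
    rw [hsym]
  have h4 : ∀ i j, a i j x * dd (bv i) (dd (bv j) (fun y => f y * u y)) x
      = f x * (a i j x * dd (bv i) (dd (bv j) u) x) + u x * (a i j x * dd (bv i) (dd (bv j) f) x)
        + a i j x * (dd (bv j) f x * dd (bv i) u x)
        + a i j x * (dd (bv i) f x * dd (bv j) u x) := fun i j => by rw [h2]; ring
  unfold pop
  simp only [h4, Finset.sum_add_distrib, ← Finset.mul_sum, h3]
  ring

lemma sq_add_sum_abs_le (b : ℝ) (f : Fin n → ℝ) :
    (|b| + ∑ i, |f i|) ^ 2 ≤ (n + 1) * (b ^ 2 + ∑ i, f i ^ 2) := by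
  have h1 := sq_sum_le_card_mul_sum_sq (s := (Finset.univ : Finset (Option (Fin n))))
    (f := fun o => Option.elim o |b| fun i => |f i|)
  simp only [Fintype.sum_option, Option.elim, sq_abs, Finset.card_univ, Fintype.card_option,
    Fintype.card_fin] at h1
  exact_mod_cast h1

lemma grad2_conj_le {K : ℝ} (hK : 0 ≤ K) (τ : ℕ) {w : Euc n → ℝ} {x : Euc n} (hx : x ≠ 0)
    (hw : ContDiff ℝ (⊤ : ℕ∞) w) :
    ‖x‖ ^ 2 * ((rho K ‖x‖ ^ τ) ^ 2 * grad2 w x) ≤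
      2 * (‖x‖ ^ 2 * grad2 (conj K τ w) x) + 2 * (τ ^ 2 * conj K τ w x ^ 2) := by
  have hr : 0 < ‖x‖ := norm_pos_iff.mpr hx
  have hh : 1 ≤ 1 + K * ‖x‖ := by nlinarith [mul_nonneg hK hr.le]
  have h1 : ∀ j, ‖x‖ ^ 2 * ((rho K ‖x‖ ^ τ) ^ 2 * dd (bv j) w x ^ 2) ≤
      2 * (‖x‖ ^ 2 * dd (bv j) (conj K τ w) x ^ 2)
        + 2 * (τ ^ 2 * conj K τ w x ^ 2 * (‖x‖ ^ 2)⁻¹) * x j ^ 2 := by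
    intro j
    have h := dd_conj hK τ hx hw j
    set D := dd (bv j) (conj K τ w) x
    set v := conj K τ w x
    have e : rho K ‖x‖ ^ τ * dd (bv j) w x = D + τ * ((‖x‖ ^ 2 * (1 + K * ‖x‖))⁻¹ * x j * v) := by
      linarith
    have hi : (1 + K * ‖x‖)⁻¹ ^ 2 ≤ 1 := by
      have := inv_le_one_of_one_le₀ hh
      have h0 : 0 ≤ (1 + K * ‖x‖)⁻¹ := by positivity
      exact pow_le_one₀ h0 this
    rw [← mul_pow, e, mul_inv]
    generalize (1 + K * ‖x‖)⁻¹ = q at hi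
    have e2 : ‖x‖ ^ 2 * ((‖x‖ ^ 2)⁻¹ * (‖x‖ ^ 2)⁻¹) = (‖x‖ ^ 2)⁻¹ := by field_simp
    have h2 : (D + τ * ((‖x‖ ^ 2)⁻¹ * q * x j * v)) ^ 2 ≤
        2 * D ^ 2 + 2 * (τ * ((‖x‖ ^ 2)⁻¹ * q * x j * v)) ^ 2 := by
      nlinarith only [sq_nonneg (D - τ * ((‖x‖ ^ 2)⁻¹ * q * x j * v))]
    have h3 := mul_le_mul_of_nonneg_left h2 (sq_nonneg ‖x‖)
    have h4 : 2 * (τ ^ 2 * v ^ 2 * (‖x‖ ^ 2)⁻¹) * x j ^ 2 * q ^ 2 ≤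
        2 * (τ ^ 2 * v ^ 2 * (‖x‖ ^ 2)⁻¹) * x j ^ 2 * 1 :=
      mul_le_mul_of_nonneg_left hi (by positivity)
    have h5 : ‖x‖ ^ 2 * (2 * D ^ 2 + 2 * (τ * ((‖x‖ ^ 2)⁻¹ * q * x j * v)) ^ 2)
        = 2 * (‖x‖ ^ 2 * D ^ 2) + 2 * (τ ^ 2 * v ^ 2 * (‖x‖ ^ 2)⁻¹) * x j ^ 2 * q ^ 2 := by
      linear_combination (2 * (τ ^ 2 * v ^ 2) * x j ^ 2 * q ^ 2) * e2
    linarith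
  have h2 := Finset.sum_le_sum fun j (_ : j ∈ Finset.univ) => h1 j
  simp only [Finset.sum_add_distrib, ← Finset.mul_sum, sum_sq_coord] at h2
  have e3 : 2 * (τ ^ 2 * conj K τ w x ^ 2 * (‖x‖ ^ 2)⁻¹) * ‖x‖ ^ 2 =
      2 * (τ ^ 2 * conj K τ w x ^ 2) := by field_simp
  rw [e3] at h2
  exact h2

/-- Where a differential inequality holds the operator term of the Carleman integrand is
absorbed. -/
lemma carlemanG_lower_of_ineq {K : ℝ} (hK : 0 ≤ K) {τ : ℕ} {w : Euc n → ℝ} {x : Euc n}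
    (hx : x ≠ 0) (hx1 : ‖x‖ ≤ 1) (hw : ContDiff ℝ (⊤ : ℕ∞) w) {C : ℝ}
    (hτ : 24 * C ^ 2 * (n + 1) ≤ τ) (hτ1 : 1 ≤ τ)
    (h : |pop a w x| ≤ C * (|w x| + ∑ i, |dd (bv i) w x|)) :
    (‖x‖ ^ n)⁻¹ * (τ ^ 2 * ‖x‖ * conj K τ w x ^ 2 / 2) ≤ carlemanG a K τ w x := by
  have hr : 0 < ‖x‖ := norm_pos_iff.mpr hx
  have hτ1' : (1 : ℝ) ≤ τ := by exact_mod_cast hτ1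
  have hτ0 : (0 : ℝ) < τ := by linarith
  have h1 := grad2_conj_le hK τ hx hw
  have hP : pop a w x ^ 2 ≤ C ^ 2 * ((n + 1) * (w x ^ 2 + grad2 w x)) := by
    rw [← sq_abs]
    calc |pop a w x| ^ 2 ≤ (C * (|w x| + ∑ i, |dd (bv i) w x|)) ^ 2 :=
          pow_le_pow_left₀ (abs_nonneg _) h 2
      _ = C ^ 2 * (|w x| + ∑ i, |dd (bv i) w x|) ^ 2 := by ring
      _ ≤ _ := mul_le_mul_of_nonneg_left (sq_add_sum_abs_le _ _) (sq_nonneg C)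
  have hg0 : 0 ≤ grad2 (conj K τ w) x := Finset.sum_nonneg fun i _ => sq_nonneg _
  have hv : conj K τ w x = rho K ‖x‖ ^ τ * w x := rfl
  unfold carlemanG
  rw [← mul_sub]
  refine mul_le_mul_of_nonneg_left ?_ (by positivity)
  set r := ‖x‖
  set v := conj K τ w x
  set γ := grad2 (conj K τ w) x
  set p := rho K r ^ τ
  set M := C ^ 2 * ((n : ℝ) + 1) with hM
  have hM0 : 0 ≤ M := by positivity
  have hτM : 24 * M ≤ τ := by rw [hM]; linarith
  have hf : (r ^ 2 * (p * pop a w x)) ^ 2 ≤ M * (r ^ 4 * v ^ 2 + r ^ 2 * (2 * (r ^ 2 * γ)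
      + 2 * (τ ^ 2 * v ^ 2))) := by
    have e1 : (r ^ 2 * (p * pop a w x)) ^ 2 = r ^ 4 * p ^ 2 * pop a w x ^ 2 := by ring
    have e2 := mul_le_mul_of_nonneg_left hP (by positivity : 0 ≤ r ^ 4 * p ^ 2)
    have e3 := mul_le_mul_of_nonneg_left h1 (by positivity : 0 ≤ M * r ^ 2)
    rw [e1]
    refine e2.trans ?_
    rw [hv] at e3 ⊢
    calc r ^ 4 * p ^ 2 * (C ^ 2 * ((n + 1) * (w x ^ 2 + grad2 w x)))
        = M * (r ^ 4 * (p * w x) ^ 2) + M * r ^ 2 * (r ^ 2 * (p ^ 2 * grad2 w x)) := by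
          rw [hM]; ring
      _ ≤ _ := by linarith
  have k1 : r ^ 4 ≤ r ^ 3 := pow_le_pow_of_le_one hr.le hx1 (by norm_num)
  have k2 : r ^ 2 ≤ r := by nlinarith only [hr, hx1]
  have k3 : r ^ 4 ≤ r := by nlinarith only [hr, hx1, k1, k2]
  have hτ2 : (1 : ℝ) ≤ (τ : ℝ) ^ 2 := one_le_pow₀ hτ1'
  have hf2 : M * (r ^ 4 * v ^ 2 + r ^ 2 * (2 * (r ^ 2 * γ) + 2 * (τ ^ 2 * v ^ 2))) ≤
      M * (3 * (τ ^ 2 * r * v ^ 2) + 3 * (r ^ 3 * γ)) := by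
    refine mul_le_mul_of_nonneg_left ?_ hM0
    have g1 : r ^ 4 * v ^ 2 ≤ τ ^ 2 * r * v ^ 2 := by
      refine mul_le_mul_of_nonneg_right ?_ (sq_nonneg v)
      nlinarith only [hτ2, k3, hr]
    have g2 : r ^ 2 * (τ ^ 2 * v ^ 2) ≤ r * (τ ^ 2 * v ^ 2) :=
      mul_le_mul_of_nonneg_right k2 (by positivity)
    have g3 : r ^ 4 * γ ≤ r ^ 3 * γ := mul_le_mul_of_nonneg_right k1 hg0
    have g4 : 0 ≤ r ^ 3 * γ := by positivity
    nlinarith only [g1, g2, g3, g4]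
  have hf3 : 4 * (r ^ 2 * (p * pop a w x)) ^ 2 / τ ≤ (τ ^ 2 * r * v ^ 2 + r ^ 3 * γ) / 2 := by
    rw [div_le_iff₀ hτ0]
    have g5 : 0 ≤ τ ^ 2 * r * v ^ 2 + r ^ 3 * γ := by positivity
    have := mul_le_mul_of_nonneg_right hτM g5
    linarith
  have g6 : 0 ≤ r ^ 3 * γ := by positivity
  linarith

lemma carlemanG_lower {K : ℝ} {τ : ℕ} (hτ1 : 1 ≤ τ) (w : Euc n → ℝ) {x : Euc n}
    (hx : x ≠ 0) (hx1 : ‖x‖ ≤ 1) {q M : ℝ} (hq : |rho K ‖x‖| ≤ q)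
    (hM : |pop a w x| ≤ M) :
    -((‖x‖ ^ n)⁻¹ * (4 * (q ^ τ) ^ 2 * M ^ 2)) ≤ carlemanG a K τ w x := by
  have hr : 0 < ‖x‖ := norm_pos_iff.mpr hx
  have hτ1' : (1 : ℝ) ≤ τ := by exact_mod_cast hτ1
  have hg0 : 0 ≤ grad2 (conj K τ w) x := Finset.sum_nonneg fun i _ => sq_nonneg _
  unfold carlemanG
  rw [← mul_sub, ← mul_neg]
  refine mul_le_mul_of_nonneg_left ?_ (by positivity)
  have h0 : 0 ≤ ‖x‖ ^ 3 * grad2 (conj K τ w) x + τ ^ 2 * ‖x‖ * conj K τ w x ^ 2 := by positivity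
  have h1 : 4 * (‖x‖ ^ 2 * (rho K ‖x‖ ^ τ * pop a w x)) ^ 2 / τ ≤
      4 * (‖x‖ ^ 2 * (rho K ‖x‖ ^ τ * pop a w x)) ^ 2 := div_le_self (by positivity) hτ1'
  have h2 : (‖x‖ ^ 2 * (rho K ‖x‖ ^ τ * pop a w x)) ^ 2 ≤ (1 * (q ^ τ * M)) ^ 2 := by
    rw [← sq_abs, abs_mul, abs_mul, abs_pow, abs_pow, abs_norm]
    have hq0 := (abs_nonneg _).trans hq
    have := pow_le_one₀ (n := 2) hr.le hx1
    gcongr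
  nlinarith only [h0, h1, h2]

lemma carlemanG_eq_zero {K : ℝ} {τ : ℕ} {w : Euc n → ℝ} {x : Euc n} (hx : x ∉ tsupport w) :
    carlemanG a K τ w x = 0 := by
  have hxv : x ∉ tsupport (conj K τ w) := fun h => hx (tsupport_conj_subset K τ w h)
  rw [carlemanG, grad2_eq_zero hxv, image_eq_zero_of_notMem_tsupport hxv, pop_eq_zero hx]
  simp

lemma dd_congr {f g : Euc n → ℝ} {x : Euc n} (h : f =ᶠ[𝓝 x] g) (ξ : Euc n) :
    dd ξ f =ᶠ[𝓝 x] dd ξ g := by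
  filter_upwards [h.fderiv (𝕜 := ℝ)] with y hy
  rw [dd, dd, hy]

lemma pop_congr {f g : Euc n → ℝ} {x : Euc n} (h : f =ᶠ[𝓝 x] g) : pop a f x = pop a g x :=
  Finset.sum_congr rfl fun _ _ => Finset.sum_congr rfl fun _ _ => by
    rw [(dd_congr (dd_congr h _) _).eq_of_nhds]

lemma exists_bound_derivs {g : Euc n → ℝ} (hg : ContDiff ℝ (⊤ : ℕ∞) g) {s : Set (Euc n)}
    (hs : IsCompact s) : ∃ D : ℝ, 1 ≤ D ∧ ∀ y ∈ s, |g y| ≤ D ∧ (∀ i, |dd (bv i) g y| ≤ D) ∧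
      ∀ i j, |dd (bv i) (dd (bv j) g) y| ≤ D := by
  have h1 : Continuous fun y => |g y| + ∑ i, |dd (bv i) g y|
      + ∑ i, ∑ j, |dd (bv i) (dd (bv j) g) y| := by
    have e1 := hg.continuous
    have e2 := fun i => (contDiff_dd hg (bv i)).continuous
    have e3 := fun i j => (contDiff_dd (contDiff_dd hg (bv j)) (bv i)).continuous
    fun_prop
  obtain ⟨D, hD⟩ := hs.exists_bound_of_continuousOn h1.continuousOn
  refine ⟨max D 1, le_max_right _ _, fun y hy => ?_⟩
  have h2 := (le_abs_self _).trans ((hD y hy).trans (le_max_left D 1))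
  have p1 := abs_nonneg (g y)
  have p2 : 0 ≤ ∑ i, |dd (bv i) g y| := Finset.sum_nonneg fun i _ => abs_nonneg _
  have p3 : 0 ≤ ∑ i, ∑ j, |dd (bv i) (dd (bv j) g) y| :=
    Finset.sum_nonneg fun i _ => Finset.sum_nonneg fun j _ => abs_nonneg _
  refine ⟨by linarith, fun i => ?_, fun i j => ?_⟩
  · have := Finset.single_le_sum (f := fun i => |dd (bv i) g y|) (fun i _ => abs_nonneg _)
      (Finset.mem_univ i)
    linarith
  · have q1 := Finset.single_le_sum (f := fun j => |dd (bv i) (dd (bv j) g) y|)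
      (fun i _ => abs_nonneg _) (Finset.mem_univ j)
    have q2 := Finset.single_le_sum (f := fun i => ∑ j, |dd (bv i) (dd (bv j) g) y|)
      (fun i _ => Finset.sum_nonneg fun j _ => abs_nonneg _) (Finset.mem_univ i)
    linarith

lemma rho_eq {K t : ℝ} (ht : 0 < t) : rho K t = t⁻¹ + K := by
  unfold rho; field_simp

lemma rho_lt {K s t : ℝ} (hs : 0 < s) (hst : s < t) : rho K t < rho K s := by
  rw [rho_eq hs, rho_eq (hs.trans hst)]
  have := inv_strictAnti₀ hs hst
  linarith

lemma rho_le {K s t : ℝ} (hs : 0 < s) (hst : s ≤ t) : rho K t ≤ rho K s := by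
  rcases hst.eq_or_lt with rfl | h
  · rfl
  · exact (rho_lt hs h).le

lemma abs_pop_mul_le (hsym : ∀ i j x, a i j x = a j i x) {f u : Euc n → ℝ}
    (hf : ContDiff ℝ (⊤ : ℕ∞) f) (hu : ContDiff ℝ (⊤ : ℕ∞) u) {x : Euc n}
    (hA : ∀ i j, |a i j x| ≤ 2) {C D m : ℝ} (hC : 0 ≤ C)
    (h : |pop a u x| ≤ C * (|u x| + ∑ i, |dd (bv i) u x|))
    (hf0 : |f x| ≤ D) (hf1 : ∀ i, |dd (bv i) f x| ≤ D)
    (hf2 : ∀ i j, |dd (bv i) (dd (bv j) f) x| ≤ D)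
    (hu0 : |u x| ≤ m) (hu1 : ∀ i, |dd (bv i) u x| ≤ m) :
    |pop a (fun y => f y * u y) x| ≤ D * (C * (n + 1) + 6 * n ^ 2) * m := by
  rw [pop_mul hsym hf hu]
  have hD := (abs_nonneg _).trans hf0
  have h1 : |pop a u x| ≤ C * ((n + 1) * m) := by
    refine h.trans (mul_le_mul_of_nonneg_left ?_ hC)
    have := abs_sum_le_card_mul (f := fun i => |dd (bv i) u x|) (B := m)
      fun i => by rw [abs_abs]; exact hu1 i
    have := le_abs_self (∑ i, |dd (bv i) u x|)
    linarith
  have h2 : |pop a f x| ≤ n * (n * (2 * D)) := abs_sum_le_card_mul fun i =>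
    abs_sum_le_card_mul fun j => abs_mul_le (hA i j) (hf2 i j)
  have h3 : |∑ i, ∑ j, a i j x * (dd (bv i) f x * dd (bv j) u x)| ≤ n * (n * (2 * (D * m))) :=
    abs_sum_le_card_mul fun i => abs_sum_le_card_mul fun j =>
      abs_mul_le (hA i j) (abs_mul_le (hf1 i) (hu1 j))
  have h4 := abs_mul_le hf0 h1
  have h5 := abs_mul_le hu0 h2
  have h6 := abs_add_le (f x * pop a u x + u x * pop a f x)
    (2 * ∑ i, ∑ j, a i j x * (dd (bv i) f x * dd (bv j) u x))
  have h7 := abs_add_le (f x * pop a u x) (u x * pop a f x)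
  rw [abs_mul 2, abs_two] at h6
  linarith

/-- Strong unique continuation in normalized coordinates. -/
theorem eq_zero_of_flat (hn : 2 ≤ n) (ha : ∀ i j, ContDiff ℝ (⊤ : ℕ∞) (a i j))
    (hsym : ∀ i j x, a i j x = a j i x) {Λ R : ℝ} (hR : 0 < R)
    (hcb : ∀ x : Euc n, ‖x‖ ≤ R → CoeffBound (av a x) (dav a x) (fun i => x i) ‖x‖ Λ)
    (hΛ : 0 ≤ Λ) (hR1 : R ≤ 1) (hKR : cK n Λ * R ≤ 1) {u : Euc n → ℝ}
    (hu : ContDiff ℝ (⊤ : ℕ∞) u)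
    {C : ℝ} (hC : 0 ≤ C)
    (hop : ∀ x : Euc n, ‖x‖ ≤ R → |pop a u x| ≤ C * (|u x| + ∑ i, |dd (bv i) u x|))
    (hflat : ∀ N : ℕ, ∃ c : ℝ, ∀ x : Euc n, ‖x‖ ≤ R →
      |u x| ≤ c * ‖x‖ ^ N ∧ ∀ i, |dd (bv i) u x| ≤ c * ‖x‖ ^ N)
    {x₀ : Euc n} (hx₀ : ‖x₀‖ < R / 4) : u x₀ = 0 := by
  by_cases h00 : x₀ = 0
  · obtain ⟨c, hc⟩ := hflat 1
    have := (hc x₀ (by linarith)).1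
    rw [h00] at this ⊢
    simpa using this
  by_contra hne
  have hK : 0 ≤ cK n Λ := by unfold cK cM; positivity
  set K := cK n Λ
  have hδ : 0 < ‖x₀‖ := norm_pos_iff.mpr h00
  have hm : 0 < |u x₀| := abs_pos.mpr hne
  obtain ⟨s, hs, hsub⟩ : ∃ s > 0, ball x₀ s ⊆
      {y | ‖x₀‖ / 2 < ‖y‖ ∧ ‖y‖ < R / 4 ∧ |u x₀| / 2 < |u y|} := by
    refine Metric.mem_nhds_iff.mp ?_
    have c1 : Continuous fun y : Euc n => ‖y‖ := continuous_norm
    have c2 : Continuous fun y : Euc n => |u y| := hu.continuous.abs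
    exact ((continuousAt_const.eventually_lt c1.continuousAt (by linarith)).and
      ((c1.continuousAt.eventually_lt continuousAt_const (by linarith)).and
        (continuousAt_const.eventually_lt c2.continuousAt (by linarith))))
  let χ : ContDiffBump (0 : Euc n) := ⟨R / 2, R, by linarith, by linarith⟩
  let ψ : ContDiffBump (0 : Euc n) := ⟨1, 2, by norm_num, by norm_num⟩
  have hχ : ContDiff ℝ (⊤ : ℕ∞) (fun x => χ x) := χ.contDiff
  have hg : ContDiff ℝ (⊤ : ℕ∞) (fun x => 1 - ψ x) := contDiff_const.sub ψ.contDiff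
  obtain ⟨M₂, hM₂⟩ := (isCompact_closedBall (0 : Euc n) R).exists_bound_of_continuousOn
    (continuous_pop ha (hχ.mul hu)).continuousOn
  obtain ⟨D, hD1, hD⟩ := exists_bound_derivs hg (isCompact_closedBall (0 : Euc n) 2)
  set ρ₂ := rho K (R / 2)
  set ρ₄ := rho K (R / 4)
  have hρ₂ : 0 < ρ₂ := rho_pos hK (by linarith)
  have hρ₄ : ρ₂ < ρ₄ := rho_lt (by linarith) (by linarith)
  set B := ((R / 2) ^ n)⁻¹ * (4 * M₂ ^ 2) + 1 with hB
  have hB1 : 1 ≤ B := by rw [hB]; linarith [show 0 ≤ ((R / 2) ^ n)⁻¹ * (4 * M₂ ^ 2) by positivity]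
  set c₀ := ‖x₀‖ / 2 * (|u x₀| / 2) ^ 2 / 2 with hc₀
  have hc₀0 : 0 < c₀ := by positivity
  set V₀ := volume.real (ball x₀ s)
  set V := volume.real (closedBall (0 : Euc n) R)
  have hV₀ : 0 < V₀ := ENNReal.toReal_pos (measure_ball_pos volume x₀ hs).ne' measure_ball_lt_top.ne
  have key : ∀ τ : ℕ, cT n Λ ≤ τ → 24 * C ^ 2 * (n + 1) ≤ τ → 1 ≤ τ →
      c₀ * V₀ * (ρ₄ ^ τ) ^ 2 ≤ B * V * (ρ₂ ^ τ) ^ 2 := by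
    intro τ hτ1 hτ2 hτ3
    obtain ⟨c', hc'⟩ := hflat (n + 2 * τ + 1 + 2)
    set c := |c'|
    have hc : ∀ x : Euc n, ‖x‖ ≤ R → |u x| ≤ c * ‖x‖ ^ (n + 2 * τ + 1 + 2) ∧
        ∀ i, |dd (bv i) u x| ≤ c * ‖x‖ ^ (n + 2 * τ + 1 + 2) := fun x hx =>
      ⟨(hc' x hx).1.trans (by gcongr; exact le_abs_self _),
        fun i => ((hc' x hx).2 i).trans (by gcongr; exact le_abs_self _)⟩
    set P := D * (C * (n + 1) + 6 * n ^ 2) * c with hP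
    have hP0 : 0 ≤ P := by positivity
    set E := 4 * (2 ^ τ) ^ 2 * (4 * P) ^ 2 with hE
    obtain ⟨ε, hε0, hε1, hε2, hε3, hε4⟩ : ∃ ε > 0, ε ≤ 1 ∧ 2 * ε < ‖x₀‖ / 2 ∧ 2 * ε < R / 4 ∧
        E * (2 * ε) ≤ (ρ₂ ^ τ) ^ 2 := by
      have hE0 : 0 ≤ E := by positivity
      have hq : 0 < (ρ₂ ^ τ) ^ 2 / (2 * E + 1) := by positivity
      refine ⟨min (min 1 (‖x₀‖ / 8)) (min (R / 16) ((ρ₂ ^ τ) ^ 2 / (2 * E + 1))), by positivity,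
        ?_, ?_, ?_, ?_⟩
      · exact (min_le_left _ _).trans (min_le_left _ _)
      · have := (min_le_left (min 1 (‖x₀‖ / 8)) (min (R / 16) ((ρ₂ ^ τ) ^ 2 / (2 * E + 1)))).trans
          (min_le_right _ _)
        linarith
      · have := (min_le_right (min 1 (‖x₀‖ / 8)) (min (R / 16) ((ρ₂ ^ τ) ^ 2 / (2 * E + 1)))).trans
          (min_le_left _ _)
        linarith
      · have := (min_le_right (min 1 (‖x₀‖ / 8)) (min (R / 16) ((ρ₂ ^ τ) ^ 2 / (2 * E + 1)))).trans
          (min_le_right _ _)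
        set e := min (min 1 (‖x₀‖ / 8)) (min (R / 16) ((ρ₂ ^ τ) ^ 2 / (2 * E + 1)))
        have he : 0 < e := by positivity
        rw [le_div_iff₀ (by positivity)] at this
        linarith
    set f : Euc n → ℝ := fun x => 1 - ψ (ε⁻¹ • x) with hfdef
    have hf : ContDiff ℝ (⊤ : ℕ∞) f := hg.comp (contDiff_id.const_smul ε⁻¹)
    set w : Euc n → ℝ := fun x => χ x * f x * u x with hwdef
    have hw : ContDiff ℝ (⊤ : ℕ∞) w := (hχ.mul hf).mul hu
    have hnorm : ∀ x : Euc n, ‖ε⁻¹ • x‖ = ‖x‖ / ε := fun x => by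
      rw [norm_smul, norm_inv, Real.norm_of_nonneg hε0.le, div_eq_inv_mul]
    have hχ1 : ∀ x : Euc n, ‖x‖ < R / 2 → χ x = 1 := fun x hx =>
      χ.one_of_mem_closedBall (by simpa using hx.le)
    have hf1 : ∀ x : Euc n, 2 * ε < ‖x‖ → f x = 1 := fun x hx => by
      have : ψ (ε⁻¹ • x) = 0 := ψ.zero_of_le_dist (by
        rw [dist_zero_right, hnorm, le_div_iff₀ hε0]; exact hx.le)
      rw [hfdef]; simp [this]
    have hf0 : ∀ x : Euc n, ‖x‖ < ε → f x = 0 := fun x hx => by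
      have : ψ (ε⁻¹ • x) = 1 := ψ.one_of_mem_closedBall (by
        rw [mem_closedBall, dist_zero_right, hnorm, div_le_iff₀ hε0]
        simpa [ψ] using hx.le)
      rw [hfdef]; simp [this]
    have evlt : ∀ (x : Euc n) (t : ℝ), ‖x‖ < t → ∀ᶠ y in 𝓝 x, ‖y‖ < t := fun x t h =>
      continuous_norm.continuousAt.eventually_lt continuousAt_const h
    have evgt : ∀ (x : Euc n) (t : ℝ), t < ‖x‖ → ∀ᶠ y in 𝓝 x, t < ‖y‖ := fun x t h =>
      continuousAt_const.eventually_lt continuous_norm.continuousAt h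
    have hnot : ∀ x : Euc n, ‖x‖ < ε → x ∉ tsupport w := fun x hx => by
      rw [notMem_tsupport_iff_eventuallyEq]
      filter_upwards [evlt x ε hx] with y hy
      simp [hwdef, hf0 y hy]
    have hsupp : tsupport w ⊆ closedBall 0 R := by
      refine (closure_mono fun x hx => ?_).trans_eq χ.tsupport_eq
      rw [Function.mem_support] at hx ⊢
      exact left_ne_zero_of_mul (left_ne_zero_of_mul hx)
    obtain ⟨hint, hle⟩ := carleman_integral hn ha hsym hcb hΛ hKR hτ1 hw
      ((isCompact_closedBall (0 : Euc n) R).of_isClosed_subset (isClosed_tsupport w) hsupp)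
      (hnot 0 (by simpa using hε0)) fun x hx => by simpa using hsupp hx
    have hgood : ∀ x : Euc n, 2 * ε < ‖x‖ → ‖x‖ < R / 2 →
        (‖x‖ ^ n)⁻¹ * (τ ^ 2 * ‖x‖ * conj K τ w x ^ 2 / 2) ≤ carlemanG a K τ w x ∧ w x = u x := by
      intro x h1 h2
      have hev : w =ᶠ[𝓝 x] u := by
        filter_upwards [evgt x _ h1, evlt x _ h2] with y hy1 hy2
        simp [hwdef, hf1 y hy1, hχ1 y hy2]
      refine ⟨?_, hev.eq_of_nhds⟩
      refine carlemanG_lower_of_ineq hK (norm_pos_iff.mp (by linarith)) (by linarith) hw hτ2 hτ3 ?_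
      rw [pop_congr hev, hev.eq_of_nhds]
      simp only [(dd_congr hev _).eq_of_nhds]
      exact hop x (by linarith)
    have hinner : ∀ x : Euc n, ε ≤ ‖x‖ → ‖x‖ ≤ 2 * ε →
        -(ρ₂ ^ τ) ^ 2 ≤ carlemanG a K τ w x := by
      intro x h1 h2
      have hr : 0 < ‖x‖ := by linarith
      have hrR : ‖x‖ ≤ R := by linarith
      have hev : w =ᶠ[𝓝 x] fun y => f y * u y := by
        filter_upwards [evlt x (R / 2) (by linarith)] with y hy2
        simp [hwdef, hχ1 y hy2]
      have hcbx := hcb x hrR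
      have hA : ∀ i j, |a i j x| ≤ 2 := fun i j => by
        have e1 : |a i j x - kd i j| ≤ 1 := (hcbx.hA i j).trans hcbx.lam_r
        have := abs_le.mp e1
        have := abs_le.mp (kd_le i j)
        exact abs_le.mpr ⟨by linarith, by linarith⟩
      have hyD := hD (ε⁻¹ • x) (by
        rw [mem_closedBall, dist_zero_right, hnorm, div_le_iff₀ hε0]; exact h2)
      have hi1 : 1 ≤ ε⁻¹ := (one_le_inv₀ hε0).mpr hε1
      have hi2 : 1 ≤ ε⁻¹ ^ 2 := one_le_pow₀ hi1
      have hi3 : ε⁻¹ ≤ ε⁻¹ ^ 2 := by nlinarith only [hi1]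
      have hDε : D ≤ D * ε⁻¹ ^ 2 := by nlinarith only [hi2, hD1]
      have hdf : ∀ i, dd (bv i) f = fun y => ε⁻¹ * dd (bv i) (fun x => 1 - ψ x) (ε⁻¹ • y) :=
        fun i => funext fun y => dd_comp_smul hg ε⁻¹ (bv i) y
      have hddf : ∀ i j, dd (bv i) (dd (bv j) f) x =
          ε⁻¹ ^ 2 * dd (bv i) (dd (bv j) (fun x => 1 - ψ x)) (ε⁻¹ • x) := fun i j => by
        have hsm := contDiff_dd hg (bv j)
        have hs2 : ContDiff ℝ (⊤ : ℕ∞) fun y => dd (bv j) (fun x => 1 - ψ x) (ε⁻¹ • y) :=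
          hsm.comp (contDiff_id.const_smul ε⁻¹)
        rw [hdf, dd_mul (differentiableAt_const _) (smooth_differentiableAt hs2 x),
          dd_comp_smul hsm, dd_const]
        ring
      have hpop : |pop a w x| ≤ 4 * P * ‖x‖ ^ (n + 2 * τ + 1) := by
        rw [pop_congr hev]
        refine (abs_pop_mul_le (D := D * ε⁻¹ ^ 2) hsym hf hu hA hC (hop x hrR) (hyD.1.trans hDε)
          (fun i => ?_) (fun i j => ?_) (hc x hrR).1 (hc x hrR).2).trans ?_
        · rw [hdf, abs_mul, abs_of_pos (by positivity : 0 < ε⁻¹)]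
          calc ε⁻¹ * _ ≤ ε⁻¹ ^ 2 * D := mul_le_mul hi3 (hyD.2.1 i) (abs_nonneg _) (by positivity)
            _ = _ := mul_comm _ _
        · rw [hddf, abs_mul, abs_of_pos (by positivity : 0 < ε⁻¹ ^ 2), mul_comm]
          exact mul_le_mul_of_nonneg_right (hyD.2.2 i j) (by positivity)
        · have e1 : ε⁻¹ ^ 2 * ‖x‖ ^ 2 ≤ 4 := by
            rw [← mul_pow]
            have : ε⁻¹ * ‖x‖ ≤ 2 := by rw [inv_mul_le_iff₀ hε0]; linarith
            have h0 : 0 ≤ ε⁻¹ * ‖x‖ := by positivity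
            nlinarith only [this, h0]
          have e2 := mul_le_mul_of_nonneg_left e1
            (by positivity : 0 ≤ P * ‖x‖ ^ (n + 2 * τ + 1))
          calc _ = P * ‖x‖ ^ (n + 2 * τ + 1) * (ε⁻¹ ^ 2 * ‖x‖ ^ 2) := by
                rw [hP, pow_add _ _ 2]; ring
            _ ≤ _ := e2
            _ = _ := by ring
      have hrho : |rho K ‖x‖| ≤ 2 * ‖x‖⁻¹ := by
        rw [abs_of_pos (rho_pos hK hr), rho, div_eq_mul_inv]
        have : K * ‖x‖ ≤ 1 := (mul_le_mul_of_nonneg_left hrR hK).trans hKR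
        gcongr
        linarith
      refine le_trans ?_ (carlemanG_lower hτ3 w (norm_pos_iff.mp hr) (by linarith) hrho hpop)
      rw [neg_le_neg_iff]
      have e3 : (‖x‖ ^ n)⁻¹ * (4 * ((2 * ‖x‖⁻¹) ^ τ) ^ 2 * (4 * P * ‖x‖ ^ (n + 2 * τ + 1)) ^ 2)
          = E * ‖x‖ ^ (n + 2 * τ + 1 + 1) := by
        rw [hE, mul_pow, inv_pow]
        have : ‖x‖ ^ (n + 2 * τ + 1) = ‖x‖ ^ n * (‖x‖ ^ τ) ^ 2 * ‖x‖ := by ring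
        rw [pow_succ _ (n + 2 * τ + 1), this]
        field_simp
      rw [e3]
      refine le_trans (mul_le_mul_of_nonneg_left ?_ (by positivity)) hε4
      calc ‖x‖ ^ (n + 2 * τ + 1 + 1) ≤ ‖x‖ ^ 1 :=
            pow_le_pow_of_le_one hr.le (by linarith) (by omega)
        _ ≤ 2 * ε := by rwa [pow_one]
    have houter : ∀ x : Euc n, R / 2 ≤ ‖x‖ → ‖x‖ ≤ R →
        -((B - 1) * (ρ₂ ^ τ) ^ 2) ≤ carlemanG a K τ w x := by
      intro x h1 h2
      have hr : 0 < ‖x‖ := by linarith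
      have hev : w =ᶠ[𝓝 x] fun y => χ y * u y := by
        filter_upwards [evgt x (2 * ε) (by linarith)] with y hy2
        simp [hwdef, hf1 y hy2]
      have hpop : |pop a w x| ≤ M₂ := by
        rw [pop_congr hev]
        exact hM₂ x (by simpa using h2)
      have hrho : |rho K ‖x‖| ≤ ρ₂ := by
        rw [abs_of_pos (rho_pos hK hr)]
        exact rho_le (by linarith) h1
      refine le_trans ?_ (carlemanG_lower hτ3 w (norm_pos_iff.mp hr) (by linarith) hrho hpop)
      rw [neg_le_neg_iff, hB, add_sub_cancel_right]
      have : (‖x‖ ^ n)⁻¹ ≤ ((R / 2) ^ n)⁻¹ := by gcongr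
      calc _ ≤ ((R / 2) ^ n)⁻¹ * (4 * (ρ₂ ^ τ) ^ 2 * M₂ ^ 2) :=
            mul_le_mul_of_nonneg_right this (by positivity)
        _ = _ := by ring
    have hlow : ∀ x : Euc n, ‖x‖ ≤ R → -(B * (ρ₂ ^ τ) ^ 2) ≤ carlemanG a K τ w x := by
      intro x hxR
      have hq : 0 ≤ (ρ₂ ^ τ) ^ 2 := by positivity
      have hBq : (ρ₂ ^ τ) ^ 2 ≤ B * (ρ₂ ^ τ) ^ 2 := le_mul_of_one_le_left hq hB1
      rcases lt_or_ge ‖x‖ ε with h1 | h1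
      · rw [carlemanG_eq_zero (hnot x h1)]; linarith
      rcases le_or_gt ‖x‖ (2 * ε) with h2 | h2
      · linarith [hinner x h1 h2]
      rcases lt_or_ge ‖x‖ (R / 2) with h3 | h3
      · have : 0 ≤ (‖x‖ ^ n)⁻¹ * (τ ^ 2 * ‖x‖ * conj K τ w x ^ 2 / 2) := by positivity
        linarith [(hgood x h2 h3).1]
      · linarith [houter x h3 hxR]
    have hshell : ∀ x ∈ ball x₀ s, c₀ * (ρ₄ ^ τ) ^ 2 ≤ carlemanG a K τ w x := by
      intro x hx
      obtain ⟨h1, h2, h3⟩ := hsub hx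
      obtain ⟨h4, h5⟩ := hgood x (by linarith) (by linarith)
      refine le_trans ?_ h4
      have hr : 0 < ‖x‖ := by linarith
      have e1 : 1 ≤ (‖x‖ ^ n)⁻¹ := (one_le_inv₀ (by positivity)).mpr
        (pow_le_one₀ hr.le (by linarith))
      have e2 : (1 : ℝ) ≤ (τ : ℝ) ^ 2 := one_le_pow₀ (by exact_mod_cast hτ3)
      have e3 : ρ₄ ^ τ ≤ rho K ‖x‖ ^ τ :=
        pow_le_pow_left₀ (hρ₂.trans hρ₄).le (rho_le hr h2.le) τ
      have e4 : (|u x₀| / 2) ^ 2 ≤ u x ^ 2 := by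
        rw [← sq_abs (u x)]; exact pow_le_pow_left₀ (by positivity) h3.le 2
      have e5 : (0 : ℝ) ≤ ρ₄ ^ τ := pow_nonneg (hρ₂.trans hρ₄).le τ
      calc c₀ * (ρ₄ ^ τ) ^ 2
          = 1 * (1 * (‖x₀‖ / 2) * ((ρ₄ ^ τ) ^ 2 * (|u x₀| / 2) ^ 2) / 2) := by rw [hc₀]; ring
        _ ≤ (‖x‖ ^ n)⁻¹ * (τ ^ 2 * ‖x‖ * ((rho K ‖x‖ ^ τ) ^ 2 * u x ^ 2) / 2) := by gcongr
        _ = _ := by rw [conj, h5]; ring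
    have i1 : Integrable ((ball x₀ s).indicator fun _ => c₀ * (ρ₄ ^ τ) ^ 2) :=
      (integrable_indicator_iff measurableSet_ball).mpr
        (integrableOn_const measure_ball_lt_top.ne)
    have i2 : Integrable ((closedBall (0 : Euc n) R).indicator fun _ => B * (ρ₂ ^ τ) ^ 2) :=
      (integrable_indicator_iff measurableSet_closedBall).mpr
        (integrableOn_const measure_closedBall_lt_top.ne)
    have hmono := integral_mono (i1.sub i2) hint fun x => by
      show (ball x₀ s).indicator (fun _ => c₀ * (ρ₄ ^ τ) ^ 2) x
        - (closedBall (0 : Euc n) R).indicator (fun _ => B * (ρ₂ ^ τ) ^ 2) x ≤ _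
      have hBq : 0 ≤ B * (ρ₂ ^ τ) ^ 2 := mul_nonneg (by linarith) (sq_nonneg _)
      by_cases hx : x ∈ ball x₀ s
      · have hxR : x ∈ closedBall (0 : Euc n) R := by
          have := (hsub hx).2.1
          rw [mem_closedBall, dist_zero_right]; linarith
        rw [indicator_of_mem hx, indicator_of_mem hxR]
        linarith [hshell x hx]
      · rw [indicator_of_notMem hx]
        by_cases hxR : x ∈ closedBall (0 : Euc n) R
        · rw [indicator_of_mem hxR]
          linarith [hlow x (by simpa using hxR)]
        · rw [indicator_of_notMem hxR, carlemanG_eq_zero fun h => hxR (hsupp h)]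
          simp
    rw [integral_sub' i1 i2, integral_indicator measurableSet_ball,
      integral_indicator measurableSet_closedBall, setIntegral_const, setIntegral_const,
      smul_eq_mul, smul_eq_mul] at hmono
    linarith
  obtain ⟨T, hT⟩ := exists_nat_ge (max (cT n Λ) (24 * C ^ 2 * (n + 1)))
  have hθ : 1 < (ρ₄ / ρ₂) ^ 2 := one_lt_pow₀ ((one_lt_div hρ₂).mpr hρ₄) two_ne_zero
  obtain ⟨m, hm2⟩ := pow_unbounded_of_one_lt (B * V / (c₀ * V₀)) hθ
  have hk := key (m + T + 1) (((le_max_left _ _).trans hT).trans (by push_cast; linarith))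
    (((le_max_right _ _).trans hT).trans (by push_cast; linarith)) (by omega)
  have h1 : ((ρ₄ / ρ₂) ^ 2) ^ m ≤ ((ρ₄ / ρ₂) ^ 2) ^ (m + T + 1) :=
    pow_le_pow_right₀ hθ.le (by omega)
  have h2 : ((ρ₄ / ρ₂) ^ 2) ^ (m + T + 1) = (ρ₄ ^ (m + T + 1)) ^ 2 / (ρ₂ ^ (m + T + 1)) ^ 2 := by
    rw [← pow_mul, div_pow, ← pow_mul, ← pow_mul, mul_comm]
  have h3 := hm2.trans_le (h1.trans_eq h2)
  rw [div_lt_div_iff₀ (by positivity) (by positivity)] at h3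
  linarith

end

section

variable {n : ℕ}

lemma exists_smooth_eventuallyEq {U : Set (Euc n)} (hU : IsOpen U) {p : Euc n} (hp : p ∈ U)
    {f : Euc n → ℝ} (hf : ContDiffOn ℝ (⊤ : ℕ∞) f U) :
    ∃ g : Euc n → ℝ, ContDiff ℝ (⊤ : ℕ∞) g ∧ g =ᶠ[𝓝 p] f := by
  obtain ⟨r, hr, hrU⟩ := Metric.isOpen_iff.mp hU p hp
  let χ : ContDiffBump p := ⟨r / 4, r / 2, by linarith, by linarith⟩
  refine ⟨fun x => χ x * f x, contDiff_iff_contDiffAt.mpr fun x => ?_, ?_⟩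
  · by_cases hx : x ∈ U
    · exact χ.contDiff.contDiffAt.mul (hf.contDiffAt (hU.mem_nhds hx))
    · have : x ∉ tsupport χ := fun h => hx (hrU (by
        rw [χ.tsupport_eq] at h
        exact closedBall_subset_ball (by simp only [χ]; linarith) h))
      rw [notMem_tsupport_iff_eventuallyEq] at this
      refine contDiffAt_const (c := (0 : ℝ)) |>.congr_of_eventuallyEq ?_
      filter_upwards [this] with y hy
      simp [hy]
  · filter_upwards [χ.eventuallyEq_one] with x hx
    simp [hx]

/-- Vanishing to infinite order at a point. -/
def FlatAt (u : Euc n → ℝ) (p : Euc n) : Prop :=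
  ∀ N : ℕ, u =O[𝓝 p] fun x => ‖x - p‖ ^ N

lemma contDiff_iterate_dd {u : Euc n → ℝ} (hu : ContDiff ℝ (⊤ : ℕ∞) u) (ξ : Euc n) (k : ℕ) :
    ContDiff ℝ (⊤ : ℕ∞) ((dd ξ)^[k] u) := by
  induction k with
  | zero => exact hu
  | succ k ih => rw [Function.iterate_succ_apply']; exact contDiff_dd ih ξ

lemma iterate_dd_eq {u : Euc n → ℝ} (hu : ContDiff ℝ (⊤ : ℕ∞) u) (ξ : Euc n) (k : ℕ) :
    (dd ξ)^[k] u = fun x => iteratedFDeriv ℝ k u x fun _ => ξ := by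
  induction k with
  | zero => ext x; simp
  | succ k ih =>
    rw [Function.iterate_succ_apply', ih]
    ext x
    rw [iteratedFDeriv_succ_apply_left]
    have h : DifferentiableAt ℝ (iteratedFDeriv ℝ k u) x :=
      (hu.differentiable_iteratedFDeriv (by exact_mod_cast WithTop.coe_lt_top _)) x
    have h2 := (ContinuousMultilinearMap.apply ℝ (fun _ : Fin k => Euc n) ℝ
      (fun _ => ξ)).hasFDerivAt.comp x h.hasFDerivAt
    have h3 : fderiv ℝ (fun x => iteratedFDeriv ℝ k u x fun _ => ξ) x = _ := h2.fderiv
    rw [dd, h3]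
    rfl

lemma hasDerivAt_line {u : Euc n → ℝ} (hu : ContDiff ℝ (⊤ : ℕ∞) u) (p ξ : Euc n) (t : ℝ) :
    HasDerivAt (fun t : ℝ => u (p + t • ξ)) (dd ξ u (p + t • ξ)) t := by
  have h1 : HasDerivAt (fun t : ℝ => p + t • ξ) ξ t := by
    simpa using ((hasDerivAt_id t).smul_const ξ).const_add p
  exact (smooth_differentiableAt hu _).hasFDerivAt.comp_hasDerivAt t h1

lemma flatAt_of_iterate_dd {u : Euc n → ℝ} (hu : ContDiff ℝ (⊤ : ℕ∞) u) {p : Euc n}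
    (h : ∀ ξ k, (dd ξ)^[k] u p = 0) : FlatAt u p := by
  intro N
  obtain ⟨M, hM⟩ := (isCompact_closedBall p 1).exists_bound_of_continuousOn
    (hu.continuous_iteratedFDeriv (m := N) (by exact_mod_cast le_top)).continuousOn
  refine Asymptotics.IsBigO.of_bound M ?_
  filter_upwards [closedBall_mem_nhds p one_pos] with x hx
  set ξ := x - p with hξ
  have hξ1 : ‖ξ‖ ≤ 1 := by rw [hξ, ← dist_eq_norm]; exact hx
  have key : ∀ j k, k + j = N → ∀ t ∈ Icc (0 : ℝ) 1,
      |(dd ξ)^[k] u (p + t • ξ)| ≤ M * ‖ξ‖ ^ N := by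
    intro j
    induction j with
    | zero =>
      intro k hk t ht
      have hk' : k = N := by omega
      subst hk'
      rw [iterate_dd_eq hu]
      refine ((iteratedFDeriv ℝ k u (p + t • ξ)).le_opNorm fun _ => ξ).trans ?_
      simp only [Finset.prod_const, Finset.card_univ, Fintype.card_fin]
      refine mul_le_mul_of_nonneg_right (hM _ ?_) (by positivity)
      rw [mem_closedBall, dist_eq_norm, add_sub_cancel_left, norm_smul, Real.norm_of_nonneg ht.1]
      exact mul_le_one₀ ht.2 (norm_nonneg _) hξ1
    | succ j ih =>
      intro k hk t ht
      have hb := ih (k + 1) (by omega)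
      have hd := fun s => hasDerivAt_line (contDiff_iterate_dd hu ξ k) p ξ s
      have hM0 : 0 ≤ M * ‖ξ‖ ^ N := (abs_nonneg _).trans (hb 0 (by simp))
      have := (convex_Icc (0 : ℝ) 1).norm_image_sub_le_of_norm_hasDerivWithin_le
        (C := M * ‖ξ‖ ^ N) (fun s _ => (hd s).hasDerivWithinAt) (fun s hs => by
          have := hb s hs
          rwa [Function.iterate_succ_apply'] at this) (left_mem_Icc.mpr zero_le_one) ht
      simp only [zero_smul, add_zero, h, sub_zero, Real.norm_eq_abs] at this
      rw [abs_of_nonneg ht.1] at this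
      exact this.trans (mul_le_of_le_one_right hM0 ht.2)
  have := key N 0 (by omega) 1 (by simp)
  rw [Function.iterate_zero, id, one_smul, hξ, add_sub_cancel] at this
  simpa using this

lemma FlatAt.exists_bound {u : Euc n → ℝ} (hu : Continuous u) (h : FlatAt u 0) (N : ℕ) :
    ∃ c : ℝ, 0 ≤ c ∧ ∀ x : Euc n, ‖x‖ ≤ 2 → |u x| ≤ c * ‖x‖ ^ N := by
  obtain ⟨c, hc⟩ := (h N).bound
  obtain ⟨ρ, hρ, hρc⟩ := Metric.eventually_nhds_iff_ball.mp hc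
  obtain ⟨M, hM⟩ := (isCompact_closedBall (0 : Euc n) 2).exists_bound_of_continuousOn
    hu.continuousOn
  refine ⟨max |c| (|M| / ρ ^ N), le_max_of_le_left (abs_nonneg _), fun x hx => ?_⟩
  rcases lt_or_ge ‖x‖ ρ with h1 | h1
  · have := hρc x (by simpa using h1)
    rw [sub_zero, norm_pow, norm_norm, Real.norm_eq_abs] at this
    refine this.trans ?_
    gcongr
    exact (le_abs_self c).trans (le_max_left _ _)
  · have h2 : |u x| ≤ |M| := (hM x (by simpa using hx)).trans (le_abs_self M)
    calc |u x| ≤ |M| / ρ ^ N * ρ ^ N := by rw [div_mul_cancel₀ _ (by positivity)]; exact h2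
      _ ≤ max |c| (|M| / ρ ^ N) * ‖x‖ ^ N := by
        gcongr
        exact le_max_right _ _

lemma FlatAt.exists_bound_dd {u : Euc n → ℝ} (hu : ContDiff ℝ (⊤ : ℕ∞) u) (h : FlatAt u 0)
    (N : ℕ) : ∃ c : ℝ, ∀ x : Euc n, ‖x‖ ≤ 1 →
      |u x| ≤ c * ‖x‖ ^ N ∧ ∀ i, |dd (bv i) u x| ≤ c * ‖x‖ ^ N := by
  have hfd : HasFDerivAt u (0 : Euc n →L[ℝ] ℝ) 0 := (h 2).hasFDerivAt one_lt_two
  obtain ⟨c₁, hc₁0, hc₁⟩ := h.exists_bound hu.continuous (2 * (N + 1))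
  obtain ⟨M, hM1, hM⟩ : ∃ M : ℝ, 0 ≤ M ∧ ∀ i, ∀ x ∈ closedBall (0 : Euc n) 2,
      |dd (bv i) (dd (bv i) u) x| ≤ M := by
    obtain ⟨D, h1, h2⟩ := exists_bound_derivs hu (isCompact_closedBall (0 : Euc n) 2)
    exact ⟨D, by linarith, fun i x hx => (h2 x hx).2.2 i i⟩
  refine ⟨c₁ * 4 ^ (N + 1) + c₁ + M, fun x hx => ?_⟩
  have hr0 := norm_nonneg x
  have hpow : ∀ m, N ≤ m → ‖x‖ ^ m ≤ ‖x‖ ^ N := fun m hm => pow_le_pow_of_le_one hr0 hx hm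
  refine ⟨(hc₁ x (by linarith)).trans ?_, fun i => ?_⟩
  · have : 0 ≤ c₁ * 4 ^ (N + 1) := by positivity
    exact mul_le_mul (by linarith) (hpow _ (by omega)) (by positivity) (by positivity)
  by_cases hx0 : x = 0
  · subst hx0
    rw [dd, hfd.fderiv]
    simp only [_root_.zero_apply, abs_zero]
    positivity
  have hr : 0 < ‖x‖ := norm_pos_iff.mpr hx0
  set s := ‖x‖ ^ (N + 1) with hs
  have hs0 : 0 < s := by positivity
  have hsr : s ≤ ‖x‖ := by
    calc s ≤ ‖x‖ ^ 1 := pow_le_pow_of_le_one hr0 hx (by omega)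
      _ = ‖x‖ := pow_one _
  have hline : ∀ t ∈ Icc (0 : ℝ) s, ‖x + t • (bv i : Euc n)‖ ≤ 2 * ‖x‖ := fun t ht => by
    refine (norm_add_le _ _).trans ?_
    rw [norm_smul, norm_bv, Real.norm_of_nonneg ht.1]
    linarith [ht.2]
  have hmem : ∀ t ∈ Icc (0 : ℝ) s, x + t • (bv i : Euc n) ∈ closedBall (0 : Euc n) 2 :=
    fun t ht => by
      rw [mem_closedBall, dist_zero_right]
      linarith [hline t ht]
  have hss : s ∈ Icc (0 : ℝ) s := right_mem_Icc.mpr hs0.le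
  have h0s : (0 : ℝ) ∈ Icc (0 : ℝ) s := left_mem_Icc.mpr hs0.le
  have h1 : ∀ t ∈ Icc (0 : ℝ) s, |dd (bv i) u (x + t • bv i) - dd (bv i) u x| ≤ M * s := by
    intro t ht
    have := (convex_Icc (0 : ℝ) s).norm_image_sub_le_of_norm_hasDerivWithin_le (C := M)
      (fun t _ => (hasDerivAt_line (contDiff_dd hu (bv i)) x (bv i) t).hasDerivWithinAt)
      (fun t ht => hM i _ (hmem t ht)) h0s ht
    simp only [zero_smul, add_zero, sub_zero, Real.norm_eq_abs] at this
    rw [abs_of_nonneg ht.1] at this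
    exact this.trans (mul_le_mul_of_nonneg_left ht.2 hM1)
  have h2 := (convex_Icc (0 : ℝ) s).norm_image_sub_le_of_norm_hasDerivWithin_le (C := M * s)
    (f := fun t => u (x + t • bv i) - t * dd (bv i) u x)
    (f' := fun t => dd (bv i) u (x + t • bv i) - 1 * dd (bv i) u x)
    (fun t _ => ((hasDerivAt_line hu x (bv i) t).sub
      ((hasDerivAt_id t).mul_const _)).hasDerivWithinAt)
    (fun t ht => by rw [one_mul]; exact h1 t ht) h0s hss
  simp only [zero_smul, add_zero, sub_zero, Real.norm_eq_abs, zero_mul] at h2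
  rw [abs_of_pos hs0] at h2
  have h3 : |u (x + s • bv i)| ≤ c₁ * (4 ^ (N + 1) * s ^ 2) := by
    have hl := hline s hss
    refine (hc₁ _ (by linarith)).trans ?_
    have : (2 * ‖x‖) ^ (2 * (N + 1)) = 4 ^ (N + 1) * s ^ 2 := by
      rw [mul_pow, pow_mul, pow_mul' ‖x‖]; norm_num [hs]
    rw [← this]
    gcongr
  have h4 : |u x| ≤ c₁ * s ^ 2 := by
    refine (hc₁ x (by linarith)).trans_eq ?_
    rw [pow_mul' ‖x‖]
  have h5 : s * |dd (bv i) u x| ≤ s * ((c₁ * 4 ^ (N + 1) + c₁ + M) * s) := by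
    rw [← abs_of_pos hs0, ← abs_mul, abs_of_pos hs0]
    have a1 := abs_le.mp h2
    have a2 := abs_le.mp h3
    have a3 := abs_le.mp h4
    exact abs_le.mpr ⟨by linarith [a1.1, a1.2], by linarith [a1.1, a1.2]⟩
  refine (le_of_mul_le_mul_left h5 hs0).trans ?_
  exact mul_le_mul_of_nonneg_left (hpow _ (by omega)) (by positivity)

lemma exists_coeffBound (hn : 1 ≤ n) {a : Fin n → Fin n → Euc n → ℝ}
    (ha : ∀ i j, ContDiff ℝ (⊤ : ℕ∞) (a i j)) (h0 : ∀ i j, a i j 0 = kd i j) :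
    ∃ Λ : ℝ, 1 ≤ Λ ∧ ∀ x : Euc n, ‖x‖ ≤ 1 → Λ * ‖x‖ ≤ 1 →
      CoeffBound (av a x) (dav a x) (fun i => x i) ‖x‖ Λ := by
  have hM : ∀ i j, ∃ M : ℝ, 0 ≤ M ∧ ∀ x ∈ closedBall (0 : Euc n) 1,
      ‖fderiv ℝ (a i j) x‖ ≤ M := by
    intro i j
    obtain ⟨M, hM⟩ := (isCompact_closedBall (0 : Euc n) 1).exists_bound_of_continuousOn
      ((ha i j).continuous_fderiv (by simp)).continuousOn
    exact ⟨M, (norm_nonneg _).trans (hM 0 (by simp)), hM⟩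
  choose M hM0 hM using hM
  have hle : ∀ i j, M i j ≤ 1 + ∑ i, ∑ j, M i j := by
    intro i j
    have h1 : M i j ≤ ∑ j, M i j :=
      Finset.single_le_sum (fun j _ => hM0 i j) (Finset.mem_univ j)
    have h2 : ∑ j, M i j ≤ ∑ i, ∑ j, M i j :=
      Finset.single_le_sum (f := fun i => ∑ j, M i j)
        (fun i _ => Finset.sum_nonneg fun j _ => hM0 i j) (Finset.mem_univ i)
    linarith
  have hs : 0 ≤ ∑ i, ∑ j, M i j :=
    Finset.sum_nonneg fun i _ => Finset.sum_nonneg fun j _ => hM0 i j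
  refine ⟨1 + ∑ i, ∑ j, M i j, by linarith, fun x hx hx2 => ?_⟩
  have hxb : x ∈ closedBall (0 : Euc n) 1 := by simpa using hx
  refine ⟨by exact_mod_cast hn, norm_nonneg _, hx, by linarith, hx2, abs_coord_le x, ?_, ?_⟩
  · intro i j
    have h := (convex_closedBall (0 : Euc n) 1).norm_image_sub_le_of_norm_fderiv_le (𝕜 := ℝ)
      (fun y _ => smooth_differentiableAt (ha i j) y) (hM i j)
      (mem_closedBall_self zero_le_one) hxb
    rw [h0, sub_zero, Real.norm_eq_abs] at h
    exact h.trans (mul_le_mul_of_nonneg_right (hle i j) (norm_nonneg _))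
  · intro l i j
    have h := (fderiv ℝ (a i j) x).le_opNorm (bv l)
    rw [norm_bv, mul_one, Real.norm_eq_abs] at h
    exact (h.trans (hM i j x hxb)).trans (hle i j)

lemma eventuallyEq_zero_of_flatAt_normalized (hn : 2 ≤ n) {a : Fin n → Fin n → Euc n → ℝ}
    (ha : ∀ i j, ContDiff ℝ (⊤ : ℕ∞) (a i j)) (hsym : ∀ i j x, a i j x = a j i x)
    (h0 : ∀ i j, a i j 0 = kd i j) {u : Euc n → ℝ} (hu : ContDiff ℝ (⊤ : ℕ∞) u)
    (hflat : FlatAt u 0) {C : ℝ} (hC : 0 ≤ C)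
    (hop : ∀ᶠ x in 𝓝 0, |pop a u x| ≤ C * (|u x| + ∑ i, |dd (bv i) u x|)) :
    u =ᶠ[𝓝 0] 0 := by
  obtain ⟨Λ, hΛ, hcb⟩ := exists_coeffBound (by omega) ha h0
  obtain ⟨ρ, hρ, hop⟩ := Metric.eventually_nhds_iff_ball.mp hop
  have hK : 0 < cK n Λ := by unfold cK cM; positivity
  set R := min (min (ρ / 2) 1) (min Λ⁻¹ (cK n Λ)⁻¹) with hR
  have hR0 : 0 < R := by positivity
  have hRρ : R < ρ := by
    have : R ≤ ρ / 2 := (min_le_left _ _).trans (min_le_left _ _)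
    linarith
  have hR1 : R ≤ 1 := (min_le_left _ _).trans (min_le_right _ _)
  have hRΛ : Λ * R ≤ 1 := by
    have : R ≤ Λ⁻¹ := (min_le_right _ _).trans (min_le_left _ _)
    calc Λ * R ≤ Λ * Λ⁻¹ := by gcongr
      _ = 1 := mul_inv_cancel₀ (by positivity)
  have hRK : cK n Λ * R ≤ 1 := by
    have : R ≤ (cK n Λ)⁻¹ := (min_le_right _ _).trans (min_le_right _ _)
    calc cK n Λ * R ≤ cK n Λ * (cK n Λ)⁻¹ := by gcongr
      _ = 1 := mul_inv_cancel₀ hK.ne'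
  filter_upwards [Metric.ball_mem_nhds (0 : Euc n) (by positivity : 0 < R / 4)] with x hx
  refine eq_zero_of_flat hn ha hsym hR0 (fun x hx => hcb x (hx.trans hR1) ?_) (by linarith) hR1
    hRK hu hC (fun x hx => hop x ?_) (fun N => ?_) (by simpa using hx)
  · exact (mul_le_mul_of_nonneg_left hx (by linarith)).trans hRΛ
  · simpa using hx.trans_lt hRρ
  · obtain ⟨c, hc⟩ := hflat.exists_bound_dd hu N
    exact ⟨c, fun x hx => hc x (hx.trans hR1)⟩

open MatrixOrder Matrix in
lemma exists_eq_mul_transpose_of_pos {A : Matrix (Fin n) (Fin n) ℝ}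
    (hsym : ∀ i j, A i j = A j i)
    (hpos : ∀ ξ : Euc n, ξ ≠ 0 → 0 < ∑ i, ∑ j, A i j * ξ i * ξ j) :
    ∃ M C : Matrix (Fin n) (Fin n) ℝ, A = M * Mᵀ ∧ M * C = 1 ∧ C * M = 1 := by
  have hA : A.PosDef := by
    refine .of_dotProduct_mulVec_pos ?_ fun ξ hξ => ?_
    · ext i j
      simp [hsym i j]
    · have := hpos (WithLp.toLp 2 ξ) (by simpa using hξ)
      simp only [dotProduct, mulVec, Finset.mul_sum, Pi.star_apply, star_trivial]
      refine this.trans_eq (Finset.sum_congr rfl fun i _ => Finset.sum_congr rfl fun j _ => ?_)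
      simp only [mul_comm, mul_left_comm]
  obtain ⟨B, hB⟩ := CStarAlgebra.nonneg_iff_eq_star_mul_self.mp hA.posSemidef.nonneg
  have hB' : A = Bᵀ * B := by simpa [star_eq_conjTranspose] using hB
  have hdet : IsUnit (Bᵀ).det := by
    have := hA.det_pos
    rw [hB', det_mul] at this
    exact (left_ne_zero_of_mul this.ne').isUnit
  exact ⟨Bᵀ, (Bᵀ)⁻¹, by simpa using hB', mul_nonsing_inv _ hdet, nonsing_inv_mul _ hdet⟩

lemma dd_comp_affine {f : Euc n → ℝ} (L : Euc n →L[ℝ] Euc n) (p ξ y : Euc n)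
    (hf : DifferentiableAt ℝ f (p + L y)) :
    dd ξ (fun y => f (p + L y)) y = dd (L ξ) f (p + L y) := by
  have h1 : HasFDerivAt (fun y => p + L y) L y := L.hasFDerivAt.const_add p
  have h2 : HasFDerivAt (fun y => f (p + L y)) ((fderiv ℝ f (p + L y)).comp L) y :=
    hf.hasFDerivAt.comp y h1
  rw [dd, h2.fderiv]
  rfl

open Matrix in
lemma sum_conj_apply (C A : Matrix (Fin n) (Fin n) ℝ) (i j : Fin n) :
    ∑ k, ∑ l, C i k * C j l * A k l = (C * A * Cᵀ) i j := by
  simp only [mul_apply, transpose_apply, Finset.sum_mul]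
  rw [Finset.sum_comm]
  exact Finset.sum_congr rfl fun _ _ => Finset.sum_congr rfl fun _ _ => by ring

open Matrix in
lemma trace_conj_eq {M C A H : Matrix (Fin n) (Fin n) ℝ} (hMC : M * C = 1) :
    ∑ i, ∑ j, (∑ k, ∑ l, C i k * C j l * A k l) * (∑ k, ∑ l, M k i * M l j * H k l)
      = ∑ i, ∑ j, A i j * H i j := by
  have e2 : ∀ i j, (∑ k, ∑ l, M k i * M l j * H k l) = (Mᵀ * H * M) i j :=
    sum_conj_apply Mᵀ H
  have e3 : ∀ P Q : Matrix (Fin n) (Fin n) ℝ, ∑ i, ∑ j, P i j * Q i j = (P * Qᵀ).trace := by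
    intro P Q
    simp [trace, mul_apply]
  simp only [sum_conj_apply, e2, e3]
  have hCM : Cᵀ * Mᵀ = 1 := by rw [← transpose_mul, hMC, transpose_one]
  calc (C * A * Cᵀ * (Mᵀ * H * M)ᵀ).trace
      = (C * (A * (Cᵀ * Mᵀ) * Hᵀ * M)).trace := by
        simp only [transpose_mul, transpose_transpose, Matrix.mul_assoc]
    _ = (A * (Cᵀ * Mᵀ) * Hᵀ * (M * C)).trace := by
        rw [trace_mul_comm, Matrix.mul_assoc]
    _ = (A * Hᵀ).trace := by rw [hCM, hMC, Matrix.mul_one, Matrix.mul_one]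

open Matrix in
lemma toEuclideanCLM_bv (M : Matrix (Fin n) (Fin n) ℝ) (i k : Fin n) :
    (toEuclideanCLM (𝕜 := ℝ) M (bv i)) k = M k i := by
  have : (toEuclideanCLM (𝕜 := ℝ) M (bv i)).ofLp = M *ᵥ (bv i).ofLp := ofLp_toEuclideanCLM M _
  rw [this]
  simp [mulVec, dotProduct, bv_apply]

open Matrix in
lemma dd_dd_comp_affine {v : Euc n → ℝ} (hv : ContDiff ℝ (⊤ : ℕ∞) v)
    (M : Matrix (Fin n) (Fin n) ℝ) (p y : Euc n) (i j : Fin n) :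
    dd (bv i) (dd (bv j) fun y => v (p + toEuclideanCLM (𝕜 := ℝ) M y)) y =
      ∑ k, ∑ l, M k i * M l j *
        dd (bv k) (dd (bv l) v) (p + toEuclideanCLM (𝕜 := ℝ) M y) := by
  set L := toEuclideanCLM (𝕜 := ℝ) M with hL
  have h1 : (dd (bv j) fun y => v (p + L y)) = fun y => dd (L (bv j)) v (p + L y) := by
    ext y
    exact dd_comp_affine L p _ y (smooth_differentiableAt hv _)
  rw [h1, dd_comp_affine L p _ y (smooth_differentiableAt (contDiff_dd hv _) _), dd_eq_sum]
  refine Finset.sum_congr rfl fun k _ => ?_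
  have h2 : dd (L (bv j)) v = fun x => ∑ l, M l j * dd (bv l) v x := by
    ext x
    rw [dd_eq_sum]
    simp only [hL, toEuclideanCLM_bv]
  rw [h2, dd_sum _ fun l _ => ((smooth_differentiableAt (contDiff_dd hv _) _).const_mul _),
    Finset.mul_sum, hL, toEuclideanCLM_bv]
  refine Finset.sum_congr rfl fun l _ => ?_
  rw [dd_mul (differentiableAt_const _) (smooth_differentiableAt (contDiff_dd hv _) _), dd_const]
  ring

open Matrix in
lemma eventuallyEq_zero_of_flatAt_of_pos (hn : 2 ≤ n) {a : Fin n → Fin n → Euc n → ℝ}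
    (ha : ∀ i j, ContDiff ℝ (⊤ : ℕ∞) (a i j)) (hsym : ∀ i j x, a i j x = a j i x) {p : Euc n}
    (hpos : ∀ ξ : Euc n, ξ ≠ 0 → 0 < ∑ i, ∑ j, a i j p * ξ i * ξ j)
    {v : Euc n → ℝ} (hv : ContDiff ℝ (⊤ : ℕ∞) v) (hflat : FlatAt v p) {C : ℝ} (hC : 0 ≤ C)
    (hop : ∀ᶠ x in 𝓝 p, |pop a v x| ≤ C * (|v x| + ∑ i, |dd (bv i) v x|)) :
    v =ᶠ[𝓝 p] 0 := by
  obtain ⟨M, D, hM, hMD, hDM⟩ :=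
    exists_eq_mul_transpose_of_pos (A := fun i j => a i j p) (fun i j => hsym i j p) hpos
  set L : Euc n →L[ℝ] Euc n := toEuclideanCLM (𝕜 := ℝ) M with hL
  set K : Euc n →L[ℝ] Euc n := toEuclideanCLM (𝕜 := ℝ) D with hK
  have hLK : ∀ x, L (K x) = x := by
    intro x
    have : L * K = 1 := by rw [hL, hK, ← map_mul, hMD, map_one]
    exact congrArg (fun T : Euc n →L[ℝ] Euc n => T x) this
  have hmap : ContDiff ℝ (⊤ : ℕ∞) fun y => p + L y := contDiff_const.add L.contDiff
  have htend : Tendsto (fun y => p + L y) (𝓝 0) (𝓝 p) := by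
    simpa using hmap.continuous.tendsto 0
  set w : Euc n → ℝ := fun y => v (p + L y) with hw
  set b : Fin n → Fin n → Euc n → ℝ :=
    fun i j y => ∑ k, ∑ l, D i k * D j l * a k l (p + L y) with hb
  have hpop : ∀ y, pop b w y = pop a v (p + L y) := by
    intro y
    simp only [pop, hb, hw, hL, dd_dd_comp_affine hv]
    exact trace_conj_eq (A := fun k l => a k l (p + L y))
      (H := fun k l => dd (bv k) (dd (bv l) v) (p + L y)) hMD
  have hb0 : ∀ i j, b i j 0 = kd i j := by
    intro i j
    have e1 : b i j 0 = (D * (M * Mᵀ) * Dᵀ) i j := by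
      rw [← hM]
      refine Eq.trans ?_ (sum_conj_apply D (fun i j => a i j p) i j)
      simp only [hb, map_zero, add_zero]
    have e2 : D * (M * Mᵀ) * Dᵀ = 1 := by
      rw [← Matrix.mul_assoc, hDM, Matrix.one_mul, ← transpose_mul, hDM, transpose_one]
    rw [e1, e2, one_apply, kd]
  have hbsym : ∀ i j x, b i j x = b j i x := by
    intro i j x
    simp only [hb]
    rw [Finset.sum_comm]
    refine Finset.sum_congr rfl fun k _ => Finset.sum_congr rfl fun l _ => ?_
    rw [hsym]
    ring
  have hdv : ∀ y, ∑ i, |dd (bv i) v (p + L y)| ≤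
      (∑ i, ∑ k, |D k i|) * ∑ i, |dd (bv i) w y| := by
    intro y
    rw [Finset.sum_mul]
    refine Finset.sum_le_sum fun i _ => ?_
    have e : dd (bv i) v (p + L y) = dd (K (bv i)) w y := by
      rw [hw, dd_comp_affine L p _ y (smooth_differentiableAt hv _), hLK]
    rw [e, dd_eq_sum, Finset.sum_mul]
    refine (Finset.abs_sum_le_sum_abs _ _).trans (Finset.sum_le_sum fun k _ => ?_)
    rw [abs_mul, hK, toEuclideanCLM_bv]
    exact mul_le_mul_of_nonneg_left
      (Finset.single_le_sum (f := fun i => |dd (bv i) w y|) (fun _ _ => abs_nonneg _)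
        (Finset.mem_univ k)) (abs_nonneg _)
  set S := ∑ i, ∑ k, |D k i| with hS
  have hS0 : 0 ≤ S := Finset.sum_nonneg fun i _ => Finset.sum_nonneg fun k _ => abs_nonneg _
  have hwz : w =ᶠ[𝓝 0] 0 := by
    refine eventuallyEq_zero_of_flatAt_normalized hn (a := b) (C := C * (1 + S))
      (fun i j => ContDiff.sum fun k _ => ContDiff.sum fun l _ =>
        contDiff_const.mul ((ha k l).comp hmap)) hbsym hb0 (hv.comp hmap) ?_ (by positivity) ?_
    · intro N
      have h1 : w =O[𝓝 0] fun y => ‖(p + L y) - p‖ ^ N := (hflat N).comp_tendsto htend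
      refine h1.trans (Asymptotics.IsBigO.pow ?_ N)
      simp only [add_sub_cancel_left, sub_zero]
      exact (L.isBigO_id _).norm_norm
    · filter_upwards [htend.eventually hop] with y hy
      rw [hpop]
      refine hy.trans ?_
      rw [mul_assoc]
      refine mul_le_mul_of_nonneg_left ?_ hC
      have h1 := hdv y
      have h2 : 0 ≤ ∑ i, |dd (bv i) w y| := Finset.sum_nonneg fun _ _ => abs_nonneg _
      have h3 : 0 ≤ S * |w y| := mul_nonneg hS0 (abs_nonneg _)
      change |w y| + _ ≤ _
      nlinarith only [h1, h2, h3]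
  have hback : Tendsto (fun x => K (x - p)) (𝓝 p) (𝓝 0) := by
    have : Continuous fun x => K (x - p) := by fun_prop
    simpa using this.tendsto p
  filter_upwards [hback.eventually hwz] with x hx
  simpa [hw, hLK] using hx

lemma dd_dd_eq_iteratedFDeriv {v : Euc n → ℝ} (hv : ContDiff ℝ (⊤ : ℕ∞) v) (ξ η x : Euc n) :
    dd ξ (dd η v) x = iteratedFDeriv ℝ 2 v x ![ξ, η] := by
  have h1 : DifferentiableAt ℝ (fderiv ℝ v) x :=
    ((hv.fderiv_right (m := 1) (by norm_cast)).differentiable (by norm_num)) x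
  have h2 : HasFDerivAt (fun y => fderiv ℝ v y η) ((fderiv ℝ (fderiv ℝ v) x).flip η) x := by
    simpa using h1.hasFDerivAt.clm_apply (hasFDerivAt_const η x)
  rw [iteratedFDeriv_two_apply, dd, show dd η v = fun y => fderiv ℝ v y η from rfl, h2.fderiv]
  rfl

lemma norm_gradient_le (v : Euc n → ℝ) (x : Euc n) :
    ‖gradient v x‖ ≤ ∑ i, |dd (bv i) v x| := by
  have h0 : 0 ≤ ∑ i, |dd (bv i) v x| := Finset.sum_nonneg fun _ _ => abs_nonneg _
  rw [gradient, LinearIsometryEquiv.norm_map]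
  refine ContinuousLinearMap.opNorm_le_bound _ h0 fun ξ => ?_
  have h := dd_eq_sum ξ v x
  rw [dd] at h
  rw [h, Finset.sum_mul]
  refine (norm_sum_le _ _).trans (Finset.sum_le_sum fun i _ => ?_)
  rw [norm_mul, mul_comm]
  exact mul_le_mul_of_nonneg_left (abs_coord_le ξ i) (abs_nonneg _)

lemma FlatAt.eq_zero {v : Euc n → ℝ} {p : Euc n} (h : FlatAt v p) : v p = 0 := by
  obtain ⟨c, hc⟩ := (h 1).bound
  simpa using hc.self_of_nhds

lemma FlatAt.gradient_eq_zero {v : Euc n → ℝ} {p : Euc n} (h : FlatAt v p) :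
    gradient v p = 0 := by
  have h1 : HasFDerivAt v (0 : Euc n →L[ℝ] ℝ) p := (h 2).hasFDerivAt one_lt_two
  rw [gradient, h1.fderiv, map_zero]

lemma FlatAt.exists_norm_le {U : Set (Euc n)} (hU : IsOpen U) {F : Euc n → ℝ → Euc n → ℝ}
    (hF : ContDiffOn ℝ (⊤ : ℕ∞) (fun p : Euc n × ℝ × Euc n => F p.1 p.2.1 p.2.2)
      (U ×ˢ (univ : Set (ℝ × Euc n))))
    (hF0 : ∀ x ∈ U, F x 0 0 = 0) {p : Euc n} (hp : p ∈ U) {v : Euc n → ℝ}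
    (hv : ContDiff ℝ (⊤ : ℕ∞) v) (hflat : FlatAt v p) :
    ∃ C : ℝ, 0 ≤ C ∧ ∀ᶠ x in 𝓝 p,
      |F x (v x) (gradient v x)| ≤ C * (|v x| + ∑ i, |dd (bv i) v x|) := by
  have hnhds : U ×ˢ (univ : Set (ℝ × Euc n)) ∈ 𝓝 (p, ((0 : ℝ), (0 : Euc n))) :=
    (hU.prod isOpen_univ).mem_nhds ⟨hp, mem_univ _⟩
  obtain ⟨K, t, ht, hK⟩ := ((hF.contDiffAt hnhds).of_le
    (by exact_mod_cast le_top : (1 : WithTop ℕ∞) ≤ _)).exists_lipschitzOnWith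
  have hgrad : Continuous (gradient v) :=
    (LinearIsometryEquiv.continuous _).comp (hv.continuous_fderiv (by simp))
  have hc1 : ContinuousAt (fun x => (x, (v x, gradient v x))) p :=
    (continuous_id.prodMk (hv.continuous.prodMk hgrad)).continuousAt
  have hc2 : ContinuousAt (fun x : Euc n => (x, ((0 : ℝ), (0 : Euc n)))) p :=
    (continuous_id.prodMk continuous_const).continuousAt
  have hm1 : ∀ᶠ x in 𝓝 p, (x, (v x, gradient v x)) ∈ t :=
    hc1.eventually (by
      simp only [hflat.eq_zero, hflat.gradient_eq_zero]; exact ht)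
  have hm2 : ∀ᶠ x in 𝓝 p, (x, ((0 : ℝ), (0 : Euc n))) ∈ t := hc2.eventually ht
  refine ⟨K, K.coe_nonneg, ?_⟩
  filter_upwards [hm1, hm2, hU.mem_nhds hp] with x h1 h2 hx
  have h := hK.norm_sub_le h1 h2
  simp only [hF0 x hx, sub_zero, Real.norm_eq_abs] at h
  refine h.trans (mul_le_mul_of_nonneg_left ?_ K.coe_nonneg)
  have h3 := norm_gradient_le v x
  have h4 : 0 ≤ ∑ i, |dd (bv i) v x| := Finset.sum_nonneg fun _ _ => abs_nonneg _
  simp only [Prod.mk_sub_mk, sub_self, sub_zero, Prod.norm_mk, norm_zero, Real.norm_eq_abs]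
  refine max_le (by positivity) (max_le ?_ ?_)
  · linarith
  · linarith [abs_nonneg (v x)]

/-- Strong unique continuation: a solution that is flat at a point vanishes near it. -/
theorem eventuallyEq_zero_of_flatAt (hn : 2 ≤ n) {U : Set (Euc n)} (hU : IsOpen U)
    {a : Fin n → Fin n → Euc n → ℝ} (ha : ∀ i j, ContDiffOn ℝ (⊤ : ℕ∞) (a i j) U)
    (hsym : ∀ i j, ∀ x ∈ U, a i j x = a j i x)
    (hpos : ∀ x ∈ U, ∀ ξ : Euc n, ξ ≠ 0 → 0 < ∑ i, ∑ j, a i j x * ξ i * ξ j)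
    {F : Euc n → ℝ → Euc n → ℝ}
    (hF : ContDiffOn ℝ (⊤ : ℕ∞) (fun p : Euc n × ℝ × Euc n => F p.1 p.2.1 p.2.2)
      (U ×ˢ (univ : Set (ℝ × Euc n))))
    (hF0 : ∀ x ∈ U, F x 0 0 = 0) {u : Euc n → ℝ}
    (heq : ∀ x ∈ U, scalarOp a F u x = 0) {p : Euc n} (hp : p ∈ U) {v : Euc n → ℝ}
    (hv : ContDiff ℝ (⊤ : ℕ∞) v) (hvu : v =ᶠ[𝓝 p] u) (hflat : FlatAt v p) :
    v =ᶠ[𝓝 p] 0 := by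
  choose a' ha' haa' using fun i j => exists_smooth_eventuallyEq hU hp (ha i j)
  obtain ⟨C, hC, hCF⟩ := hflat.exists_norm_le hU hF hF0 hp hv
  set b : Fin n → Fin n → Euc n → ℝ := fun i j x => (a' i j x + a' j i x) / 2 with hb
  have hba : ∀ᶠ x in 𝓝 p, ∀ i j, b i j x = a i j x := by
    have h : ∀ᶠ x in 𝓝 p, ∀ i j, a' i j x = a i j x :=
      Filter.eventually_all.mpr fun i => Filter.eventually_all.mpr fun j => haa' i j
    filter_upwards [h, hU.mem_nhds hp] with x hx hxU i j
    rw [hb]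
    simp only
    rw [hx, hx, hsym j i x hxU]
    ring
  refine eventuallyEq_zero_of_flatAt_of_pos hn (a := b) (C := C)
    (fun i j => ((ha' i j).add (ha' j i)).div_const 2)
    (fun i j x => by simp only [hb]; rw [add_comm]) ?_ hv hflat hC ?_
  · intro ξ hξ
    simp only [hba.self_of_nhds]
    exact hpos p hp ξ hξ
  · have h2 : iteratedFDeriv ℝ 2 v =ᶠ[𝓝 p] iteratedFDeriv ℝ 2 u := hvu.iteratedFDeriv ℝ 2
    have h3 : gradient v =ᶠ[𝓝 p] gradient u := hvu.gradient
    filter_upwards [hba, hvu, h2, h3, hCF, hU.mem_nhds hp] with x hx1 hx2 hx3 hx4 hx5 hxU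
    have h := heq x hxU
    rw [scalarOp, ← hx2, ← hx3, ← hx4] at h
    have e : pop b v x = F x (v x) (gradient v x) := by
      simp only [pop, hx1, dd_dd_eq_iteratedFDeriv hv, bv]
      linarith
    rwa [e]

lemma iterate_dd_congr {f g : Euc n → ℝ} {x : Euc n} (h : f =ᶠ[𝓝 x] g) (ξ : Euc n) (k : ℕ) :
    (dd ξ)^[k] f =ᶠ[𝓝 x] (dd ξ)^[k] g := by
  induction k with
  | zero => exact h
  | succ k ih =>
    rw [Function.iterate_succ_apply', Function.iterate_succ_apply']
    exact dd_congr ih ξ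

lemma iterate_dd_zero (ξ : Euc n) (k : ℕ) : (dd ξ)^[k] (0 : Euc n → ℝ) = 0 := by
  induction k with
  | zero => rfl
  | succ k ih =>
    rw [Function.iterate_succ_apply', ih]
    ext x
    exact dd_const ξ 0 x

/-- A nontrivial solution has finite vanishing order at every point. -/
theorem exists_iterate_dd_ne_zero (hn : 2 ≤ n) {U : Set (Euc n)} (hU : IsOpen U)
    (hUconn : IsConnected U)
    {a : Fin n → Fin n → Euc n → ℝ} (ha : ∀ i j, ContDiffOn ℝ (⊤ : ℕ∞) (a i j) U)
    (hsym : ∀ i j, ∀ x ∈ U, a i j x = a j i x)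
    (hpos : ∀ x ∈ U, ∀ ξ : Euc n, ξ ≠ 0 → 0 < ∑ i, ∑ j, a i j x * ξ i * ξ j)
    {F : Euc n → ℝ → Euc n → ℝ}
    (hF : ContDiffOn ℝ (⊤ : ℕ∞) (fun p : Euc n × ℝ × Euc n => F p.1 p.2.1 p.2.2)
      (U ×ˢ (univ : Set (ℝ × Euc n))))
    (hF0 : ∀ x ∈ U, F x 0 0 = 0) {u : Euc n → ℝ} (hu : ContDiffOn ℝ (⊤ : ℕ∞) u U)
    (heq : ∀ x ∈ U, scalarOp a F u x = 0) (hnontriv : ∃ x ∈ U, u x ≠ 0)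
    {p : Euc n} (hp : p ∈ U) {v : Euc n → ℝ}
    (hv : ContDiff ℝ (⊤ : ℕ∞) v) (hvu : v =ᶠ[𝓝 p] u) :
    ∃ ξ k, (dd ξ)^[k] v p ≠ 0 := by
  by_contra! hzero
  set V : Set (Euc n) := {x | u =ᶠ[𝓝 x] 0} with hV
  have hVopen : IsOpen V := isOpen_iff_mem_nhds.mpr fun x hx => eventually_eventually_nhds.mpr hx
  have key : ∀ {q : Euc n} {w : Euc n → ℝ}, q ∈ U → ContDiff ℝ (⊤ : ℕ∞) w → w =ᶠ[𝓝 q] u →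
      (∀ ξ k, (dd ξ)^[k] w q = 0) → q ∈ V := fun hq hw hwu h0 =>
    hwu.symm.trans (eventuallyEq_zero_of_flatAt hn hU ha hsym hpos hF hF0 heq hq hw hwu
      (flatAt_of_iterate_dd hw h0))
  have hsub : U ⊆ V := by
    refine hUconn.isPreconnected.subset_of_closure_inter_subset hVopen
      ⟨p, hp, key hp hv hvu hzero⟩ ?_
    rintro x ⟨hxV, hxU⟩
    obtain ⟨w, hw, hwu⟩ := exists_smooth_eventuallyEq hU hxU hu
    refine key hxU hw hwu fun ξ k => ?_
    by_contra hne
    have hne' : ∀ᶠ y in 𝓝 x, (dd ξ)^[k] w y ≠ 0 :=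
      (contDiff_iterate_dd hw ξ k).continuous.continuousAt.eventually_ne hne
    obtain ⟨y, hyV, hy, hyw⟩ := ((mem_closure_iff_frequently.mp hxV).and_eventually
      (hne'.and (eventually_eventually_nhds.mpr hwu))).exists
    have hyw' : w =ᶠ[𝓝 y] 0 := EventuallyEq.trans hyw hyV
    apply hy
    rw [(iterate_dd_congr hyw' ξ k).eq_of_nhds, iterate_dd_zero]
    rfl
  obtain ⟨x, hx, hux⟩ := hnontriv
  exact hux (hsub hx).eq_of_nhds

end

section

variable {n m : ℕ}

lemma countablyCinfRectifiable_mono {S T : Set (Euc n)} (hT : CountablyCinfRectifiable m T)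
    (h : S ⊆ T) : CountablyCinfRectifiable m S :=
  let ⟨g, hg, hgT⟩ := hT
  ⟨g, hg, h.trans hgT⟩

lemma countablyCinfRectifiable_of_subset_range {S : Set (Euc n)} {h : Euc m → Euc n}
    (hh : ContDiff ℝ (⊤ : ℕ∞) h) (hS : S ⊆ range h) : CountablyCinfRectifiable m S :=
  ⟨fun _ => h, fun _ => hh, hS.trans (subset_iUnion (fun _ : ℕ => range h) 0)⟩

lemma countablyCinfRectifiable_iUnion {S : ℕ → Set (Euc n)}
    (h : ∀ i, CountablyCinfRectifiable m (S i)) : CountablyCinfRectifiable m (⋃ i, S i) := by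
  choose g hg hgS using h
  refine ⟨fun k => g k.unpair.1 k.unpair.2, fun k => hg _ _, iUnion_subset fun i x hx => ?_⟩
  obtain ⟨j, hj⟩ := mem_iUnion.mp (hgS i hx)
  exact mem_iUnion.mpr ⟨Nat.pair i j, by simpa using hj⟩

lemma countablyCinfRectifiable_of_local {S : Set (Euc n)}
    (h : ∀ x ∈ S, ∃ O ∈ 𝓝 x, CountablyCinfRectifiable m (S ∩ O)) :
    CountablyCinfRectifiable m S := by
  choose! O hO hSO using h
  obtain ⟨t, htS, htc, hcov⟩ := TopologicalSpace.countable_cover_nhdsWithin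
    (fun x hx => mem_nhdsWithin_of_mem_nhds (hO x hx))
  rcases S.eq_empty_or_nonempty with rfl | ⟨x₀, hx₀⟩
  · exact countablyCinfRectifiable_of_subset_range (h := fun _ => 0) contDiff_const
      (empty_subset _)
  have htne : t.Nonempty := by
    obtain ⟨x, hx, -⟩ := mem_iUnion₂.mp (hcov hx₀)
    exact ⟨x, hx⟩
  obtain ⟨f, rfl⟩ := htc.exists_eq_range htne
  refine countablyCinfRectifiable_mono
    (countablyCinfRectifiable_iUnion fun i => hSO (f i) (htS (mem_range_self i))) fun x hx => ?_
  obtain ⟨i, hi⟩ := mem_iUnion.mp (by simpa only [biUnion_range] using hcov hx)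
  exact mem_iUnion.mpr ⟨i, hx, hi⟩

lemma exists_linearIsometry_ker {ℓ : Euc n →L[ℝ] ℝ} (hℓ : ℓ ≠ 0) :
    ∃ ι : Euc (n - 1) →ₗᵢ[ℝ] Euc n, ∀ y, ℓ y = 0 → y ∈ range ι := by
  have hfr : Module.finrank ℝ (LinearMap.ker (ℓ : Euc n →ₗ[ℝ] ℝ)) = n - 1 := by
    have h := Module.Dual.finrank_ker_add_one_of_ne_zero (f := (ℓ : Euc n →ₗ[ℝ] ℝ))
      (fun h => hℓ (ContinuousLinearMap.coe_injective h))
    rw [finrank_euclideanSpace_fin] at h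
    omega
  let e := ((stdOrthonormalBasis ℝ (LinearMap.ker (ℓ : Euc n →ₗ[ℝ] ℝ))).reindex
    (finCongr hfr)).repr
  refine ⟨(Submodule.subtypeₗᵢ _).comp e.symm.toLinearIsometry, fun y hy => ?_⟩
  exact ⟨e ⟨y, hy⟩, by simp⟩

lemma exists_nhds_subset_range {g : Euc n → ℝ} (hg : ContDiff ℝ (⊤ : ℕ∞) g) {x : Euc n}
    (hgx : g x = 0) (hdg : fderiv ℝ g x ≠ 0) :
    ∃ O ∈ 𝓝 x, ∃ h : Euc (n - 1) → Euc n, ContDiff ℝ (⊤ : ℕ∞) h ∧ {y | g y = 0} ∩ O ⊆ range h := by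
  set ℓ := fderiv ℝ g x with hℓ
  obtain ⟨η, hη⟩ : ∃ η, ℓ η ≠ 0 := by
    by_contra! h
    exact hdg (ContinuousLinearMap.ext h)
  set ξ := (ℓ η)⁻¹ • η with hξ
  have hξ1 : ℓ ξ = 1 := by simp [hξ, hη]
  let Φ : Euc n → Euc n := fun y => y + (g y - ℓ y) • ξ
  have hΦ : ContDiff ℝ (⊤ : ℕ∞) Φ := contDiff_id.add ((hg.sub ℓ.contDiff).smul contDiff_const)
  have hℓΦ : ∀ y, ℓ (Φ y) = g y := fun y => by simp [Φ, hξ1]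
  have hΦ' : HasFDerivAt Φ ((ContinuousLinearEquiv.refl ℝ (Euc n) : Euc n ≃L[ℝ] Euc n) :
      Euc n →L[ℝ] Euc n) x := by
    have h1 : HasFDerivAt (fun y => g y - ℓ y) (ℓ - ℓ) x :=
      (smooth_differentiableAt hg x).hasFDerivAt.sub ℓ.hasFDerivAt
    have h2 := (hasFDerivAt_id x).add (h1.smul_const ξ)
    have e : ContinuousLinearMap.id ℝ (Euc n) + (ℓ - ℓ).smulRight ξ =
        ((ContinuousLinearEquiv.refl ℝ (Euc n) : Euc n ≃L[ℝ] Euc n) : Euc n →L[ℝ] Euc n) := by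
      ext y
      simp
    rw [← e]
    exact h2
  set e := hΦ.contDiffAt.toOpenPartialHomeomorph Φ hΦ' (by simp) with he
  have hxe : x ∈ e.source := hΦ.contDiffAt.mem_toOpenPartialHomeomorph_source hΦ' (by simp)
  have hecoe : ∀ y, e y = Φ y := fun y => rfl
  let W : Set (Euc n) := {y | fderiv ℝ Φ y ∈
    range ((↑) : (Euc n ≃L[ℝ] Euc n) → (Euc n →L[ℝ] Euc n))}
  have hW : IsOpen W := ContinuousLinearEquiv.isOpen.preimage (hΦ.continuous_fderiv (by simp))
  have hxW : x ∈ W := ⟨_, hΦ'.fderiv.symm⟩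
  have hT : IsOpen (e.target ∩ e.symm ⁻¹' W) := e.isOpen_inter_preimage_symm hW
  have hxT : Φ x ∈ e.target ∩ e.symm ⁻¹' W :=
    ⟨e.map_source hxe, by rw [mem_preimage, ← hecoe, e.left_inv hxe]; exact hxW⟩
  have hsm : ∀ z ∈ e.target ∩ e.symm ⁻¹' W, ContDiffAt ℝ (⊤ : ℕ∞) e.symm z := by
    rintro z ⟨hz, A, hA⟩
    refine e.contDiffAt_symm hz (f₀' := A) ?_ hΦ.contDiffAt
    rw [hA]
    exact (hΦ.differentiable (by simp) _).hasFDerivAt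
  obtain ⟨r, hr, hrT⟩ := Metric.isOpen_iff.mp hT _ hxT
  obtain ⟨ι, hι⟩ := exists_linearIsometry_ker hdg
  obtain ⟨c, hc⟩ := hι (Φ x) (by rw [hℓΦ, hgx])
  refine ⟨e.source ∩ Φ ⁻¹' ball (Φ x) r, Filter.inter_mem (e.open_source.mem_nhds hxe)
    (hΦ.continuous.continuousAt (Metric.ball_mem_nhds _ hr)),
    fun z => e.symm (ι (OpenPartialHomeomorph.univBall c r z)), ?_, ?_⟩
  · refine contDiff_iff_contDiffAt.mpr fun z => ?_
    have hz : OpenPartialHomeomorph.univBall c r z ∈ ball c r := by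
      rw [← OpenPartialHomeomorph.univBall_target c hr]
      exact (OpenPartialHomeomorph.univBall c r).map_source (by simp)
    have h1 : ι (OpenPartialHomeomorph.univBall c r z) ∈ ball (Φ x) r := by
      rw [← hc, mem_ball, ι.dist_map]
      exact hz
    exact (hsm _ (hrT h1)).comp z
      (ι.contDiff.comp OpenPartialHomeomorph.contDiff_univBall).contDiffAt
  · rintro y ⟨hy, hye, hyr⟩
    obtain ⟨w, hw⟩ := hι (Φ y) (by rw [hℓΦ]; exact hy)
    have hwc : w ∈ ball c r := by
      rw [mem_ball, ← ι.dist_map, hw, hc]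
      exact hyr
    rw [← OpenPartialHomeomorph.univBall_target c hr] at hwc
    refine ⟨(OpenPartialHomeomorph.univBall c r).symm w, ?_⟩
    simp only
    rw [(OpenPartialHomeomorph.univBall c r).right_inv hwc, hw, ← hecoe, e.left_inv hye]

lemma countablyCinfRectifiable_regular {g : Euc n → ℝ} (hg : ContDiff ℝ (⊤ : ℕ∞) g) :
    CountablyCinfRectifiable (n - 1) {x | g x = 0 ∧ fderiv ℝ g x ≠ 0} := by
  refine countablyCinfRectifiable_of_local fun x hx => ?_
  obtain ⟨O, hO, h, hh, hsub⟩ := exists_nhds_subset_range hg hx.1 hx.2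
  exact ⟨O, hO, countablyCinfRectifiable_of_subset_range hh
    fun y hy => hsub ⟨hy.1.1, hy.2⟩⟩

/-- At a zero where some iterated directional derivative is nonzero, there is a last vanishing
one before the first nonzero one. -/
lemma exists_iterate_dd_eq_zero {v : Euc n → ℝ} {ξ x : Euc n} {k : ℕ} (hx : v x = 0)
    (hk : (dd ξ)^[k] v x ≠ 0) :
    ∃ j < k, (dd ξ)^[j] v x = 0 ∧ dd ξ ((dd ξ)^[j] v) x ≠ 0 := by
  induction k with
  | zero => exact absurd hx hk
  | succ k ih =>
    by_cases h : (dd ξ)^[k] v x = 0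
    · exact ⟨k, k.lt_succ_self, h, by rwa [Function.iterate_succ_apply'] at hk⟩
    · obtain ⟨j, hj, h⟩ := ih h
      exact ⟨j, hj.trans k.lt_succ_self, h⟩

lemma countablyCinfRectifiable_zeros {v : Euc n → ℝ} (hv : ContDiff ℝ (⊤ : ℕ∞) v) (ξ : Euc n)
    (k : ℕ) : CountablyCinfRectifiable (n - 1) {x | v x = 0 ∧ (dd ξ)^[k] v x ≠ 0} := by
  refine countablyCinfRectifiable_mono (countablyCinfRectifiable_iUnion fun j =>
    countablyCinfRectifiable_regular (contDiff_iterate_dd hv ξ j)) fun x hx => ?_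
  obtain ⟨j, -, h1, h2⟩ := exists_iterate_dd_eq_zero hx.1 hx.2
  exact mem_iUnion.mpr ⟨j, h1, fun h => h2 (by rw [dd, h]; rfl)⟩

lemma hausdorffMeasure_le_of_dist_le {π : Euc n → Fin m → ℝ} {T : Set (Euc n)} {C : ℝ≥0}
    (h : ∀ y ∈ T, ∀ z ∈ T, dist y z ≤ C * dist (π y) (π z)) :
    μH[(m : ℝ)] T ≤ (C : ℝ≥0∞) ^ (m : ℝ) * volume (π '' T) := by
  have hvol : (μH[(m : ℝ)] : Measure (Fin m → ℝ)) = volume := by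
    simpa using hausdorffMeasure_pi_real (ι := Fin m)
  choose! s hs hπs using fun a (ha : a ∈ π '' T) => ha
  have hL : LipschitzOnWith C s (π '' T) := by
    refine LipschitzOnWith.of_dist_le_mul fun a ha b hb => ?_
    have := h _ (hs a ha) _ (hs b hb)
    rwa [hπs a ha, hπs b hb] at this
  have hT : T ⊆ s '' (π '' T) := fun y hy => by
    have hy' := mem_image_of_mem π hy
    refine ⟨π y, hy', ?_⟩
    have := h _ (hs _ hy') _ hy
    rw [hπs _ hy', dist_self, mul_zero] at this
    exact dist_le_zero.mp this
  rw [← hvol]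
  exact (measure_mono hT).trans (hL.hausdorffMeasure_image_le (by positivity))

lemma hausdorffMeasure_lt_top_of_fibers {π : Euc n → Fin m → ℝ} (hπ : Continuous π)
    {S K : Set (Euc n)} (hS : MeasurableSet S) (hK : IsCompact K) (hSK : S ⊆ K) {C : ℝ≥0}
    {P : ℕ → Set (Euc n)} (hP : ∀ c, MeasurableSet (P c)) (hcov : S ⊆ ⋃ c, P c)
    (hlip : ∀ c, ∀ y ∈ S ∩ P c, ∀ z ∈ S ∩ P c, dist y z ≤ C * dist (π y) (π z)) {k : ℕ}
    (hfib : ∀ τ, ∀ s : Finset (Euc n), (∀ x ∈ s, x ∈ S ∧ π x = τ) → s.card ≤ k) :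
    μH[(m : ℝ)] S < ⊤ := by
  set T : ℕ → Set (Euc n) := fun c => S ∩ disjointed P c with hT
  have hTm : ∀ c, MeasurableSet (T c) := fun c => hS.inter (MeasurableSet.disjointed hP c)
  have hTd : Pairwise (Function.onFun Disjoint T) := fun c d hcd =>
    (disjoint_disjointed P hcd).mono inter_subset_right inter_subset_right
  have hTlip : ∀ c, ∀ y ∈ T c, ∀ z ∈ T c, dist y z ≤ C * dist (π y) (π z) := fun c y hy z hz =>
    hlip c y ⟨hy.1, disjointed_subset P c hy.2⟩ z ⟨hz.1, disjointed_subset P c hz.2⟩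
  have hinj : ∀ c, InjOn π (T c) := fun c y hy z hz hyz => by
    have := hTlip c y hy z hz
    rw [hyz, dist_self, mul_zero] at this
    exact dist_le_zero.mp this
  have himm : ∀ c, MeasurableSet (π '' T c) := fun c =>
    (hTm c).image_of_continuousOn_injOn hπ.continuousOn (hinj c)
  have hSU : S ⊆ ⋃ c, T c := by
    rw [hT, ← inter_iUnion, iUnion_disjointed]
    exact subset_inter le_rfl hcov
  have hsum : ∑' c, volume (π '' T c) ≤ k * volume (π '' K) := by
    calc ∑' c, volume (π '' T c)
        = ∑' c, ∫⁻ τ, (π '' T c).indicator 1 τ := by simp_rw [lintegral_indicator_one (himm _)]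
      _ = ∫⁻ τ, ∑' c, (π '' T c).indicator 1 τ :=
          (lintegral_tsum fun c => (measurable_one.indicator (himm c)).aemeasurable).symm
      _ ≤ ∫⁻ τ, (π '' K).indicator (fun _ => (k : ℝ≥0∞)) τ := by
          refine lintegral_mono fun τ => ?_
          by_cases hτ : τ ∈ π '' K
          · rw [indicator_of_mem hτ]
            refine ENNReal.summable.tsum_le_of_sum_le fun F => ?_
            classical
            simp only [indicator_apply, Pi.one_apply]
            rw [Finset.sum_boole]
            have hex : ∀ c ∈ F.filter fun c => τ ∈ π '' T c, ∃ x, x ∈ T c ∧ π x = τ :=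
              fun c hc => (Finset.mem_filter.mp hc).2
            choose! x hxT hxτ using hex
            have hxinj : Set.InjOn x (F.filter fun c => τ ∈ π '' T c) := by
              intro c hc d hd hcd
              by_contra hne
              refine disjoint_left.mp (hTd hne) (hxT c hc) ?_
              rw [hcd]
              exact hxT d hd
            have := hfib τ ((F.filter fun c => τ ∈ π '' T c).image x) (by
              intro y hy
              obtain ⟨c, hc, rfl⟩ := Finset.mem_image.mp hy
              exact ⟨(hxT c hc).1, hxτ c hc⟩)
            rw [Finset.card_image_of_injOn hxinj] at this
            exact_mod_cast this
          · have h0 : ∀ c, (π '' T c).indicator (1 : (Fin m → ℝ) → ℝ≥0∞) τ = 0 := fun c =>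
              indicator_of_notMem
                (fun h => hτ (image_mono (inter_subset_left.trans hSK) h)) _
            simp [h0]
      _ = k * volume (π '' K) := lintegral_indicator_const (hK.image hπ).measurableSet _
  calc μH[(m : ℝ)] S ≤ ∑' c, μH[(m : ℝ)] (T c) := (measure_mono hSU).trans (measure_iUnion_le _)
    _ ≤ ∑' c, (C : ℝ≥0∞) ^ (m : ℝ) * volume (π '' T c) :=
        ENNReal.tsum_le_tsum fun c => hausdorffMeasure_le_of_dist_le (hTlip c)
    _ = (C : ℝ≥0∞) ^ (m : ℝ) * ∑' c, volume (π '' T c) := ENNReal.tsum_mul_left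
    _ ≤ (C : ℝ≥0∞) ^ (m : ℝ) * (k * volume (π '' K)) := by gcongr
    _ < ⊤ := ENNReal.mul_lt_top (ENNReal.rpow_lt_top_of_nonneg (by positivity) (by simp))
        (ENNReal.mul_lt_top (by simp) (hK.image hπ).measure_lt_top)

/-- The projection forgetting the `i`-th coordinate. -/
def forget (i : Fin (m + 1)) (x : Euc (m + 1)) : Fin m → ℝ := fun l => x (i.succAbove l)

lemma continuous_forget (i : Fin (m + 1)) : Continuous (forget i) := by
  unfold forget
  fun_prop

lemma norm_le_sum_abs (x : Euc n) : ‖x‖ ≤ ∑ i, |x i| := by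
  conv_lhs => rw [← sum_smul_bv x]
  refine (norm_sum_le _ _).trans (Finset.sum_le_sum fun i _ => ?_)
  rw [norm_smul, norm_bv, mul_one, Real.norm_eq_abs]

lemma exists_nhds_dist_le {g : Euc (m + 1) → ℝ} (hg : ContDiff ℝ (⊤ : ℕ∞) g) {x : Euc (m + 1)}
    {i : Fin (m + 1)} (hi : dd (bv i) g x ≠ 0)
    (hmax : ∀ l, |dd (bv l) g x| ≤ |dd (bv i) g x|) :
    ∃ O ∈ 𝓝 x, ∀ y ∈ O, ∀ z ∈ O, g y = 0 → g z = 0 →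
      dist y z ≤ 4 * m * dist (forget i y) (forget i z) := by
  set A := |dd (bv i) g x| with hA
  have hA0 : 0 < A := abs_pos.mpr hi
  have hstrict : HasStrictFDerivAt g (fderiv ℝ g x) x := hg.contDiffAt.hasStrictFDerivAt (by simp)
  have h := hstrict.isLittleO.def (half_pos hA0)
  rw [nhds_prod_eq] at h
  obtain ⟨O, hO, h⟩ := eventually_prod_self_iff'.mp h
  refine ⟨O, hO, fun y hy z hz hgy hgz => ?_⟩
  have h1 := h y hy z hz
  simp only [hgy, hgz, sub_self, zero_sub, norm_neg] at h1
  set δ := y - z with hδ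
  set d := dist (forget i y) (forget i z) with hd
  have hd0 : 0 ≤ d := dist_nonneg
  have hl : ∀ l, |δ (i.succAbove l)| ≤ d := fun l => dist_le_pi_dist (forget i y) (forget i z) l
  have h2 : ‖δ‖ ≤ |δ i| + m * d := by
    refine (norm_le_sum_abs δ).trans ?_
    rw [Fin.sum_univ_succAbove _ i]
    refine add_le_add le_rfl ((Finset.sum_le_sum fun l _ => hl l).trans ?_)
    simp
  have h3 : fderiv ℝ g x δ = δ i * dd (bv i) g x +
      ∑ l : Fin m, δ (i.succAbove l) * dd (bv (i.succAbove l)) g x := by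
    rw [← Fin.sum_univ_succAbove (fun l => δ l * dd (bv l) g x) i]
    exact dd_eq_sum δ g x
  have h4 : |∑ l : Fin m, δ (i.succAbove l) * dd (bv (i.succAbove l)) g x| ≤ m * (d * A) :=
    abs_sum_le_card_mul fun l => by
      rw [abs_mul]
      exact mul_le_mul (hl l) (hmax _) (abs_nonneg _) hd0
  have h5 : |δ i| * A ≤ |fderiv ℝ g x δ| + m * (d * A) := by
    rw [hA, ← abs_mul]
    have e : δ i * dd (bv i) g x = fderiv ℝ g x δ -
        ∑ l : Fin m, δ (i.succAbove l) * dd (bv (i.succAbove l)) g x := by rw [h3]; ring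
    rw [e]
    exact (abs_sub _ _).trans (by rw [← hA]; gcongr)
  rw [Real.norm_eq_abs] at h1
  have h6 : |δ i| ≤ 3 * (m * d) := by
    refine le_of_mul_le_mul_right ?_ hA0
    have h7 := mul_le_mul_of_nonneg_left h2 (half_pos hA0).le
    nlinarith only [h1, h5, h7]
  rw [dist_eq_norm]
  linarith

lemma exists_zero_of_strictMono {I : Set ℝ} (hI : I.OrdConnected) (k : ℕ) :
    ∀ (f : ℕ → ℝ → ℝ), (∀ j t, HasDerivAt (f j) (f (j + 1) t) t) →
      ∀ a : Fin (k + 1) → ℝ, StrictMono a → (∀ i, a i ∈ I ∧ f 0 (a i) = 0) →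
        ∃ c ∈ I, f k c = 0 := by
  induction k with
  | zero => exact fun f _ a _ h => ⟨a 0, h 0⟩
  | succ k ih =>
    intro f hf a ha h
    have hex : ∀ i : Fin (k + 1), ∃ c ∈ Ioo (a i.castSucc) (a i.succ), f 1 c = 0 := fun i =>
      exists_hasDerivAt_eq_zero (ha i.castSucc_lt_succ)
        (fun t _ => (hf 0 t).continuousAt.continuousWithinAt)
        (by rw [(h _).2, (h _).2]) fun t _ => hf 0 t
    choose c hc hfc using hex
    have hmono : StrictMono c := by
      refine Fin.strictMono_iff_lt_succ.mpr fun i => ?_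
      have h1 := (hc i.castSucc).2
      have h2 := (hc i.succ).1
      rw [← Fin.succ_castSucc] at h2
      exact h1.trans h2
    exact ih (fun j => f (j + 1)) (fun j => hf (j + 1)) c hmono
      fun i => ⟨hI.out (h _).1 (h _).1 (Ioo_subset_Icc_self (hc i)), hfc i⟩

lemma card_le_of_iterate_dd_ne_zero {w : Euc (m + 1) → ℝ} (hw : ContDiff ℝ (⊤ : ℕ∞) w)
    {B : Set (Euc (m + 1))} (hB : Convex ℝ B) {i : Fin (m + 1)} {k : ℕ}
    (hk : ∀ x ∈ B, (dd (bv i))^[k] w x ≠ 0) (τ : Fin m → ℝ) (s : Finset (Euc (m + 1)))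
    (hs : ∀ x ∈ s, (x ∈ B ∧ w x = 0) ∧ forget i x = τ) : s.card ≤ k := by
  by_contra! hcard
  obtain ⟨x₀, hx₀⟩ := Finset.card_pos.mp (by omega : 0 < s.card)
  set p : Euc (m + 1) := x₀ - x₀ i • bv i with hp
  have hline : ∀ x ∈ s, x = p + x i • bv i := by
    intro x hx
    ext l
    rcases Fin.eq_self_or_eq_succAbove i l with rfl | ⟨l, rfl⟩
    · simp [hp, bv_apply]
    · have : forget i x l = forget i x₀ l := by rw [(hs x hx).2, (hs x₀ hx₀).2]
      simp only [forget] at this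
      simp [hp, bv_apply, Fin.ne_succAbove, this]
  have hinj : Set.InjOn (fun x : Euc (m + 1) => x i) s := fun x hx y hy hxy => by
    rw [hline x hx, hline y hy, show x i = y i from hxy]
  obtain ⟨t, ht, htc⟩ := Finset.exists_subset_card_eq (s := s.image fun x => x i) (n := k + 1)
    (by rw [Finset.card_image_of_injOn hinj]; omega)
  have hI : (((fun r : ℝ => p + r • bv i) ⁻¹' B).OrdConnected) := by
    refine Convex.ordConnected fun a ha b hb α β hα hβ hαβ => ?_
    have := hB ha hb hα hβ hαβ
    have e : α • (p + a • bv i) + β • (p + b • bv i) =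
        p + (α • a + β • b) • (bv i : Euc (m + 1)) := by
      have : p = (α + β) • p := by rw [hαβ, one_smul]
      conv_rhs => rw [this]
      simp only [smul_eq_mul]
      module
    rw [mem_preimage, ← e]
    exact this
  obtain ⟨c, hc, hc0⟩ := exists_zero_of_strictMono hI k
    (fun j r => (dd (bv i))^[j] w (p + r • bv i)) (fun j r => by
      simp only [Function.iterate_succ_apply']
      exact hasDerivAt_line (contDiff_iterate_dd hw _ j) p _ r)
    (t.orderEmbOfFin htc) (t.orderEmbOfFin htc).strictMono fun l => by
      obtain ⟨x, hx, hxl⟩ := Finset.mem_image.mp (ht (t.orderEmbOfFin_mem htc l))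
      simp only at hxl
      rw [← hxl, mem_preimage, ← hline x hx]
      exact (hs x hx).1
  exact hk _ hc hc0

lemma hausdorffMeasure_piece_lt_top {w g : Euc (m + 1) → ℝ} (hw : ContDiff ℝ (⊤ : ℕ∞) w)
    (hg : ContDiff ℝ (⊤ : ℕ∞) g) {K : Set (Euc (m + 1))} (hKc : IsCompact K) (hKv : Convex ℝ K)
    {i : Fin (m + 1)} {k : ℕ} (hk : ∀ x ∈ K, (dd (bv i))^[k] w x ≠ 0) :
    μH[(m : ℝ)] {x | (x ∈ K ∧ w x = 0) ∧ g x = 0 ∧ dd (bv i) g x ≠ 0 ∧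
      ∀ l, |dd (bv l) g x| ≤ |dd (bv i) g x|} < ⊤ := by
  set S := {x | (x ∈ K ∧ w x = 0) ∧ g x = 0 ∧ dd (bv i) g x ≠ 0 ∧
      ∀ l, |dd (bv l) g x| ≤ |dd (bv i) g x|} with hS
  have hdg := fun l => (contDiff_dd hg (bv l)).continuous
  have hSm : MeasurableSet S := by
    refine (hKc.measurableSet.inter
      (isClosed_eq hw.continuous continuous_const).measurableSet).inter
      ((isClosed_eq hg.continuous continuous_const).measurableSet.inter
        ((isOpen_ne_fun (hdg i) continuous_const).measurableSet.inter ?_))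
    have : IsClosed {x | ∀ l, |dd (bv l) g x| ≤ |dd (bv i) g x|} := by
      rw [ofPred_forall]
      exact isClosed_iInter fun l => isClosed_le (hdg l).abs (hdg i).abs
    exact this.measurableSet
  rcases S.eq_empty_or_nonempty with h | ⟨x₀, hx₀⟩
  · simp [h]
  have hloc : ∀ x ∈ S, ∃ O ∈ 𝓝 x, ∀ y ∈ O, ∀ z ∈ O, g y = 0 → g z = 0 →
      dist y z ≤ 4 * m * dist (forget i y) (forget i z) := fun x hx =>
    exists_nhds_dist_le hg hx.2.2.1 hx.2.2.2
  choose! O hO hdist using hloc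
  obtain ⟨t, htS, htc, hcov⟩ := TopologicalSpace.countable_cover_nhdsWithin
    (fun x hx => mem_nhdsWithin_of_mem_nhds (interior_mem_nhds.mpr (hO x hx)))
  have htne : t.Nonempty := by
    obtain ⟨x, hx, -⟩ := mem_iUnion₂.mp (hcov hx₀)
    exact ⟨x, hx⟩
  obtain ⟨f, rfl⟩ := htc.exists_eq_range htne
  refine hausdorffMeasure_lt_top_of_fibers (continuous_forget i) hSm hKc (fun x hx => hx.1.1)
    (C := 4 * m) (P := fun c => interior (O (f c))) (fun c => isOpen_interior.measurableSet)
    (by simpa only [biUnion_range] using hcov) (fun c y hy z hz => ?_) (k := k)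
    (fun τ s hs => card_le_of_iterate_dd_ne_zero hw hKv hk τ s fun x hx =>
      ⟨(hs x hx).1.1, (hs x hx).2⟩)
  exact_mod_cast hdist (f c) (htS (mem_range_self c)) y (interior_subset hy.2) z
    (interior_subset hz.2) hy.1.2.1 hz.1.2.1

lemma exists_hausdorffMeasure_lt_top_of_coord {w : Euc (m + 1) → ℝ}
    (hw : ContDiff ℝ (⊤ : ℕ∞) w) {q : Euc (m + 1)} {k : ℕ}
    (hk : ∀ i, (dd (bv i))^[k] w q ≠ 0) :
    ∃ O ∈ 𝓝 q, μH[(m : ℝ)] ({x | w x = 0} ∩ O) < ⊤ := by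
  have hev : ∀ᶠ x in 𝓝 q, ∀ i, (dd (bv i))^[k] w x ≠ 0 := Filter.eventually_all.mpr fun i =>
    (contDiff_iterate_dd hw (bv i) k).continuous.continuousAt.eventually_ne (hk i)
  obtain ⟨r, hr, hball⟩ := Metric.nhds_basis_closedBall.eventually_iff.mp hev
  refine ⟨closedBall q r, Metric.closedBall_mem_nhds q hr, ?_⟩
  set g : ℕ → Euc (m + 1) → ℝ := fun j => (dd (bv 0))^[j] w with hg
  have hsub : {x | w x = 0} ∩ closedBall q r ⊆ ⋃ ji : Fin k × Fin (m + 1),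
      {x | (x ∈ closedBall q r ∧ w x = 0) ∧ g ji.1 x = 0 ∧ dd (bv ji.2) (g ji.1) x ≠ 0 ∧
        ∀ l, |dd (bv l) (g ji.1) x| ≤ |dd (bv ji.2) (g ji.1) x|} := by
    rintro x ⟨hx0, hxr⟩
    obtain ⟨j, hj, h1, h2⟩ := exists_iterate_dd_eq_zero hx0 (hball hxr 0)
    obtain ⟨i, hi⟩ := Finite.exists_max fun l => |dd (bv l) (g j) x|
    refine mem_iUnion.mpr ⟨(⟨j, hj⟩, i), ⟨hxr, hx0⟩, h1, ?_, hi⟩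
    exact abs_pos.mp ((abs_pos.mpr h2).trans_le (hi 0))
  refine (measure_mono hsub).trans_lt ((measure_iUnion_le _).trans_lt ?_)
  rw [tsum_fintype]
  exact ENNReal.sum_lt_top.mpr fun ji _ => hausdorffMeasure_piece_lt_top hw
    (contDiff_iterate_dd hw _ _) (isCompact_closedBall q r) (convex_closedBall q r)
    fun x hx => hball hx _

lemma iterate_dd_comp_affine {v : Euc n → ℝ} (hv : ContDiff ℝ (⊤ : ℕ∞) v)
    (L : Euc n →L[ℝ] Euc n) (p ξ : Euc n) (k : ℕ) :
    (dd ξ)^[k] (fun y => v (p + L y)) = fun y => (dd (L ξ))^[k] v (p + L y) := by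
  induction k with
  | zero => rfl
  | succ k ih =>
    ext y
    rw [Function.iterate_succ_apply', ih, Function.iterate_succ_apply']
    exact dd_comp_affine L p ξ y (smooth_differentiableAt (contDiff_iterate_dd hv _ k) _)

/-- Any direction can be perturbed to a frame of directions given by an invertible linear map,
along which a given nonvanishing iterated derivative remains nonzero. -/
lemma exists_linear_iterate_dd_ne_zero {v : Euc n → ℝ} (hv : ContDiff ℝ (⊤ : ℕ∞) v)
    {p ξ : Euc n} {k : ℕ} (hk : (dd ξ)^[k] v p ≠ 0) :
    ∃ T K : Euc n →L[ℝ] Euc n, (∀ z, T (K z) = z) ∧ ∀ i, (dd (T (bv i)))^[k] v p ≠ 0 := by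
  have hcont : Continuous fun η : Euc n => (dd η)^[k] v p := by
    simp only [iterate_dd_eq hv]
    exact (iteratedFDeriv ℝ k v p).cont.comp (by fun_prop)
  set e : Euc n →L[ℝ] ℝ := ∑ i, EuclideanSpace.proj i with he
  have he1 : ∀ i, e (bv i) = 1 := fun i => by simp [he, bv_apply]
  have hev : ∀ᶠ ε : ℝ in 𝓝[>] 0, (∀ i, (dd (ε • bv i + ξ))^[k] v p ≠ 0) ∧ ε + e ξ ≠ 0 := by
    refine (Filter.eventually_all.mpr fun i => ?_).and ?_
    · refine Filter.Eventually.filter_mono nhdsWithin_le_nhds ?_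
      have h : Continuous fun ε : ℝ => (dd (ε • bv i + ξ))^[k] v p :=
        hcont.comp (by fun_prop : Continuous fun ε : ℝ => ε • (bv i : Euc n) + ξ)
      exact h.continuousAt.eventually_ne (by simpa using hk)
    · rcases eq_or_ne (e ξ) 0 with h0 | h0
      · filter_upwards [self_mem_nhdsWithin] with ε hε
        rw [h0, add_zero]
        exact (mem_Ioi.mp hε).ne'
      · refine Filter.Eventually.filter_mono nhdsWithin_le_nhds ?_
        exact (by fun_prop : Continuous fun ε : ℝ => ε + e ξ).continuousAt.eventually_ne
          (by simpa using h0)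
  obtain ⟨ε, ⟨hε1, hε2⟩, hε⟩ := (hev.and self_mem_nhdsWithin).exists
  have hε0 : ε ≠ 0 := (mem_Ioi.mp hε).ne'
  refine ⟨ε • ContinuousLinearMap.id ℝ _ + e.smulRight ξ,
    ε⁻¹ • (ContinuousLinearMap.id ℝ _ - e.smulRight ((ε + e ξ)⁻¹ • ξ)), fun z => ?_, fun i => ?_⟩
  · ext l
    simp only [add_apply, smul_apply, sub_apply, ContinuousLinearMap.id_apply,
      ContinuousLinearMap.smulRight_apply, map_smul, map_sub, smul_eq_mul, PiLp.add_apply,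
      PiLp.smul_apply, PiLp.sub_apply]
    field_simp
    ring
  · simpa [he1] using hε1 i

lemma exists_hausdorffMeasure_lt_top {v : Euc (m + 1) → ℝ} (hv : ContDiff ℝ (⊤ : ℕ∞) v)
    {p ξ : Euc (m + 1)} {k : ℕ} (hk : (dd ξ)^[k] v p ≠ 0) :
    ∃ O ∈ 𝓝 p, μH[(m : ℝ)] ({x | v x = 0} ∩ O) < ⊤ := by
  obtain ⟨T, K, hTK, hT⟩ := exists_linear_iterate_dd_ne_zero hv hk
  obtain ⟨O, hO, hfin⟩ := exists_hausdorffMeasure_lt_top_of_coord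
    (w := fun y => v (p + T y)) (q := 0) (k := k)
    (hv.comp (contDiff_const.add T.contDiff)) fun i => by
      rw [iterate_dd_comp_affine hv]
      simpa using hT i
  have hlip : LipschitzWith ‖T‖₊ fun y => p + T y := by
    refine LipschitzWith.of_dist_le_mul fun x y => ?_
    rw [dist_add_left]
    exact T.lipschitz.dist_le_mul x y
  have hK : ContinuousAt (fun x => K (x - p)) p := by fun_prop
  refine ⟨(fun x => K (x - p)) ⁻¹' O, hK.preimage_mem_nhds (by simpa using hO), ?_⟩
  have hsub : {x | v x = 0} ∩ (fun x => K (x - p)) ⁻¹' O ⊆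
      (fun y => p + T y) '' ({y | v (p + T y) = 0} ∩ O) := by
    rintro x ⟨hx, hxO⟩
    have hx' : p + T (K (x - p)) = x := by rw [hTK, add_sub_cancel]
    exact ⟨K (x - p), ⟨by simpa only [mem_ofPred_eq, hx'] using hx, hxO⟩, hx'⟩
  refine (measure_mono hsub).trans_lt ((hlip.hausdorffMeasure_image_le m.cast_nonneg _).trans_lt ?_)
  exact ENNReal.mul_lt_top (ENNReal.rpow_lt_top_of_nonneg m.cast_nonneg ENNReal.coe_ne_top) hfin

end

end NodalSet

/-- For a nontrivial smooth solution `u` of a scalar semilinear elliptic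
second-order equation respecting the zero section on an open connected `U ⊆ ℝⁿ`, `n ≥ 2`,
the nodal set `N(u) = u⁻¹(0)` is countably `(n−1)`-`C^∞`-rectifiable and has locally
finite `(n−1)`-dimensional Hausdorff measure. -/
theorem nodal_set_rectifiable_scalar_second_order
    (n : ℕ) (hn : 2 ≤ n)
    (U : Set (Euc n)) (hUopen : IsOpen U) (hUconn : IsConnected U)
    (a : Fin n → Fin n → Euc n → ℝ)
    (ha : ∀ i j, ContDiffOn ℝ (⊤ : ℕ∞) (a i j) U)
    (hsym : ∀ i j, ∀ x ∈ U, a i j x = a j i x)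
    (hpos : ∀ x ∈ U, ∀ ξ : Euc n, ξ ≠ 0 → 0 < ∑ i, ∑ j, a i j x * ξ i * ξ j)
    (F : Euc n → ℝ → Euc n → ℝ)
    (hF : ContDiffOn ℝ (⊤ : ℕ∞) (fun p : Euc n × ℝ × Euc n => F p.1 p.2.1 p.2.2)
      (U ×ˢ (univ : Set (ℝ × Euc n))))
    (hF0 : ∀ x ∈ U, F x 0 0 = 0)
    (u : Euc n → ℝ) (hu : ContDiffOn ℝ (⊤ : ℕ∞) u U)
    (heq : ∀ x ∈ U, scalarOp a F u x = 0)
    (hnontriv : ∃ x ∈ U, u x ≠ 0) :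
    CountablyCinfRectifiable (n - 1) {x ∈ U | u x = 0} ∧
      ∀ p ∈ U, ∃ r > 0, μH[(n : ℝ) - 1] ({x ∈ U | u x = 0} ∩ ball p r) < ⊤ := by
  have hkey : ∀ p ∈ U, ∃ v : Euc n → ℝ, ContDiff ℝ (⊤ : ℕ∞) v ∧ v =ᶠ[𝓝 p] u ∧
      ∃ ξ k, (NodalSet.dd ξ)^[k] v p ≠ 0 := fun p hp =>
    let ⟨v, hv, hvu⟩ := NodalSet.exists_smooth_eventuallyEq hUopen hp hu
    ⟨v, hv, hvu, NodalSet.exists_iterate_dd_ne_zero hn hUopen hUconn ha hsym hpos hF hF0 hu heq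
      hnontriv hp hv hvu⟩
  constructor
  · refine NodalSet.countablyCinfRectifiable_of_local fun p hp => ?_
    obtain ⟨v, hv, hvu, ξ, k, hk⟩ := hkey p hp.1
    have hne : ∀ᶠ y in 𝓝 p, (NodalSet.dd ξ)^[k] v y ≠ 0 :=
      (NodalSet.contDiff_iterate_dd hv ξ k).continuous.continuousAt.eventually_ne hk
    exact ⟨_, hvu.and hne, NodalSet.countablyCinfRectifiable_mono
      (NodalSet.countablyCinfRectifiable_zeros hv ξ k)
      fun y hy => ⟨hy.2.1.trans hy.1.2, hy.2.2⟩⟩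
  · intro p hp
    obtain ⟨v, hv, hvu, ξ, k, hk⟩ := hkey p hp
    obtain ⟨m, rfl⟩ : ∃ m, n = m + 1 := ⟨n - 1, by omega⟩
    obtain ⟨O, hO, hfin⟩ := NodalSet.exists_hausdorffMeasure_lt_top hv hk
    obtain ⟨r, hr, hball⟩ := Metric.mem_nhds_iff.mp (Filter.inter_mem hO hvu)
    refine ⟨r, hr, ?_⟩
    rw [Nat.cast_add, Nat.cast_one, add_sub_cancel_right]
    have hsub : {x ∈ U | u x = 0} ∩ ball p r ⊆ {x | v x = 0} ∩ O :=
      fun y hy => ⟨(hball hy.2).2.trans hy.1.2, (hball hy.2).1⟩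
    exact (measure_mono hsub).trans_lt hfin
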